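/- arXiv:0805.2569 — 8 statements merged into one kernel-verified Lean document; each statement's English description precedes it below -/
import Mathlib

section
/- Let ω₁, ω₂ ∈ ℂ be linearly independent over ℝ, let L = ℤω₁ + ℤω₂ be the lattice they generate, and suppose the Eisenstein invariants g₂ = 60·∑_{ω ∈ L∖{0}} ω⁻⁴ and g₃ = 140·∑_{ω ∈ L∖{0}} ω⁻⁶ are rational numbers. Then the entire function σ(x)/x = ∏_{ω ∈ L∖{0}} (1 − x/ω)·exp(x/ω + x²/(2ω²)) (the Weierstrass sigma function of L divided by x) is given by a power series with rational coefficients: there exists a sequence a : ℕ → ℚ with a₀ = 1 such that for every x ∈ ℂ, ∏_{ω ∈ L∖{0}} (1 − x/ω)·exp(x/ω + x²/(2ω²)) = ∑_{n=0}^{∞} aₙ xⁿ. -/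
open Filter Topology

/-- The Weierstrass elementary factor `(1 - z) exp (z + z² / 2)` of genus two. -/
noncomputable def elementaryFactorTwo (z : ℂ) : ℂ :=
  (1 - z) * Complex.exp (z + z ^ 2 / 2)

@[simp]
lemma elementaryFactorTwo_zero : elementaryFactorTwo 0 = 1 := by
  simp [elementaryFactorTwo]

lemma hasDerivAt_elementaryFactorTwo (z : ℂ) :
    HasDerivAt elementaryFactorTwo (-z ^ 2 * Complex.exp (z + z ^ 2 / 2)) z := by
  have h₁ : HasDerivAt (fun z : ℂ ↦ z + z ^ 2 / 2) (1 + z) z := by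
    convert! (hasDerivAt_id' z).add ((hasDerivAt_pow 2 z).div_const 2) using 1
    simp
  convert! ((hasDerivAt_id' z).const_sub 1).mul h₁.cexp using 1
  ring

lemma differentiable_elementaryFactorTwo : Differentiable ℂ elementaryFactorTwo :=
  fun z ↦ (hasDerivAt_elementaryFactorTwo z).differentiableAt

lemma norm_elementaryFactorTwo_sub_one_le {z : ℂ} (hz : ‖z‖ ≤ 1) :
    ‖elementaryFactorTwo z - 1‖ ≤ Real.exp 2 * ‖z‖ ^ 3 := by
  have key := (convex_closedBall (0 : ℂ) ‖z‖).norm_image_sub_le_of_norm_hasDerivWithin_le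
    (f := elementaryFactorTwo) (C := Real.exp 2 * ‖z‖ ^ 2) (x := 0) (y := z)
    (fun y _ ↦ (hasDerivAt_elementaryFactorTwo y).hasDerivWithinAt) ?_ (by simp) (by simp)
  · simpa [pow_succ, mul_assoc] using key
  · intro y hy
    have hy : ‖y‖ ≤ ‖z‖ := by simpa using hy
    have hy1 := hy.trans hz
    have hre : ‖y + y ^ 2 / 2‖ ≤ 2 := by
      refine (norm_add_le _ _).trans ?_
      rw [norm_div, norm_pow, Complex.norm_ofNat]
      nlinarith [norm_nonneg y]
    rw [norm_mul, norm_neg, norm_pow, mul_comm, Complex.norm_exp]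
    gcongr
    exact (Complex.re_le_norm _).trans hre

section CanonicalProduct

variable {ι : Type*} {u : ι → ℂ}

lemma multipliableLocallyUniformlyOn_elementaryFactorTwo
    (hu : Summable fun i ↦ ‖u i‖ ^ 3) {R : ℝ} (hR : 0 < R) :
    MultipliableLocallyUniformlyOn (fun i x ↦ elementaryFactorTwo (u i * x))
      (Metric.ball 0 R) := by
  have key := Summable.multipliableLocallyUniformlyOn_one_add (R := ℂ)
    (f := fun i x ↦ elementaryFactorTwo (u i * x) - 1)
    (u := fun i ↦ Real.exp 2 * R ^ 3 * ‖u i‖ ^ 3) (K := Metric.ball (0 : ℂ) R)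
    Metric.isOpen_ball (hu.mul_left _) ?_ fun i ↦ ?_
  · simpa using key
  · filter_upwards [hu.tendsto_cofinite_zero.eventually_lt_const
      (show 0 < (R⁻¹) ^ 3 by positivity)] with i hi x hx
    have hi : ‖u i‖ < R⁻¹ := lt_of_pow_lt_pow_left₀ 3 (by positivity) hi
    have hx : ‖x‖ ≤ R := by simpa using (mem_ball_zero_iff.mp hx).le
    have h1 : ‖u i * x‖ ≤ 1 := by
      rw [norm_mul, ← inv_mul_cancel₀ hR.ne']
      gcongr
    refine (norm_elementaryFactorTwo_sub_one_le h1).trans ?_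
    rw [norm_mul, mul_pow, mul_assoc, mul_comm (R ^ 3)]
    gcongr
  · exact ((differentiable_elementaryFactorTwo.comp (by fun_prop)).sub_const 1
      : Differentiable ℂ fun x ↦ elementaryFactorTwo (u i * x) - 1).continuous.continuousOn

lemma differentiable_elementaryFactorTwo_mul (c : ℂ) :
    Differentiable ℂ fun x ↦ elementaryFactorTwo (c * x) :=
  differentiable_elementaryFactorTwo.comp (by fun_prop)

lemma differentiable_tprod_elementaryFactorTwo (hu : Summable fun i ↦ ‖u i‖ ^ 3) :
    Differentiable ℂ fun x ↦ ∏' i, elementaryFactorTwo (u i * x) := by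
  intro x
  have hR : 0 < ‖x‖ + 1 := by positivity
  have h := (multipliableLocallyUniformlyOn_elementaryFactorTwo hu hR).hasProdLocallyUniformlyOn
  rw [hasProdLocallyUniformlyOn_iff_tendstoLocallyUniformlyOn] at h
  refine (h.differentiableOn (.of_forall fun s ↦ ?_) Metric.isOpen_ball).differentiableAt
    (Metric.isOpen_ball.mem_nhds (by simp))
  exact DifferentiableOn.fun_finsetProd fun i _ ↦
    (differentiable_elementaryFactorTwo_mul (u i)).differentiableOn

lemma logDeriv_elementaryFactorTwo_mul {c x : ℂ} (h : c * x ≠ 1) :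
    logDeriv (fun y ↦ elementaryFactorTwo (c * y)) x = -(c ^ 3 * x ^ 2 * (1 - c * x)⁻¹) := by
  have hd : HasDerivAt (fun y ↦ elementaryFactorTwo (c * y)) _ x :=
    (hasDerivAt_elementaryFactorTwo (c * x)).comp x ((hasDerivAt_id' x).const_mul c)
  have h1 : 1 - c * x ≠ 0 := sub_ne_zero.mpr h.symm
  rw [logDeriv_apply, hd.deriv, elementaryFactorTwo]
  have := Complex.exp_ne_zero (c * x + (c * x) ^ 2 / 2)
  field_simp

lemma exists_forall_norm_le_of_summable_norm_pow_three (hu : Summable fun i ↦ ‖u i‖ ^ 3) :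
    ∃ M > 0, ∀ i, ‖u i‖ ≤ M := by
  have h0 : 0 ≤ ∑' i, ‖u i‖ ^ 3 := tsum_nonneg fun i ↦ by positivity
  refine ⟨1 + ∑' i, ‖u i‖ ^ 3, by positivity, fun i ↦ ?_⟩
  have h := hu.le_tsum i fun j _ ↦ by positivity
  nlinarith [norm_nonneg (u i), sq_nonneg (‖u i‖ - 1), sq_nonneg (‖u i‖)]

lemma hasSum_geometric_swap (hu : Summable fun i ↦ ‖u i‖ ^ 3) {M : ℝ} (hM : ∀ i, ‖u i‖ ≤ M)
    {x : ℂ} (hx : M * ‖x‖ < 1) :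
    ∃ S, HasSum (fun i ↦ u i ^ 3 * x ^ 2 * (1 - u i * x)⁻¹) S ∧
      HasSum (fun n ↦ x ^ (n + 2) * ∑' i, u i ^ (n + 3)) S := by
  have hlt (i : ι) : ‖u i * x‖ < 1 := by
    rw [norm_mul]
    exact (mul_le_mul_of_nonneg_right (hM i) (norm_nonneg x)).trans_lt hx
  have hsum : Summable fun p : ι × ℕ ↦ u p.1 ^ 3 * x ^ 2 * (u p.1 * x) ^ p.2 := by
    by_cases hι : Nonempty ι
    · obtain ⟨i₀⟩ := hι
      have hM0 : 0 ≤ M := (norm_nonneg _).trans (hM i₀)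
      refine .of_norm_bounded ((hu.mul_right (‖x‖ ^ 2)).mul_of_nonneg
        (summable_geometric_of_lt_one (by positivity) hx) (fun i ↦ by positivity)
        fun n ↦ by positivity) fun p ↦ ?_
      simp only [norm_mul, norm_pow]
      gcongr
      exact hM _
    · have := not_nonempty_iff.mp hι
      exact .of_finite
  have hgeom (i : ι) : HasSum (fun n ↦ u i ^ 3 * x ^ 2 * (u i * x) ^ n)
      (u i ^ 3 * x ^ 2 * (1 - u i * x)⁻¹) :=
    (hasSum_geometric_of_norm_lt_one (hlt i)).mul_left _
  refine ⟨_, hsum.hasSum.prod_fiberwise hgeom, ?_⟩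
  have hswap := (Equiv.prodComm ℕ ι).hasSum_iff.mpr hsum.hasSum
  refine (hswap.prod_fiberwise fun n ↦ (hswap.summable.prod_factor n).hasSum).congr_fun fun n ↦ ?_
  rw [← tsum_mul_left]
  refine tsum_congr fun i ↦ ?_
  simp only [Function.comp_apply, Equiv.prodComm_apply, Prod.swap_prod_mk]
  ring

lemma hasFPowerSeriesAt_logDeriv_tprod_elementaryFactorTwo (hu : Summable fun i ↦ ‖u i‖ ^ 3) :
    HasFPowerSeriesAt (logDeriv fun x ↦ ∏' i, elementaryFactorTwo (u i * x))
      (.ofScalars ℂ fun n ↦ if n < 2 then 0 else -∑' i, u i ^ (n + 1)) 0 := by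
  obtain ⟨M, hM0, hM⟩ := exists_forall_norm_le_of_summable_norm_pow_three hu
  have hne : ∀ᶠ x in 𝓝 (0 : ℂ), ∏' i, elementaryFactorTwo (u i * x) ≠ 0 :=
    (differentiable_tprod_elementaryFactorTwo hu).continuous.continuousAt.eventually_ne (by simp)
  rw [hasFPowerSeriesAt_iff]
  filter_upwards [hne, Metric.ball_mem_nhds 0 (inv_pos.mpr hM0)] with x hx hxM
  have hxM : M * ‖x‖ < 1 := by
    rw [← mul_inv_cancel₀ hM0.ne']
    exact mul_lt_mul_of_pos_left (mem_ball_zero_iff.mp hxM) hM0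
  have h1 (i : ι) : u i * x ≠ 1 := fun h ↦ by
    have := congrArg norm h
    rw [norm_mul, norm_one] at this
    exact absurd this ((mul_le_mul_of_nonneg_right (hM i) (norm_nonneg x)).trans_lt hxM).ne
  obtain ⟨S, hS₁, hS₂⟩ := hasSum_geometric_swap hu hM hxM
  have hlog : HasSum (fun i ↦ logDeriv (fun y ↦ elementaryFactorTwo (u i * y)) x) (-S) := by
    simpa only [logDeriv_elementaryFactorTwo_mul (h1 _)] using hS₁.neg
  have hR : 0 < ‖x‖ + 1 := by positivity
  have h := logDeriv_tprod_eq_tsum Metric.isOpen_ball (x := x) (by simp)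
    (f := fun i y ↦ elementaryFactorTwo (u i * y))
    (fun i ↦ mul_ne_zero (sub_ne_zero.mpr (h1 i).symm) (Complex.exp_ne_zero _))
    (fun i ↦ (differentiable_elementaryFactorTwo_mul (u i)).differentiableOn)
    hlog.summable (multipliableLocallyUniformlyOn_elementaryFactorTwo hu hR) hx
  rw [zero_add, h, hlog.tsum_eq, ← hasSum_nat_add_iff' 2]
  simpa [FormalMultilinearSeries.coeff_ofScalars, Finset.sum_range_succ, add_assoc] using hS₂.neg

end CanonicalProduct

open PowerSeries in
/-- The Taylor series at `0` of a function, as a formal power series. -/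
noncomputable def taylorPowerSeries (f : ℂ → ℂ) : ℂ⟦X⟧ :=
  .mk fun n ↦ iteratedDeriv n f 0 / n.factorial

namespace taylorPowerSeries

open PowerSeries

variable {f g : ℂ → ℂ}

lemma coeff_eq (f : ℂ → ℂ) (n : ℕ) :
    coeff n (taylorPowerSeries f) = iteratedDeriv n f 0 / n.factorial :=
  coeff_mk _ _

lemma eq_mk_of_hasFPowerSeriesAt {c : ℕ → ℂ} (h : HasFPowerSeriesAt f (.ofScalars ℂ c) 0) :
    taylorPowerSeries f = .mk c := by
  ext n
  have := congrArg (fun p ↦ p.coeff n)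
    (h.analyticAt.hasFPowerSeriesAt.eq_formalMultilinearSeries h)
  simpa [coeff_eq, FormalMultilinearSeries.coeff_ofScalars] using this

lemma congr (h : f =ᶠ[𝓝 0] g) : taylorPowerSeries f = taylorPowerSeries g := by
  ext n
  rw [coeff_eq, coeff_eq, h.iteratedDeriv_eq]

protected lemma add (hf : AnalyticAt ℂ f 0) (hg : AnalyticAt ℂ g 0) :
    taylorPowerSeries (fun z ↦ f z + g z) = taylorPowerSeries f + taylorPowerSeries g := by
  ext n
  rw [map_add, coeff_eq, coeff_eq, coeff_eq,
    iteratedDeriv_fun_add hf.contDiffAt hg.contDiffAt, add_div]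

protected lemma sub (hf : AnalyticAt ℂ f 0) (hg : AnalyticAt ℂ g 0) :
    taylorPowerSeries (fun z ↦ f z - g z) = taylorPowerSeries f - taylorPowerSeries g := by
  ext n
  rw [map_sub, coeff_eq, coeff_eq, coeff_eq,
    iteratedDeriv_fun_sub hf.contDiffAt hg.contDiffAt, sub_div]

protected lemma mul (hf : AnalyticAt ℂ f 0) (hg : AnalyticAt ℂ g 0) :
    taylorPowerSeries (fun z ↦ f z * g z) = taylorPowerSeries f * taylorPowerSeries g := by
  ext n
  rw [coeff_mul, coeff_eq, iteratedDeriv_fun_mul hf.contDiffAt hg.contDiffAt,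
    Finset.Nat.sum_antidiagonal_eq_sum_range_succ
      (fun i j ↦ coeff i (taylorPowerSeries f) * coeff j (taylorPowerSeries g)), Finset.sum_div]
  refine Finset.sum_congr rfl fun i hi ↦ ?_
  rw [coeff_eq, coeff_eq, Nat.cast_choose ℂ (by grind : i ≤ n)]
  have := n.factorial_ne_zero
  field_simp

protected lemma const (c : ℂ) : taylorPowerSeries (fun _ ↦ c) = C c := by
  ext n
  rw [coeff_eq, iteratedDeriv_const, coeff_C]
  split_ifs with h <;> simp [h]

protected lemma pow (hf : AnalyticAt ℂ f 0) (n : ℕ) :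
    taylorPowerSeries (fun z ↦ f z ^ n) = taylorPowerSeries f ^ n := by
  induction n with
  | zero => simpa only [pow_zero, map_one] using taylorPowerSeries.const 1
  | succ n ih => simp_rw [pow_succ, taylorPowerSeries.mul (hf.fun_pow n) hf, ih]

protected lemma id : taylorPowerSeries (fun z ↦ z) = X := by
  ext n
  rw [coeff_eq, iteratedDeriv_fun_id_zero, coeff_X]
  split_ifs with h <;> simp [h]

protected lemma deriv (f : ℂ → ℂ) :
    taylorPowerSeries (deriv f) = d⁄dX ℂ (taylorPowerSeries f) := by
  ext n
  rw [coeff_derivative, coeff_eq, coeff_eq, iteratedDeriv_succ', Nat.factorial_succ]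
  have := n.factorial_ne_zero
  have : (n : ℂ) + 1 ≠ 0 := n.cast_add_one_ne_zero
  push_cast
  field_simp

end taylorPowerSeries

section TruncatedCoefficients

open PowerSeries

/-- The power series whose coefficients up to degree `n` lie in a given subring. -/
def coeffLESubring {R : Type*} [CommRing R] (K : Subring R) (n : ℕ) : Subring R⟦X⟧ where
  carrier := {P | ∀ k ≤ n, coeff k P ∈ K}
  mul_mem' {P Q} hP hQ k hk := by
    rw [coeff_mul]
    refine K.sum_mem fun p hp ↦ ?_
    rw [Finset.HasAntidiagonal.mem_antidiagonal] at hp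
    exact K.mul_mem (hP _ (by lia)) (hQ _ (by lia))
  one_mem' k _ := by
    rw [coeff_one]
    split_ifs
    exacts [K.one_mem, K.zero_mem]
  add_mem' hP hQ k hk := by
    rw [map_add]
    exact K.add_mem (hP k hk) (hQ k hk)
  zero_mem' k _ := by simp
  neg_mem' hP k hk := by
    rw [map_neg]
    exact K.neg_mem (hP k hk)

section

variable {R : Type*} [CommRing R] {K : Subring R} {n : ℕ}

lemma mem_coeffLESubring {P : R⟦X⟧} :
    P ∈ coeffLESubring K n ↔ ∀ k ≤ n, coeff k P ∈ K := Iff.rfl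

lemma C_mem_coeffLESubring {c : R} (hc : c ∈ K) : C c ∈ coeffLESubring K n := fun k _ ↦ by
  rw [coeff_C]
  split_ifs
  exacts [hc, K.zero_mem]

lemma X_mem_coeffLESubring : X ∈ coeffLESubring K n := fun k _ ↦ by
  rw [coeff_X]
  split_ifs
  exacts [K.one_mem, K.zero_mem]

lemma X_mul_derivative_mem_coeffLESubring {P : R⟦X⟧} (hP : P ∈ coeffLESubring K n) :
    X * d⁄dX R P ∈ coeffLESubring K n := fun k hk ↦ by
  cases k with
  | zero => simp
  | succ k =>
    rw [coeff_succ_X_mul, coeff_derivative]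
    exact K.mul_mem (hP _ hk) (K.add_mem (natCast_mem K k) K.one_mem)

end

variable {F : Type*} [Field F] [CharZero F] {K : Subfield F}

/-- A power series solution of `P' = P * H` has coefficients in any subfield containing its
constant coefficient and the coefficients of `H`. -/
lemma coeff_mem_of_derivative_eq_mul {P H : F⟦X⟧} (hPH : d⁄dX F P = P * H)
    (h0 : coeff 0 P ∈ K) (hH : ∀ n, coeff n H ∈ K) (n : ℕ) : coeff n P ∈ K := by
  induction n using Nat.strong_induction_on with
  | _ n ih =>
    cases n with
    | zero => exact h0
    | succ n =>
      have hmem : P * H ∈ coeffLESubring K.toSubring n :=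
        mul_mem (fun k hk ↦ ih k (by lia)) fun k _ ↦ hH k
      have h := hmem n le_rfl
      rw [← hPH, coeff_derivative] at h
      have hn : (n : F) + 1 ≠ 0 := n.cast_add_one_ne_zero
      rw [← mul_div_cancel_right₀ (coeff (n + 1) P) hn]
      exact K.div_mem h (K.add_mem (natCast_mem K n) K.one_mem)

/-- If `P` is the regular part at `0` of a formal solution `X⁻² + P` of the Weierstrass
differential equation with invariants in a subfield, then `P` has coefficients in that subfield. -/
lemma coeff_mem_of_weierstrass_equation {P : F⟦X⟧} {a b : F} (ha : a ∈ K) (hb : b ∈ K)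
    (hP : (d⁄dX F P * X ^ 3 - C 2) ^ 2 =
      C 4 * (P * X ^ 2 + C 1) ^ 3 - C a * (P * X ^ 6 + X ^ 4) - C b * X ^ 6) (n : ℕ) :
    coeff n P ∈ K := by
  set D := X * d⁄dX F P with hD
  set Q := C 12 * P ^ 2 + C 4 * P ^ 3 * X ^ 2 - C a - C a * P * X ^ 2 - C b * X ^ 2 - D ^ 2
    with hQ
  have hX : (X : F⟦X⟧) ^ 2 ≠ 0 := pow_ne_zero 2 X_ne_zero
  have key : C 4 * D + C 12 * P = -(X ^ 2 * Q) := by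
    refine mul_left_cancel₀ hX ?_
    simp only [hQ, hD, map_ofNat, map_one] at hP ⊢
    linear_combination -hP
  induction n using Nat.strong_induction_on with
  | _ n ih =>
    have hcoeff : coeff n (C 4 * D + C 12 * P) = (4 * n + 12) * coeff n P := by
      rw [map_add, coeff_C_mul, coeff_C_mul, hD]
      cases n with
      | zero => simp
      | succ n =>
        rw [coeff_succ_X_mul, coeff_derivative]
        push_cast
        ring
    have hmem : (4 * n + 12 : F) * coeff n P ∈ K := by
      rw [← hcoeff, key, map_neg, coeff_X_pow_mul']
      split_ifs with hn
      · have hPn : P ∈ coeffLESubring K.toSubring (n - 2) := fun k hk ↦ ih k (by lia)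
        have hDn := X_mul_derivative_mem_coeffLESubring hPn
        have hXn : X ∈ coeffLESubring K.toSubring (n - 2) := X_mem_coeffLESubring
        have han : C a ∈ coeffLESubring K.toSubring (n - 2) := C_mem_coeffLESubring ha
        have hbn : C b ∈ coeffLESubring K.toSubring (n - 2) := C_mem_coeffLESubring hb
        have hQn : Q ∈ coeffLESubring K.toSubring (n - 2) := by
          rw [hQ, map_ofNat, map_ofNat]
          refine sub_mem (sub_mem (sub_mem (sub_mem (add_mem (mul_mem (ofNat_mem _ 12)
            (pow_mem hPn 2)) (mul_mem (mul_mem (ofNat_mem _ 4) (pow_mem hPn 3))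
            (pow_mem hXn 2))) han) ?_) (mul_mem hbn (pow_mem hXn 2))) (pow_mem hDn 2)
          exact mul_mem (mul_mem han hPn) (pow_mem hXn 2)
        exact K.neg_mem (hQn _ le_rfl)
      · simp
    have hne : (4 * n + 12 : F) ≠ 0 := mod_cast (by lia : 4 * n + 12 ≠ 0)
    rw [← mul_div_cancel_left₀ (coeff n P) hne]
    exact K.div_mem hmem
      (K.add_mem (K.mul_mem (ofNat_mem K 4) (natCast_mem K n)) (ofNat_mem K 12))

end TruncatedCoefficients

namespace PeriodPair

open PowerSeries
open scoped PeriodPair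

variable (Λ : PeriodPair) {K : Subfield ℂ}

lemma weierstrassPExcept_zero_relation :
    (fun z ↦ (℘'[Λ - (0 : ℂ)] z * z ^ 3 - 2) ^ 2) =ᶠ[𝓝 0] fun z ↦
      4 * (℘[Λ - (0 : ℂ)] z * z ^ 2 + 1) ^ 3 -
      Λ.g₂ * (℘[Λ - (0 : ℂ)] z * z ^ 6 + z ^ 4) - Λ.g₃ * z ^ 6 := by
  filter_upwards [Λ.compl_lattice_sdiff_singleton_mem_nhds _] with z hz
  by_cases hz0 : z = 0
  · simp [hz0]; norm_num
  have hz : z ∉ Λ.lattice := by simp_all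
  have hp : ℘[Λ - (0 : ℂ)] z * z ^ 2 + 1 = ℘[Λ] z * z ^ 2 := by
    have := Λ.weierstrassPExcept_def 0 z
    simp only [ZeroMemClass.coe_zero, sub_zero] at this
    rw [this]
    field_simp
    simp
  have hd : ℘'[Λ - (0 : ℂ)] z * z ^ 3 - 2 = ℘'[Λ] z * z ^ 3 := by
    have := Λ.derivWeierstrassPExcept_def 0 z
    simp only [ZeroMemClass.coe_zero, sub_zero] at this
    rw [this]
    field_simp
    ring
  rw [hd, hp]
  linear_combination z ^ 6 * Λ.derivWeierstrassP_sq z hz + Λ.g₂ * z ^ 4 * hp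

lemma taylorPowerSeries_weierstrassPExcept_zero :
    taylorPowerSeries ℘[Λ - (0 : ℂ)] =
      .mk fun n ↦ if n = 0 then 0 else ((n : ℂ) + 1) * Λ.G (n + 2) := by
  simpa using taylorPowerSeries.eq_mk_of_hasFPowerSeriesAt
    (Λ.hasFPowerSeriesAt_weierstrassPExcept 0)

lemma taylorPowerSeries_derivWeierstrassPExcept_zero :
    taylorPowerSeries ℘'[Λ - (0 : ℂ)] = d⁄dX ℂ (taylorPowerSeries ℘[Λ - (0 : ℂ)]) := by
  rw [← taylorPowerSeries.deriv]
  refine (taylorPowerSeries.congr ?_).symm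
  exact Λ.eqOn_deriv_weierstrassPExcept_derivWeierstrassPExcept 0 |>.eventuallyEq_of_mem
    (Λ.compl_lattice_sdiff_singleton_mem_nhds 0)

lemma taylorPowerSeries_weierstrass_equation {P : ℂ⟦X⟧}
    (hP : P = taylorPowerSeries ℘[Λ - (0 : ℂ)]) :
    (d⁄dX ℂ P * X ^ 3 - C 2) ^ 2 =
      C 4 * (P * X ^ 2 + C 1) ^ 3 - C Λ.g₂ * (P * X ^ 6 + X ^ 4) - C Λ.g₃ * X ^ 6 := by
  have h := taylorPowerSeries.congr Λ.weierstrassPExcept_zero_relation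
  repeat first
    | rw [taylorPowerSeries.sub (by fun_prop) (by fun_prop)] at h
    | rw [taylorPowerSeries.add (by fun_prop) (by fun_prop)] at h
    | rw [taylorPowerSeries.mul (by fun_prop) (by fun_prop)] at h
    | rw [taylorPowerSeries.pow (by fun_prop)] at h
  simpa only [taylorPowerSeries.const, taylorPowerSeries.id,
    taylorPowerSeries_derivWeierstrassPExcept_zero, ← hP] using h

/-- All Eisenstein sums of a lattice lie in any field containing its invariants. -/
lemma G_mem_of_g₂_mem_of_g₃_mem (h₂ : Λ.g₂ ∈ K) (h₃ : Λ.g₃ ∈ K) (n : ℕ) : Λ.G (n + 3) ∈ K := by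
  have h := coeff_mem_of_weierstrass_equation h₂ h₃
    (Λ.taylorPowerSeries_weierstrass_equation rfl) (n + 1)
  rw [taylorPowerSeries_weierstrassPExcept_zero, coeff_mk, if_neg (by lia)] at h
  have hne : ((n + 1 : ℕ) : ℂ) + 1 ≠ 0 := Nat.cast_add_one_ne_zero _
  rw [← mul_div_cancel_left₀ (Λ.G (n + 3)) hne]
  exact K.div_mem h (K.add_mem (natCast_mem K _) K.one_mem)

/-- The Weierstrass sigma function of a lattice, divided by the variable. -/
noncomputable def sigmaDivSelf (x : ℂ) : ℂ :=
  ∏' l : Λ.lattice, elementaryFactorTwo ((l : ℂ)⁻¹ * x)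

lemma summable_norm_inv_pow_three : Summable fun l : Λ.lattice ↦ ‖(l : ℂ)⁻¹‖ ^ 3 := by
  simpa using ZLattice.summable_norm_pow_inv Λ.lattice 3 (by simp)

lemma differentiable_sigmaDivSelf : Differentiable ℂ Λ.sigmaDivSelf :=
  differentiable_tprod_elementaryFactorTwo Λ.summable_norm_inv_pow_three

@[simp]
lemma sigmaDivSelf_zero : Λ.sigmaDivSelf 0 = 1 := by
  simp [sigmaDivSelf]

lemma derivative_taylorPowerSeries_sigmaDivSelf :
    d⁄dX ℂ (taylorPowerSeries Λ.sigmaDivSelf) = taylorPowerSeries Λ.sigmaDivSelf *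
      .mk fun n ↦ if n < 2 then 0 else -Λ.G (n + 1) := by
  have hH := hasFPowerSeriesAt_logDeriv_tprod_elementaryFactorTwo Λ.summable_norm_inv_pow_three
  have hmk := taylorPowerSeries.eq_mk_of_hasFPowerSeriesAt hH
  simp only [inv_pow] at hmk
  change taylorPowerSeries (logDeriv Λ.sigmaDivSelf) =
    .mk fun n ↦ if n < 2 then 0 else -Λ.G (n + 1) at hmk
  rw [← hmk, ← taylorPowerSeries.deriv,
    ← taylorPowerSeries.mul (Λ.differentiable_sigmaDivSelf.analyticAt 0)
    (show AnalyticAt ℂ (logDeriv Λ.sigmaDivSelf) 0 from hH.analyticAt)]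
  refine taylorPowerSeries.congr ?_
  filter_upwards [Λ.differentiable_sigmaDivSelf.continuous.continuousAt.eventually_ne
    (by simp : Λ.sigmaDivSelf 0 ≠ 0)] with x hx
  rw [logDeriv_apply, mul_div_cancel₀ _ hx]

/-- The Taylor coefficients of the sigma function lie in any field containing the invariants. -/
lemma coeff_taylorPowerSeries_sigmaDivSelf_mem (h₂ : Λ.g₂ ∈ K) (h₃ : Λ.g₃ ∈ K) (n : ℕ) :
    coeff n (taylorPowerSeries Λ.sigmaDivSelf) ∈ K := by
  refine coeff_mem_of_derivative_eq_mul Λ.derivative_taylorPowerSeries_sigmaDivSelf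
    (by simp [taylorPowerSeries.coeff_eq]) (fun n ↦ ?_) n
  rw [coeff_mk]
  split_ifs with hn
  · exact K.zero_mem
  · obtain ⟨m, rfl⟩ := Nat.exists_eq_add_of_le' (not_lt.mp hn)
    exact K.neg_mem (Λ.G_mem_of_g₂_mem_of_g₃_mem h₂ h₃ m)

lemma sigmaDivSelf_eq_tsum (x : ℂ) :
    Λ.sigmaDivSelf x = ∑' n, coeff n (taylorPowerSeries Λ.sigmaDivSelf) * x ^ n := by
  rw [← Complex.taylorSeries_eq_of_entire' 0 x Λ.differentiable_sigmaDivSelf]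
  simp only [taylorPowerSeries.coeff_eq, sub_zero, div_eq_inv_mul]

lemma mem_lattice_iff_mem_closure (z : ℂ) :
    z ∈ Λ.lattice ↔ z ∈ AddSubgroup.closure {Λ.ω₁, Λ.ω₂} := by
  rw [lattice, ← Submodule.span_int_eq_addSubgroupClosure, Submodule.mem_toAddSubgroup]

/-- A product over the lattice of a function with value `1` at `0` is the product over the nonzero
lattice vectors; likewise for a sum over the lattice of a function with value `0` at `0`. -/
@[to_additive]
lemma tprod_ne_zero_eq {M : Type*} [CommMonoid M] [TopologicalSpace M] {L : AddSubgroup ℂ}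
    (hL : ∀ z, z ∈ Λ.lattice ↔ z ∈ L) {f : ℂ → M} (hf : f 0 = 1) :
    ∏' w : {z : ℂ // z ∈ L ∧ z ≠ 0}, f w = ∏' l : Λ.lattice, f l := by
  let e (w : {z : ℂ // z ∈ L ∧ z ≠ 0}) : Λ.lattice := ⟨w, (hL w).mpr w.2.1⟩
  have he : Function.Injective e := fun v w h ↦ Subtype.ext (congrArg (fun l : Λ.lattice ↦ (l : ℂ)) h)
  refine he.tprod_eq (f := fun l : Λ.lattice ↦ f l) fun l hl ↦ ?_
  refine ⟨⟨l, (hL l).mp l.2, fun h0 ↦ hl ?_⟩, rfl⟩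
  simp only [h0, hf]

end PeriodPair

/-- If the Eisenstein invariants `g₂ = 60 ∑_{ω ∈ L∖{0}} ω⁻⁴` and
`g₃ = 140 ∑_{ω ∈ L∖{0}} ω⁻⁶` of the lattice `L = ℤω₁ + ℤω₂` are rational, then
`σ(x)/x = ∏_{ω ∈ L∖{0}} (1 - x/ω) exp(x/ω + x²/(2ω²))` is given by a power series
with rational coefficients and constant term `1`. -/
theorem sigma_div_x_rational_coeffs (ω₁ ω₂ : ℂ) (hindep : LinearIndependent ℝ ![ω₁, ω₂])
    (L : AddSubgroup ℂ) (hL : L = AddSubgroup.closure {ω₁, ω₂})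
    (hg₂ : ∃ q : ℚ, (60 : ℂ) * ∑' w : {z : ℂ // z ∈ L ∧ z ≠ 0}, ((w : ℂ) ^ 4)⁻¹ = q)
    (hg₃ : ∃ q : ℚ, (140 : ℂ) * ∑' w : {z : ℂ // z ∈ L ∧ z ≠ 0}, ((w : ℂ) ^ 6)⁻¹ = q) :
    ∃ a : ℕ → ℚ, a 0 = 1 ∧ ∀ x : ℂ,
      (∏' w : {z : ℂ // z ∈ L ∧ z ≠ 0},
        (1 - x / (w : ℂ)) * Complex.exp (x / (w : ℂ) + x ^ 2 / (2 * (w : ℂ) ^ 2)))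
      = ∑' n : ℕ, (a n : ℂ) * x ^ n := by
  let Λ : PeriodPair := ⟨ω₁, ω₂, hindep⟩
  have hΛ (z : ℂ) : z ∈ Λ.lattice ↔ z ∈ L := hL ▸ Λ.mem_lattice_iff_mem_closure z
  have hG (n : ℕ) (hn : n ≠ 0) :
      ∑' w : {z : ℂ // z ∈ L ∧ z ≠ 0}, ((w : ℂ) ^ n)⁻¹ = Λ.G n :=
    Λ.tsum_ne_zero_eq hΛ (f := fun z ↦ (z ^ n)⁻¹) (by simp [hn])
  rw [hG 4 (by simp)] at hg₂
  rw [hG 6 (by simp)] at hg₃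
  have h₂ : Λ.g₂ ∈ (Rat.castHom ℂ).fieldRange := hg₂.imp fun q hq ↦ hq.symm
  have h₃ : Λ.g₃ ∈ (Rat.castHom ℂ).fieldRange := hg₃.imp fun q hq ↦ hq.symm
  choose a ha using Λ.coeff_taylorPowerSeries_sigmaDivSelf_mem h₂ h₃
  replace ha (n : ℕ) : (a n : ℂ) = PowerSeries.coeff n (taylorPowerSeries Λ.sigmaDivSelf) := ha n
  refine ⟨a, ?_, fun x ↦ ?_⟩
  · have h0 := ha 0
    rw [taylorPowerSeries.coeff_eq] at h0
    exact_mod_cast (by simpa using h0 : (a 0 : ℂ) = 1)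
  · simp_rw [ha]
    rw [← Λ.sigmaDivSelf_eq_tsum, PeriodPair.sigmaDivSelf, ← Λ.tprod_ne_zero_eq hΛ
      (f := fun z ↦ elementaryFactorTwo (z⁻¹ * x)) (by simp)]
    refine tprod_congr fun w ↦ ?_
    rw [elementaryFactorTwo, mul_comm, ← div_eq_inv_mul, mul_comm]
    congr 3
    rw [div_pow, div_div, mul_comm 2]
end

section
/- (Hurwitz) For every complex number α there exists a sequence a : ℕ → ℚ of rational numbers, not identically zero, such that the power series p(z) = ∑_{n=0}^{∞} aₙ zⁿ converges absolutely for every z ∈ ℂ, defines an entire function of exponential growth (there is a constant C > 0 with |p(z)| ≤ C·e^{C|z|} for all z ∈ ℂ), and satisfies p(α) = 0. -/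
/-- A real linear form of two variables can be approximated by its values at rational points. -/
theorem exists_rat_approx_of_real_relation {α x : ℂ} {r s B ε : ℝ} (hε : 0 < ε)
    (hr : |r| ≤ B) (hs : |s| ≤ B) (h : x + r + s * α = 0) :
    ∃ p q : ℚ, |(p : ℝ)| ≤ B + ε ∧ |(q : ℝ)| ≤ B + ε ∧ ‖x + p + q * α‖ ≤ ε := by
  have hα : 0 < 1 + ‖α‖ := by positivity
  have hδ : 0 < ε / (1 + ‖α‖) := by positivity
  have hδε : ε / (1 + ‖α‖) ≤ ε := div_le_self hε.le (by linarith [norm_nonneg α])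
  obtain ⟨p, hp⟩ := exists_rat_near r hδ
  obtain ⟨q, hq⟩ := exists_rat_near s hδ
  have hp' : ‖((p : ℝ) - r : ℝ)‖ ≤ ε / (1 + ‖α‖) := by
    rw [Real.norm_eq_abs, abs_sub_comm]; exact hp.le
  have hq' : ‖((q : ℝ) - s : ℝ)‖ ≤ ε / (1 + ‖α‖) := by
    rw [Real.norm_eq_abs, abs_sub_comm]; exact hq.le
  refine ⟨p, q, ?_, ?_, ?_⟩
  · rw [Real.norm_eq_abs] at hp'
    have := abs_add_le ((p : ℝ) - r) r
    rw [sub_add_cancel] at this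
    linarith
  · rw [Real.norm_eq_abs] at hq'
    have := abs_add_le ((q : ℝ) - s) s
    rw [sub_add_cancel] at this
    linarith
  · have e : x + p + q * α = (((p : ℝ) - r : ℝ) : ℂ) + (((q : ℝ) - s : ℝ) : ℂ) * α := by
      push_cast
      linear_combination h
    rw [e]
    calc _ ≤ ‖((p : ℝ) - r : ℝ)‖ + ‖((q : ℝ) - s : ℝ)‖ * ‖α‖ := by
          refine (norm_add_le _ _).trans ?_
          rw [norm_mul, Complex.norm_real, Complex.norm_real]
      _ ≤ ε / (1 + ‖α‖) + ε / (1 + ‖α‖) * ‖α‖ := by gcongr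
      _ = ε := by field_simp

/-- Every complex number `α` lies in a subfield of `ℂ` which is spanned over `ℝ` by `1` and `α`,
with coefficients depending boundedly on the element. -/
theorem exists_subfield_real_span_one_self (α : ℂ) :
    ∃ (V : Subfield ℂ) (K : ℝ), 0 ≤ K ∧ α ∈ V ∧
      ∀ x ∈ V, ∃ r s : ℝ, |r| ≤ K * ‖x‖ ∧ |s| ≤ K * ‖x‖ ∧ x + r + s * α = 0 := by
  by_cases h : α.im = 0
  · refine ⟨Complex.ofRealHom.fieldRange, 1, zero_le_one, ⟨α.re, ?_⟩, ?_⟩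
    · apply Complex.ext <;> simp [h]
    · rintro _ ⟨t, rfl⟩
      exact ⟨-t, 0, by simp, by simp, by simp⟩
  · have him : 0 < |α.im| := abs_pos.2 h
    refine ⟨⊤, 1 + (1 + ‖α‖) / |α.im|, by positivity, trivial, fun x _ =>
      ⟨-(x.re - x.im / α.im * α.re), -(x.im / α.im), ?_, ?_, ?_⟩⟩
    · have h1 : |x.im / α.im * α.re| ≤ ‖x‖ / |α.im| * ‖α‖ := by
        rw [abs_mul, abs_div]
        gcongr
        · exact Complex.abs_im_le_norm x
        · exact Complex.abs_re_le_norm α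
      have h2 := abs_sub x.re (x.im / α.im * α.re)
      have h3 := Complex.abs_re_le_norm x
      have h4 : 0 ≤ ‖x‖ / |α.im| := by positivity
      rw [abs_neg]
      have e : (1 + (1 + ‖α‖) / |α.im|) * ‖x‖ = ‖x‖ + ‖x‖ / |α.im| + ‖x‖ / |α.im| * ‖α‖ := by
        ring
      linarith
    · have h1 : |x.im / α.im| ≤ ‖x‖ / |α.im| := by
        rw [abs_div]
        gcongr
        exact Complex.abs_im_le_norm x
      have h4 : 0 ≤ ‖x‖ / |α.im| * ‖α‖ := by positivity
      rw [abs_neg]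
      have e : (1 + (1 + ‖α‖) / |α.im|) * ‖x‖ = ‖x‖ + ‖x‖ / |α.im| + ‖x‖ / |α.im| * ‖α‖ := by
        ring
      linarith [norm_nonneg x]
    · apply Complex.ext
      · simp
      · simp [h]

open Filter Topology Nat in
/-- For `α ≠ 0` there is a rational sequence with factorial decay and nonzero constant term whose
partial sums at `α` of odd length tend to zero. -/
theorem exists_rat_seq_factorial_decay {α : ℂ} (hα : α ≠ 0) :
    ∃ (b : ℕ → ℚ) (M : ℝ), b 0 = 1 ∧ (∀ n, |(b n : ℝ)| ≤ M / n !) ∧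
      Tendsto (fun k => ∑ n ∈ Finset.range (2 * k + 1), (b n : ℂ) * α ^ n) atTop (𝓝 0) := by
  obtain ⟨V, K, hK, hαV, hV⟩ := exists_subfield_real_span_one_self α
  have step : ∀ (k : ℕ) (x : V), ∃ p q : ℚ,
      |(p : ℝ)| ≤ K * ‖(x : ℂ)‖ + 1 / (2 * k + 4)! ∧
      |(q : ℝ)| ≤ K * ‖(x : ℂ)‖ + 1 / (2 * k + 4)! ∧
      ‖(x : ℂ) + p + q * α‖ ≤ 1 / (2 * k + 4)! := by
    intro k x
    obtain ⟨r, s, hr, hs, h⟩ := hV x x.2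
    exact exists_rat_approx_of_real_relation (by positivity) hr hs h
  choose p q hp hq hpq using step
  obtain ⟨T, hT0, hTs⟩ : ∃ T : ℕ → V, (T 0 : ℂ) = α⁻¹ ∧
      ∀ k, (T (k + 1) : ℂ) = ((T k : ℂ) + p k (T k) + q k (T k) * α) / α ^ 2 := by
    let a : V := ⟨α, hαV⟩
    refine ⟨fun k => Nat.rec a⁻¹ (fun k x => (x + (p k x : V) + (q k x : V) * a) / a ^ 2) k,
      rfl, fun k => ?_⟩
    push_cast
    rfl
  obtain ⟨b, hb0, hb1, hb2⟩ : ∃ b : ℕ → ℚ, b 0 = 1 ∧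
      (∀ k, b (2 * k + 1) = p k (T k)) ∧ ∀ k, b (2 * k + 2) = q k (T k) := by
    refine ⟨fun n => Nat.casesOn n 1
      (fun m => if Even m then p (m / 2) (T (m / 2)) else q (m / 2) (T (m / 2))), rfl,
      fun k => by simp, fun k => ?_⟩
    have h1 : ¬ Even (2 * k + 1) := by simp
    have h2 : (2 * k + 1) / 2 = k := by omega
    simp only [if_neg h1, h2]
  have hsum (k : ℕ) : ∑ n ∈ Finset.range (2 * k + 1), (b n : ℂ) * α ^ n
      = α ^ (2 * k + 1) * T k := by
    induction k with
    | zero => simp [hb0, hT0, hα]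
    | succ k ih =>
      rw [show 2 * (k + 1) + 1 = 2 * k + 1 + 1 + 1 by ring, Finset.sum_range_succ,
        Finset.sum_range_succ, ih, hb1, show 2 * k + 1 + 1 = 2 * k + 2 by ring, hb2, hTs]
      field_simp
      ring
  have hα' : 0 < ‖α‖ := norm_pos_iff.2 hα
  let L : ℝ := 2 * ‖α‖⁻¹ + ‖α‖⁻¹ ^ 2
  have hL : 0 ≤ L := by positivity
  have hTL (k : ℕ) : ‖(T k : ℂ)‖ ≤ L / (2 * k + 2)! := by
    cases k with
    | zero =>
      rw [hT0, norm_inv]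
      have : 0 < ‖α‖⁻¹ := by positivity
      simp only [L, mul_zero, zero_add, Nat.factorial_two]
      push_cast
      nlinarith [sq_nonneg ‖α‖⁻¹]
    | succ k =>
      rw [hTs, norm_div, norm_pow]
      calc _ ≤ (1 / (2 * k + 4)! : ℝ) / ‖α‖ ^ 2 := by
            gcongr
            exact hpq k (T k)
        _ = ‖α‖⁻¹ ^ 2 / (2 * k + 4)! := by field_simp
        _ ≤ L / (2 * k + 4)! := by
            gcongr
            exact le_add_of_nonneg_left (by positivity)
  have hfac {m n : ℕ} (h : m ≤ n) : (1 : ℝ) / n ! ≤ 1 / m ! := by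
    gcongr
  have hcoef {k m : ℕ} (hm : m ≤ 2 * k + 2) :
      K * ‖(T k : ℂ)‖ + 1 / (2 * k + 4)! ≤ (K * L + 1) / m ! := by
    calc _ ≤ K * (L / (2 * k + 2)!) + 1 / (2 * k + 4)! := by gcongr; exact hTL k
      _ = K * L * (1 / (2 * k + 2)!) + 1 / (2 * k + 4)! := by ring
      _ ≤ K * L * (1 / m !) + 1 / m ! := by
          gcongr ?_ + ?_
          · exact mul_le_mul_of_nonneg_left (hfac hm) (by positivity)
          · exact hfac (by omega)
      _ = _ := by ring
  refine ⟨b, K * L + 1, hb0, fun n => ?_, ?_⟩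
  · rcases n with _ | m
    · have : 0 ≤ K * L := by positivity
      simpa [hb0]
    · rcases Nat.even_or_odd' m with ⟨k, rfl | rfl⟩
      · rw [hb1]
        exact (hp k _).trans (hcoef (by omega))
      · rw [show 2 * k + 1 + 1 = 2 * k + 2 by ring, hb2]
        exact (hq k _).trans (hcoef le_rfl)
  · simp_rw [hsum]
    have hlim := ((FloorSemiring.tendsto_pow_div_factorial_atTop ‖α‖).comp
      (tendsto_atTop_mono (fun k : ℕ => (by omega : k ≤ 2 * k + 1)) tendsto_id)).const_mul L
    rw [mul_zero] at hlim
    refine squeeze_zero_norm (fun k => ?_) hlim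
    rw [norm_mul, norm_pow]
    calc _ ≤ ‖α‖ ^ (2 * k + 1) * (L * (1 / (2 * k + 2)!)) := by
          gcongr
          exact (hTL k).trans_eq (by ring)
      _ ≤ ‖α‖ ^ (2 * k + 1) * (L * (1 / (2 * k + 1)!)) := by
          gcongr ?_ * (_ * ?_)
          exact hfac (by omega)
      _ = _ := by
          simp only [Function.comp_apply]
          ring

/-- (Hurwitz) For every complex number `α` there is a power series with rational
coefficients, not identically zero, which converges absolutely on all of `ℂ`, defines
an entire function of exponential growth, and vanishes at `α`. -/
theorem hurwitz_vanishing_series (α : ℂ) :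
    ∃ a : ℕ → ℚ, a ≠ 0 ∧
      (∀ z : ℂ, Summable fun n : ℕ => ‖(a n : ℂ) * z ^ n‖) ∧
      (∃ C : ℝ, 0 < C ∧ ∀ z : ℂ,
        ‖∑' n : ℕ, (a n : ℂ) * z ^ n‖ ≤ C * Real.exp (C * ‖z‖)) ∧
      (∑' n : ℕ, (a n : ℂ) * α ^ n) = 0 := by
  suffices h : ∃ (a : ℕ → ℚ) (M : ℝ), a ≠ 0 ∧ (∀ n, |(a n : ℝ)| ≤ M / n.factorial) ∧
      ((∀ z : ℂ, Summable fun n : ℕ => (a n : ℂ) * z ^ n) →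
        (∑' n : ℕ, (a n : ℂ) * α ^ n) = 0) by
    obtain ⟨a, M, ha, hM, h0⟩ := h
    have hterm (z : ℂ) (n : ℕ) : ‖(a n : ℂ) * z ^ n‖ ≤ M * (‖z‖ ^ n / n.factorial) := by
      rw [norm_mul, norm_pow, show ‖(a n : ℂ)‖ = |(a n : ℝ)| by
        rw [← Complex.ofReal_ratCast, Complex.norm_real, Real.norm_eq_abs]]
      calc _ ≤ M / n.factorial * ‖z‖ ^ n := by gcongr; exact hM n
        _ = _ := by ring
    have hexp (z : ℂ) : HasSum (fun n : ℕ => M * (‖z‖ ^ n / n.factorial))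
        (M * Real.exp ‖z‖) := by
      rw [Real.exp_eq_exp_ℝ]
      exact (NormedSpace.expSeries_div_hasSum_exp ‖z‖).mul_left M
    have hs (z : ℂ) : Summable fun n : ℕ => ‖(a n : ℂ) * z ^ n‖ :=
      Summable.of_nonneg_of_le (fun _ => norm_nonneg _) (hterm z) (hexp z).summable
    refine ⟨a, ha, hs, ⟨max M 1, by positivity, fun z => ?_⟩, h0 fun z => (hs z).of_norm⟩
    calc _ ≤ M * Real.exp ‖z‖ := tsum_of_norm_bounded (hexp z) (hterm z)
      _ ≤ max M 1 * Real.exp (max M 1 * ‖z‖) := by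
        gcongr
        · exact le_max_left _ _
        · exact le_mul_of_one_le_left (norm_nonneg z) (le_max_right _ _)
  rcases eq_or_ne α 0 with rfl | hα
  · refine ⟨Pi.single 1 1, 1, by simp, fun n => ?_, fun _ => ?_⟩
    · rcases eq_or_ne n 1 with rfl | hn
      · simp
      · rw [Pi.single_eq_of_ne hn, Rat.cast_zero, abs_zero]
        positivity
    · refine (tsum_congr fun n => ?_).trans tsum_zero
      rcases eq_or_ne n 0 with rfl | hn <;> simp [*]
  · obtain ⟨b, M, hb0, hb, hlim⟩ := exists_rat_seq_factorial_decay hα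
    refine ⟨b, M, fun h => by simp [h] at hb0, hb, fun hs => ?_⟩
    exact tendsto_nhds_unique ((hs α).hasSum.tendsto_sum_nat.comp
      (Filter.tendsto_atTop_mono (fun k : ℕ => (by omega : k ≤ 2 * k + 1)) Filter.tendsto_id)) hlim
end

section
/- For any two complex numbers α and β there exists a sequence a : ℕ → ℚ of rational numbers, not identically zero, such that the power series p(z) = ∑_{n=0}^{∞} aₙ zⁿ converges absolutely for every z ∈ ℂ, defines an entire function of exponential growth (there is a constant C > 0 with |p(z)| ≤ C·e^{C|z|} for all z ∈ ℂ), and satisfies p(α) = 0 and p(β) = 0. -/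
open Polynomial in
/-- Every pair of complex numbers lies in the zero set of `X * q` for some real polynomial `q`
with constant term `1`. -/
lemma exists_real_polynomial_constantCoeff_one_vanishing (α β : ℂ) :
    ∃ q : ℝ[X], q.coeff 0 = 1 ∧ aeval α (X * q) = 0 ∧ aeval β (X * q) = 0 := by
  have single (w : ℂ) : ∃ q : ℝ[X], q.coeff 0 = 1 ∧ aeval w (X * q) = 0 := by
    by_cases hw : w = 0
    · exact ⟨1, by simp, by simp [hw]⟩
    · have h : w * (starRingEnd ℂ) w = (Complex.normSq w : ℂ) := Complex.mul_conj w
      have hs : w + (starRingEnd ℂ) w = ((2 * w.re : ℝ) : ℂ) := Complex.add_conj w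
      have hne : (Complex.normSq w : ℂ) ≠ 0 := by simpa using hw
      refine ⟨1 - C (2 * w.re / Complex.normSq w) * X + C (Complex.normSq w)⁻¹ * X ^ 2,
        by simp [coeff_zero_eq_eval_zero], ?_⟩
      have : aeval w (1 - C (2 * w.re / Complex.normSq w) * X
          + C (Complex.normSq w)⁻¹ * X ^ 2) = 0 := by
        simp only [map_add, map_sub, map_one, map_mul, aeval_C, aeval_X, map_pow,
          Complex.coe_algebraMap, Complex.ofReal_div, Complex.ofReal_inv]
        rw [← hs]
        field_simp
        rw [← h]
        ring
      rw [map_mul, this, mul_zero]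
  obtain ⟨p, hp, hpα⟩ := single α
  obtain ⟨q, hq, hqβ⟩ := single β
  refine ⟨p * q, by simp [mul_coeff_zero, hp, hq], ?_, ?_⟩
  · rw [← mul_assoc, map_mul, hpα, zero_mul]
  · rw [mul_left_comm, map_mul, hqβ, mul_zero]

/-- Multipliers `t` chosen recursively so that the Cauchy product of `t` and `q` takes the values
`r n s`, where `s` is the contribution of the previous multipliers. -/
noncomputable def cauchyMultiplier (q : ℕ → ℝ) (r : ℕ → ℝ → ℚ) : ℕ → ℝ
  | n => r n (∑ i : Fin n, cauchyMultiplier q r i * q (n - i)) -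
      ∑ i : Fin n, cauchyMultiplier q r i * q (n - i)

/-- A real sequence with initial term `1` has a Cauchy product with some arbitrarily small positive
sequence all of whose terms are rational. -/
lemma exists_pos_lt_cauchyProduct_rational (q : ℕ → ℝ) (hq : q 0 = 1) (δ : ℕ → ℝ)
    (hδ : ∀ n, 0 < δ n) :
    ∃ t : ℕ → ℝ, (∀ n, 0 < t n ∧ t n < δ n) ∧
      ∀ n, ∃ r : ℚ, ∑ p ∈ Finset.HasAntidiagonal.antidiagonal n, t p.1 * q p.2 = r := by
  have approx (n : ℕ) (s : ℝ) : ∃ r : ℚ, s < r ∧ (r : ℝ) < s + δ n :=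
    exists_rat_btwn (lt_add_of_pos_right s (hδ n))
  choose r hr using approx
  have eqn (n : ℕ) := cauchyMultiplier.eq_1 q r n
  refine ⟨cauchyMultiplier q r, fun n => ?_, fun n =>
    ⟨r n (∑ i : Fin n, cauchyMultiplier q r i * q (n - i)), ?_⟩⟩
  · rw [eqn]
    have := hr n (∑ i : Fin n, cauchyMultiplier q r i * q (n - i))
    constructor <;> linarith [this.1, this.2]
  · rw [Finset.Nat.sum_antidiagonal_eq_sum_range_succ
        (fun i j => cauchyMultiplier q r i * q j), Finset.sum_range_succ, Nat.sub_self, hq,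
      mul_one, eqn n, Finset.sum_range (fun i => cauchyMultiplier q r i * q (n - i))]
    ring

/-- A real polynomial has at most exponential growth on `ℂ`. -/
lemma Polynomial.exists_norm_aeval_le_mul_exp (Q : Polynomial ℝ) :
    ∃ C : ℝ, 0 ≤ C ∧ ∀ z : ℂ, ‖Polynomial.aeval z Q‖ ≤ C * Real.exp ‖z‖ := by
  refine ⟨∑ j ∈ Finset.range (Q.natDegree + 1), |Q.coeff j| * j.factorial,
    by positivity, fun z => ?_⟩
  rw [Polynomial.aeval_eq_sum_range, Finset.sum_mul]
  refine (norm_sum_le _ _).trans (Finset.sum_le_sum fun j _ => ?_)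
  rw [norm_smul, norm_pow, Real.norm_eq_abs, mul_assoc]
  gcongr
  have := Real.pow_div_factorial_le_exp ‖z‖ (norm_nonneg z) j
  rwa [div_le_iff₀ (by positivity), mul_comm] at this

/-- (Hurwitz) For any two complex numbers `α`, `β` there is a power series with rational
coefficients, not identically zero, which converges absolutely on all of `ℂ`, defines
an entire function of exponential growth, and vanishes at both `α` and `β`. -/
theorem hurwitz_two_points_vanishing_series (α β : ℂ) :
    ∃ a : ℕ → ℚ, a ≠ 0 ∧
      (∀ z : ℂ, Summable fun n : ℕ => ‖(a n : ℂ) * z ^ n‖) ∧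
      (∃ C : ℝ, 0 < C ∧ ∀ z : ℂ,
        ‖∑' n : ℕ, (a n : ℂ) * z ^ n‖ ≤ C * Real.exp (C * ‖z‖)) ∧
      (∑' n : ℕ, (a n : ℂ) * α ^ n) = 0 ∧
      (∑' n : ℕ, (a n : ℂ) * β ^ n) = 0 := by
  obtain ⟨q, hq, hα, hβ⟩ := exists_real_polynomial_constantCoeff_one_vanishing α β
  obtain ⟨t, ht, hrat⟩ := exists_pos_lt_cauchyProduct_rational q.coeff hq
    (fun n => 1 / (n.factorial : ℝ)) (fun n => by positivity)
  set Q : Polynomial ℝ := Polynomial.X * q with hQ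
  have hratQ (n : ℕ) : ∃ r : ℚ,
      ∑ p ∈ Finset.HasAntidiagonal.antidiagonal n, t p.1 * Q.coeff p.2 = r := by
    cases n with
    | zero => exact ⟨0, by simp [hQ]⟩
    | succ n =>
      obtain ⟨r, hr⟩ := hrat n
      refine ⟨r, ?_⟩
      rw [Finset.Nat.sum_antidiagonal_succ', ← hr]
      simp [hQ, Polynomial.coeff_X_mul]
  choose a ha using hratQ
  have ha1 : a 1 ≠ 0 := by
    intro h
    have h1 := ha 1
    rw [h, Finset.Nat.sum_antidiagonal_succ'] at h1
    simp [hQ, Polynomial.coeff_X_mul, hq, (ht 0).1.ne'] at h1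
  have bound (z : ℂ) (n : ℕ) : ‖(t n : ℂ) * z ^ n‖ ≤ ‖z‖ ^ n / n.factorial := by
    rw [norm_mul, norm_pow, Complex.norm_real, Real.norm_of_nonneg (ht n).1.le, div_eq_mul_one_div,
      mul_comm]
    gcongr
    exact (ht n).2.le
  have sumt (z : ℂ) : Summable fun n => ‖(t n : ℂ) * z ^ n‖ :=
    (Real.summable_pow_div_factorial ‖z‖).of_nonneg_of_le (fun _ => norm_nonneg _) (bound z)
  have hasSumQ (z : ℂ) : HasSum (fun n => (Q.coeff n : ℂ) * z ^ n) (Polynomial.aeval z Q) := by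
    rw [Polynomial.aeval_eq_sum_range]
    simp only [Complex.real_smul]
    refine hasSum_sum_of_ne_finset_zero fun n hn => ?_
    rw [Polynomial.coeff_eq_zero_of_natDegree_lt (by simpa using hn)]
    simp
  have sumQ (z : ℂ) : Summable fun n => ‖(Q.coeff n : ℂ) * z ^ n‖ := (hasSumQ z).summable.norm
  have cauchy (z : ℂ) : (fun n => ∑ p ∈ Finset.HasAntidiagonal.antidiagonal n,
      ((t p.1 : ℂ) * z ^ p.1) * ((Q.coeff p.2 : ℂ) * z ^ p.2)) = fun n => (a n : ℂ) * z ^ n := by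
    funext n
    have h : ((a n : ℚ) : ℂ) = ((a n : ℝ) : ℂ) := by norm_cast
    rw [h, ← ha n]
    push_cast
    rw [Finset.sum_mul]
    refine Finset.sum_congr rfl fun p hp => ?_
    rw [← Finset.HasAntidiagonal.mem_antidiagonal.mp hp, pow_add]
    ring
  have value (z : ℂ) : ∑' n, (a n : ℂ) * z ^ n
      = (∑' n, (t n : ℂ) * z ^ n) * Polynomial.aeval z Q := by
    rw [← cauchy z, ← (hasSumQ z).tsum_eq]
    exact (tsum_mul_tsum_eq_tsum_sum_antidiagonal_of_summable_norm (sumt z) (sumQ z)).symm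
  refine ⟨a, fun h => ha1 (congrFun h 1), fun z => ?_, ?_, by rw [value, hα, mul_zero],
    by rw [value, hβ, mul_zero]⟩
  · have := summable_norm_sum_mul_antidiagonal_of_summable_norm (sumt z) (sumQ z)
    exact this.congr fun n => congrArg norm (congrFun (cauchy z) n)
  · obtain ⟨C, hC, hCQ⟩ := Q.exists_norm_aeval_le_mul_exp
    refine ⟨C + 2, by positivity, fun z => ?_⟩
    have ht_le : ‖∑' n, (t n : ℂ) * z ^ n‖ ≤ Real.exp ‖z‖ := by
      refine tsum_of_norm_bounded ?_ (bound z)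
      rw [Real.exp_eq_exp_ℝ]
      exact NormedSpace.expSeries_div_hasSum_exp ‖z‖
    rw [value, norm_mul]
    calc _ ≤ Real.exp ‖z‖ * (C * Real.exp ‖z‖) :=
          mul_le_mul ht_le (hCQ z) (norm_nonneg _) (Real.exp_pos _).le
      _ = C * Real.exp (2 * ‖z‖) := by rw [two_mul, Real.exp_add]; ring
      _ ≤ (C + 2) * Real.exp ((C + 2) * ‖z‖) := by gcongr <;> linarith
end

section
/- For every complex number α, the set of sequences a : ℕ → ℚ, not identically zero, such that the series p(z) = ∑_{n=0}^{∞} aₙ zⁿ converges absolutely for every z ∈ ℂ, the resulting entire function has exponential growth (there is C > 0 with |p(z)| ≤ C·e^{C|z|} for all z), and p(α) = 0, is uncountable. -/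
open Filter Topology

theorem exists_rat_ne_abs_sub_le (t : ℚ) (x : ℝ) {δ : ℝ} (hδ : 0 < δ) :
    ∃ q : ℚ, q ≠ t ∧ |x - q| ≤ δ := by
  obtain ⟨q, hq₁, hq₂⟩ := exists_rat_btwn (show x < x + δ by linarith)
  obtain ⟨r, hr₁, hr₂⟩ := exists_rat_btwn hq₁
  by_cases h : q = t
  · refine ⟨r, ?_, ?_⟩
    · rintro rfl
      rw [h] at hr₂
      exact lt_irrefl _ hr₂
    · rw [abs_le]
      constructor <;> linarith
  · refine ⟨q, h, ?_⟩
    rw [abs_le]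
    constructor <;> linarith

/-- A second order linear recurrence can be perturbed by rational numbers avoiding prescribed
values so that its solution decays factorially. -/
theorem exists_perturbed_recurrence (c d : ℝ) (t : ℕ → ℚ) :
    ∃ (f : ℕ → ℝ) (a : ℕ → ℚ), f 0 = 0 ∧ f 1 = 0 ∧ (∀ n, a n ≠ t n) ∧
      (∀ n, f (n + 2) = c * f (n + 1) - d * f n - a n) ∧
      ∀ n, |f n| ≤ ((n.factorial : ℝ))⁻¹ := by
  have key (n : ℕ) (x : ℝ) : ∃ q : ℚ, q ≠ t n ∧ |x - q| ≤ (((n + 2).factorial : ℝ))⁻¹ :=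
    exists_rat_ne_abs_sub_le (t n) x (by positivity)
  choose pick hne hle using key
  let F : ℕ → ℝ × ℝ := fun n => Nat.rec (0, 0)
    (fun k p => (p.2, c * p.2 - d * p.1 - pick k (c * p.2 - d * p.1))) n
  refine ⟨fun n => (F n).1, fun n => pick n (c * (F n).2 - d * (F n).1), rfl, rfl,
    fun n => hne _ _, fun n => rfl, fun n => ?_⟩
  match n with
  | 0 => simp [F]
  | 1 => simp [F]
  | k + 2 => exact hle k _

theorem sum_range_recurrence_mul_pow {c d α : ℂ} (hα : d * α ^ 2 - c * α + 1 = 0)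
    {f a : ℕ → ℂ} (h₀ : f 0 = 0) (h₁ : f 1 = 0)
    (hf : ∀ n, f (n + 2) = c * f (n + 1) - d * f n - a n) (n : ℕ) :
    α * ∑ k ∈ Finset.range n, a k * α ^ k = d * f n * α ^ (n + 1) - f (n + 1) * α ^ n := by
  induction n with
  | zero => simp [h₀, h₁]
  | succ n ih =>
    rw [Finset.sum_range_succ, mul_add, ih]
    linear_combination α ^ (n + 1) * hf n - f (n + 1) * α ^ n * hα

theorem summable_norm_mul_pow_of_le_factorial {a : ℕ → ℂ} {M : ℝ}
    (ha : ∀ n, ‖a n‖ ≤ M / n.factorial) (z : ℂ) :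
    Summable fun n => ‖a n * z ^ n‖ := by
  refine Summable.of_nonneg_of_le (fun n => norm_nonneg _) (fun n => ?_)
    ((Real.summable_pow_div_factorial ‖z‖).mul_left M)
  rw [norm_mul, norm_pow]
  calc ‖a n‖ * ‖z‖ ^ n ≤ M / n.factorial * ‖z‖ ^ n := by gcongr; exact ha n
    _ = M * (‖z‖ ^ n / n.factorial) := by ring

theorem norm_tsum_mul_pow_le_exp {a : ℕ → ℂ} {M : ℝ}
    (ha : ∀ n, ‖a n‖ ≤ M / n.factorial) (z : ℂ) :
    ‖∑' n, a n * z ^ n‖ ≤ M * Real.exp ‖z‖ := by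
  have hexp : HasSum (fun n : ℕ => ‖z‖ ^ n / n.factorial) (Real.exp ‖z‖) := by
    rw [Real.exp_eq_exp_ℝ]
    exact NormedSpace.expSeries_div_hasSum_exp ‖z‖
  refine tsum_of_norm_bounded (hexp.mul_left M) fun n => ?_
  rw [norm_mul, norm_pow]
  calc ‖a n‖ * ‖z‖ ^ n ≤ M / n.factorial * ‖z‖ ^ n := by gcongr; exact ha n
    _ = M * (‖z‖ ^ n / n.factorial) := by ring

theorem exists_vanishing_series_avoiding_of_ne_zero {α : ℂ} (hα : α ≠ 0) (t : ℕ → ℚ) :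
    ∃ (a : ℕ → ℚ) (M : ℝ), 1 ≤ M ∧ (∀ n, a n ≠ t n) ∧
      (∀ n, ‖(a n : ℂ)‖ ≤ M / n.factorial) ∧ ∑' n, (a n : ℂ) * α ^ n = 0 := by
  have hN : Complex.normSq α ≠ 0 := by simpa using hα
  set d : ℝ := (Complex.normSq α)⁻¹ with hd
  set c : ℝ := 2 * α.re * d with hc
  have hroot : (d : ℂ) * α ^ 2 - c * α + 1 = 0 := by
    have hN' : (Complex.normSq α : ℂ) ≠ 0 := by exact_mod_cast hN
    have h₁ : (Complex.normSq α : ℂ) * d = 1 := by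
      rw [hd]; push_cast; exact mul_inv_cancel₀ hN'
    have h₂ := Complex.mul_conj α
    have h₃ := Complex.add_conj α
    have h₄ : (c : ℂ) = 2 * α.re * d := by rw [hc]; push_cast; ring
    push_cast at h₃
    rw [h₄]
    linear_combination (d * α) * h₃ - d * h₂ - h₁
  obtain ⟨f, a, hf₀, hf₁, hne, hf, hle⟩ := exists_perturbed_recurrence c d t
  have hbound (n : ℕ) : ‖(a n : ℂ)‖ ≤ (1 + |c| + |d|) / n.factorial := by
    have mono {m k : ℕ} (h : m ≤ k) : ((k.factorial : ℝ))⁻¹ ≤ ((m.factorial : ℝ))⁻¹ := by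
      gcongr
    have h₀ := hle n
    have h₁ := (hle (n + 1)).trans (mono n.le_succ)
    have h₂ := (hle (n + 2)).trans (mono (n.le_add_right 2))
    have e : (a n : ℝ) = c * f (n + 1) - d * f n - f (n + 2) := by rw [hf]; ring
    have hn : ‖(a n : ℂ)‖ = |(a n : ℝ)| := by
      rw [← Real.norm_eq_abs, ← Complex.norm_real]; simp
    calc ‖(a n : ℂ)‖ = |c * f (n + 1) - d * f n - f (n + 2)| := by rw [hn, e]
      _ ≤ |c * f (n + 1)| + |d * f n| + |f (n + 2)| :=
        (abs_sub _ _).trans (add_le_add_left (abs_sub _ _) _)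
      _ = |c| * |f (n + 1)| + |d| * |f n| + |f (n + 2)| := by
        rw [abs_mul c, abs_mul d]
      _ ≤ |c| * ((n.factorial : ℝ))⁻¹ + |d| * ((n.factorial : ℝ))⁻¹
          + ((n.factorial : ℝ))⁻¹ := by gcongr
      _ = _ := by ring
  refine ⟨a, 1 + |c| + |d|, by linarith [abs_nonneg c, abs_nonneg d], hne, hbound, ?_⟩
  have hsum := (summable_norm_mul_pow_of_le_factorial hbound α).of_norm.hasSum.tendsto_sum_nat
  have hpart := sum_range_recurrence_mul_pow hroot (f := fun n => (f n : ℂ))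
    (a := fun n => (a n : ℂ)) (by simp [hf₀]) (by simp [hf₁])
    (fun n => by simp only [hf]; push_cast; ring)
  have hlim : Tendsto (fun n => (f n : ℂ) * α ^ n) atTop (𝓝 0) := by
    refine (summable_norm_mul_pow_of_le_factorial (M := 1) (fun n => ?_)
      α).of_norm.tendsto_atTop_zero
    rw [Complex.norm_real, one_div]
    exact hle n
  have hlim' := (tendsto_add_atTop_iff_nat 1).2 hlim
  have hzero : Tendsto
      (fun n => α * (α * ∑ k ∈ Finset.range n, (a k : ℂ) * α ^ k)) atTop (𝓝 0) := by
    have := (hlim.const_mul ((d : ℂ) * α ^ 2)).sub hlim'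
    rw [mul_zero, sub_zero] at this
    refine this.congr fun n => ?_
    rw [hpart]
    ring
  have := tendsto_nhds_unique ((hsum.const_mul α).const_mul α) hzero
  simpa [hα] using this

theorem exists_vanishing_series_avoiding (α : ℂ) (t : ℕ → ℚ) :
    ∃ (a : ℕ → ℚ) (M : ℝ), 1 ≤ M ∧ (∀ n, a (n + 1) ≠ t n) ∧
      (∀ n, ‖(a n : ℂ)‖ ≤ M / n.factorial) ∧ ∑' n, (a n : ℂ) * α ^ n = 0 := by
  by_cases hα : α = 0
  · have key (n : ℕ) : ∃ q : ℚ, q ≠ t n ∧ |(0 : ℝ) - q| ≤ 1 / ((n + 1).factorial : ℝ) :=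
      exists_rat_ne_abs_sub_le (t n) 0 (by positivity)
    choose b hne hle using key
    refine ⟨fun n => Nat.casesOn n 0 b, 1, le_rfl, hne, fun n => ?_, ?_⟩
    · cases n with
      | zero => simp
      | succ n =>
        have := hle n
        rw [zero_sub, abs_neg, ← Real.norm_eq_abs, ← Complex.norm_real] at this
        simpa using this
    · rw [tsum_eq_single 0 fun n hn => by simp [hα, hn]]
      simp
  · obtain ⟨a, M, hM, hne, h⟩ :=
      exists_vanishing_series_avoiding_of_ne_zero hα fun n => t (n - 1)
    exact ⟨a, M, hM, fun n => hne (n + 1), h⟩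

/-- For every complex number `α`, the set of not-identically-zero rational sequences
`a : ℕ → ℚ` whose power series converges absolutely everywhere, defines an entire
function of exponential growth, and vanishes at `α`, is uncountable. -/
theorem uncountably_many_vanishing_series (α : ℂ) :
    ¬ Set.Countable {a : ℕ → ℚ | a ≠ 0 ∧
      (∀ z : ℂ, Summable fun n : ℕ => ‖(a n : ℂ) * z ^ n‖) ∧
      (∃ C : ℝ, 0 < C ∧ ∀ z : ℂ,
        ‖∑' n : ℕ, (a n : ℂ) * z ^ n‖ ≤ C * Real.exp (C * ‖z‖)) ∧
      (∑' n : ℕ, (a n : ℂ) * α ^ n) = 0} := by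
  intro hS
  obtain ⟨s, hs⟩ := (hS.insert 0).exists_eq_range (Set.insert_nonempty _ _)
  obtain ⟨a, M, hM, hne, hle, hzero⟩ := exists_vanishing_series_avoiding α fun n => s n (n + 1)
  have ha : a ∉ Set.range s := by
    rintro ⟨n, rfl⟩
    exact hne n rfl
  rw [← hs, Set.mem_insert_iff, not_or] at ha
  refine ha.2 ⟨ha.1, summable_norm_mul_pow_of_le_factorial hle, ⟨M, by linarith, fun z => ?_⟩,
    hzero⟩
  refine (norm_tsum_mul_pow_le_exp hle z).trans ?_
  gcongr
  exact le_mul_of_one_le_left (norm_nonneg z) hM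
end

section
/- (Lindemann) The real number π is transcendental over ℚ: it is not a root of any nonzero polynomial with rational coefficients. -/
open Polynomial
open scoped Nat

universe u

theorem exists_isAlgClosed_isGalois (k : Type u) [Field k] [CharZero k] :
    ∃ (A : Type u) (_ : Field A) (_ : CharZero A) (_ : Algebra k A),
      IsAlgClosed A ∧ IsGalois k A :=
  ⟨AlgebraicClosure k, inferInstance, inferInstance, inferInstance, inferInstance, inferInstance⟩

theorem Multiset.exists_aroots_eq_of_map_gal_eq {A : Type*} [Field A] [Algebra ℚ A]
    [IsGalois ℚ A] (M : Multiset A) (hM : ∀ σ : Gal(A/ℚ), M.map σ = M) :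
    ∃ f : ℤ[X], f ≠ 0 ∧ f.aroots A = M := by
  set Q : A[X] := (M.map fun a ↦ X - C a).prod with hQ
  have hmap (σ : Gal(A/ℚ)) : Q.map (σ : A →+* A) = Q := by
    conv_rhs => rw [hQ, ← hM σ]
    simp [hQ, Polynomial.map_multiset_prod]
  have hlift : Q ∈ lifts (algebraMap ℚ A) := by
    rw [lifts_iff_coeff_lifts]
    intro n
    rw [InfiniteGalois.mem_range_algebraMap_iff_fixed]
    intro σ
    conv_rhs => rw [← hmap σ, coeff_map]
    rfl
  obtain ⟨q, hq⟩ := (mem_lifts _).1 hlift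
  obtain ⟨b, hbmem, hb⟩ := IsLocalization.integerNormalization_spec (nonZeroDivisors ℤ) q
  have hb0 : (b : A) ≠ 0 := by
    have := Algebra.charZero_of_charZero ℚ A
    exact_mod_cast nonZeroDivisors.ne_zero hbmem
  have hf : (IsLocalization.integerNormalization (nonZeroDivisors ℤ) q).map (algebraMap ℤ A) =
      C (b : A) * Q := by
    rw [IsScalarTower.algebraMap_eq ℤ ℚ A, ← Polynomial.map_map, hb, ← hq]
    simp [zsmul_eq_mul]
  refine ⟨IsLocalization.integerNormalization (nonZeroDivisors ℤ) q, ?_, ?_⟩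
  · intro h
    have hQ0 : Q ≠ 0 := (monic_multiset_prod_of_monic _ _ fun a _ ↦ monic_X_sub_C a).ne_zero
    rw [h, Polynomial.map_zero] at hf
    exact mul_ne_zero (C_ne_zero.2 hb0) hQ0 hf.symm
  · rw [aroots, hf, roots_C_mul _ hb0, hQ, roots_multiset_prod_X_sub_C]

theorem Polynomial.isIntegral_leadingCoeff_pow_mul_aeval {A : Type*} [CommRing A]
    {f g : ℤ[X]} {r : A} (hr : aeval r f = 0) {N : ℕ} (hN : g.natDegree ≤ N) :
    IsIntegral ℤ ((f.leadingCoeff : A) ^ N * aeval r g) := by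
  have h := isIntegral_leadingCoeff_smul f r hr
  rw [zsmul_eq_mul] at h
  rw [aeval_eq_sum_range, Finset.mul_sum]
  refine IsIntegral.sum _ fun i hi ↦ ?_
  obtain ⟨j, rfl⟩ := Nat.exists_eq_add_of_le
    ((Nat.lt_succ_iff.1 (Finset.mem_range.1 hi)).trans hN)
  have : (f.leadingCoeff : A) ^ (i + j) * g.coeff i • r ^ i =
      ((g.coeff i * f.leadingCoeff ^ j : ℤ) : A) * ((f.leadingCoeff : A) * r) ^ i := by
    rw [zsmul_eq_mul]; push_cast; ring
  rw [this]
  exact (isIntegral_algebraMap (R := ℤ) (A := A)).mul (h.pow i)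

theorem Polynomial.map_aroots_algHom {A : Type*} [Field A] [Algebra ℚ A] [IsAlgClosed A]
    (f : ℤ[X]) {B : Type*} [Field B] [Algebra ℚ B] (σ : A →ₐ[ℚ] B) :
    (f.aroots A).map σ = f.aroots B := by
  have := (IsAlgClosed.splits (f.map (algebraMap ℤ A))).roots_map (σ : A →+* B)
  rw [Polynomial.map_map, RingHom.ext_int ((σ : A →+* B).comp (algebraMap ℤ A))
    (algebraMap ℤ B)] at this
  exact this.symm

theorem Polynomial.exists_int_eq_leadingCoeff_pow_mul_sum_aroots (f g : ℤ[X]) {N : ℕ}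
    (hN : g.natDegree ≤ N) :
    ∃ z : ℤ, (f.leadingCoeff : ℂ) ^ N * ((f.aroots ℂ).map fun r ↦ aeval r g).sum = z := by
  obtain ⟨A, _, _, _, _, _⟩ := exists_isAlgClosed_isGalois ℚ
  let ι : A →ₐ[ℚ] ℂ := IsAlgClosed.lift
  set x : A := (f.leadingCoeff : A) ^ N * ((f.aroots A).map fun r ↦ aeval r g).sum with hx
  have hmap {B : Type} [Field B] [Algebra ℚ B] (σ : A →ₐ[ℚ] B) :
      σ x = (f.leadingCoeff : B) ^ N * ((f.aroots B).map fun r ↦ aeval r g).sum := by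
    have haeval (r : A) : σ (aeval r g) = aeval (σ r) g :=
      (aeval_algHom_apply (σ.restrictScalars ℤ) r g).symm
    rw [← map_aroots_algHom f σ, hx]
    simp [map_multiset_sum, haeval]
  have hint : IsIntegral ℤ x := by
    rw [hx, ← Multiset.sum_map_mul_left]
    refine IsIntegral.multiset_sum fun y hy ↦ ?_
    obtain ⟨r, hr, rfl⟩ := Multiset.mem_map.1 hy
    exact isIntegral_leadingCoeff_pow_mul_aeval (mem_aroots'.1 hr).2 hN
  obtain ⟨y, hy⟩ := (InfiniteGalois.mem_range_algebraMap_iff_fixed x).2 fun σ : Gal(A/ℚ) ↦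
    hmap (σ : A →ₐ[ℚ] A)
  rw [← hy, isIntegral_algebraMap_iff (algebraMap ℚ A).injective] at hint
  obtain ⟨z, rfl⟩ := IsIntegrallyClosed.isIntegral_iff.1 hint
  refine ⟨z, ?_⟩
  rw [← hmap ι, ← hy]
  simp

theorem Polynomial.intCast_add_sum_exp_aroots_ne_zero (f : ℤ[X]) (hf : f.eval 0 ≠ 0) {k : ℤ}
    (hk : k ≠ 0) : (k : ℂ) + ((f.aroots ℂ).map Complex.exp).sum ≠ 0 := by
  intro hsum
  obtain ⟨c, hc⟩ := LindemannWeierstrass.exp_polynomial_approx f hf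
  set a := f.leadingCoeff
  have ha0 : a ≠ 0 := leadingCoeff_ne_zero.2 (by rintro rfl; simp at hf)
  set D := f.natDegree
  set K : ℝ := |(a : ℝ)| ^ D * |c| with hK
  set m := Multiset.card (f.aroots ℂ)
  have hlim : ∀ᶠ n : ℕ in Filter.atTop, (m * K) * (K ^ n / n !) < 1 := by
    have := (FloorSemiring.tendsto_pow_div_factorial_atTop K).const_mul (m * K)
    rw [mul_zero] at this
    exact this.eventually_lt_const one_pos
  obtain ⟨n₀, hn₀⟩ := Filter.eventually_atTop.1 hlim
  obtain ⟨p, hp_ge, hp⟩ := Nat.exists_infinite_primes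
    ((f.eval 0).natAbs + a.natAbs + k.natAbs + n₀ + 1)
  obtain ⟨n, hpn, g, hg, happrox⟩ := hc p (by omega) hp
  obtain ⟨z, hz⟩ := exists_int_eq_leadingCoeff_pow_mul_sum_aroots f g
    (hg.trans (Nat.sub_le _ 1))
  have hp' : Prime (p : ℤ) := Nat.prime_iff_prime_int.1 hp
  have hndvd {b : ℤ} (hb : b ≠ 0) (hbp : b.natAbs < p) : ¬ (p : ℤ) ∣ b := fun h ↦
    absurd (Nat.le_of_dvd (Int.natAbs_pos.2 hb) (Int.natCast_dvd.1 h)) (by omega)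
  have hM : a ^ (p * D) * (n * k) + p * z ≠ 0 := by
    intro h
    have : (p : ℤ) ∣ a ^ (p * D) * (n * k) := ⟨-z, by linarith⟩
    rcases hp'.dvd_or_dvd this with h | h
    · exact hndvd ha0 (by omega) (hp'.dvd_of_dvd_pow h)
    · exact (hp'.dvd_or_dvd h).elim hpn (hndvd hk (by omega))
  have hnorm : ‖((f.aroots ℂ).map fun r ↦ n • Complex.exp r - p • aeval r g).sum‖ ≤
      m * (|c| ^ p / (p - 1)!) := by
    refine (norm_multiset_sum_le _).trans ?_
    refine (Multiset.sum_le_card_nsmul _ (|c| ^ p / (p - 1)!) ?_).trans (by simp [m])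
    simp only [Multiset.map_map, Multiset.mem_map, Function.comp_apply]
    rintro _ ⟨r, hr, rfl⟩
    refine (happrox hr).trans ?_
    exact div_le_div_of_nonneg_right ((le_abs_self _).trans (abs_pow c p).le) (by positivity)
  have hexp : ((f.aroots ℂ).map Complex.exp).sum = -k := by linear_combination hsum
  have heq : ((a ^ (p * D) * (n * k) + p * z : ℤ) : ℂ) =
      -((a : ℂ) ^ (p * D) *
        ((f.aroots ℂ).map fun r ↦ n • Complex.exp r - p • aeval r g).sum) := by
    simp only [Multiset.sum_map_sub, zsmul_eq_mul, nsmul_eq_mul, Multiset.sum_map_mul_left, hexp]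
    push_cast
    rw [← hz]
    ring
  have hle : (1 : ℝ) ≤ ‖((a ^ (p * D) * (n * k) + p * z : ℤ) : ℂ)‖ := by
    rw [Complex.norm_intCast]
    exact_mod_cast Int.one_le_abs hM
  have hlt := hn₀ (p - 1) (by omega)
  refine absurd (hle.trans_eq (congrArg _ heq)) (not_le.2 (lt_of_le_of_lt ?_ hlt))
  rw [norm_neg, norm_mul, norm_pow, Complex.norm_intCast]
  calc _ ≤ |(a : ℝ)| ^ (p * D) * (m * (|c| ^ p / (p - 1)!)) := by gcongr
    _ = m * (K ^ p / (p - 1)!) := by rw [hK, mul_pow, ← pow_mul, mul_comm D]; ring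
    _ = _ := by
      obtain ⟨q, rfl⟩ : ∃ q, p = q + 1 := ⟨p - 1, by omega⟩
      rw [Nat.add_sub_cancel, pow_succ]; ring

theorem Complex.exp_ne_neg_one_of_isAlgebraic {α : ℂ} (hα : IsAlgebraic ℚ α) :
    Complex.exp α ≠ -1 := by
  classical
  intro hexp
  obtain ⟨A, _, _, _, _, _⟩ := exists_isAlgClosed_isGalois ℚ
  let ι : A →ₐ[ℚ] ℂ := IsAlgClosed.lift
  obtain ⟨P, hP0, hP⟩ := (IsFractionRing.isAlgebraic_iff ℤ ℚ ℂ).2 hα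
  set R : Finset A := (P.aroots A).toFinset with hR
  have hRσ (σ : Gal(A/ℚ)) : R.image σ = R := by
    rw [hR, ← Multiset.toFinset_map]
    exact congrArg _ (map_aroots_algHom P (σ : A →ₐ[ℚ] A))
  set S : Multiset A := R.powerset.val.map fun s ↦ ∑ r ∈ s, r with hS
  have hSσ (σ : Gal(A/ℚ)) : S.map σ = S := by
    conv_rhs => rw [hS, ← hRσ σ, Finset.powerset_image,
      Finset.image_val_of_injOn (Finset.image_injective σ.injective).injOn]
    simp [hS, Finset.sum_image σ.injective.injOn]
  set M := S.filter (· ≠ 0) with hM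
  obtain ⟨f, hf0, hf⟩ := Multiset.exists_aroots_eq_of_map_gal_eq M fun σ ↦ by
    conv_rhs => rw [hM, ← hSσ σ]
    rw [Multiset.filter_map, hM]
    simp
  have hS0 : (0 : A) ∈ S := Multiset.mem_map.2 ⟨∅, by simp, by simp⟩
  refine intCast_add_sum_exp_aroots_ne_zero f ?_ (k := S.count 0) ?_ ?_
  · intro h
    have : (0 : A) ∈ f.aroots A := by
      rw [mem_aroots]
      refine ⟨hf0, ?_⟩
      have := aeval_algebraMap_apply_eq_algebraMap_eval (A := A) (0 : ℤ) f
      simpa [h] using this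
    simp [hf, hM] at this
  · exact_mod_cast (Multiset.count_pos.2 hS0).ne'
  · have hfilter : S.filter (· = 0) = Multiset.replicate (S.count 0) 0 := Multiset.filter_eq' S 0
    have hprod : ∏ r ∈ R, (1 + Complex.exp (ι r)) = 0 := by
      have hmem : α ∈ (P.aroots A).map ι := by
        rw [map_aroots_algHom P ι, mem_aroots]
        exact ⟨hP0, hP⟩
      obtain ⟨r, hr, rfl⟩ := Multiset.mem_map.1 hmem
      exact Finset.prod_eq_zero (Multiset.mem_toFinset.2 hr) (by rw [hexp]; ring)
    have hsum : (S.map fun r ↦ Complex.exp (ι r)).sum = 0 := by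
      rw [← hprod, Finset.prod_one_add, hS, Multiset.map_map]
      exact Finset.sum_congr rfl fun s _ ↦ by simp [Complex.exp_sum]
    rw [← map_aroots_algHom f ι, hf, hM, Multiset.map_map, ← hsum]
    conv_rhs => rw [← Multiset.filter_add_not (· = 0) S]
    rw [Multiset.map_add, Multiset.sum_add, hfilter]
    simp

/-- (Lindemann) The real number `π` is transcendental over `ℚ`: it is not a root of any
nonzero polynomial with rational coefficients. -/
theorem pi_transcendental : Transcendental ℚ Real.pi := by
  intro h
  have hI : IsAlgebraic ℚ Complex.I := (Complex.isIntegral_rat_I).isAlgebraic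
  exact Complex.exp_ne_neg_one_of_isAlgebraic
    ((h.algebraMap (A := ℂ)).mul hI) Complex.exp_pi_mul_I
end

section
/- (Schneider) Let ω₁, ω₂ ∈ ℂ be linearly independent over ℝ, let L = ℤω₁ + ℤω₂ be the lattice they generate, and suppose the Eisenstein invariants g₂ = 60·∑_{ω ∈ L∖{0}} ω⁻⁴ and g₃ = 140·∑_{ω ∈ L∖{0}} ω⁻⁶ are algebraic numbers. Then every nonzero element ω of L (i.e., every nonzero period of the associated elliptic curve) is transcendental over ℚ. -/
namespace SchneiderPeriods

open PowerSeries Nat Finset NumberField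

section Arithmetic

variable {K : Type*} [Field K]

/-- The coefficients of `f` up to index `n` become integral when multiplied by `a!`. -/
def FactorialIntegral (n : ℕ) (f : K⟦X⟧) : Prop :=
  ∀ a ≤ n, IsIntegral ℤ ((a ! : K) * coeff a f)

lemma FactorialIntegral.mul {n : ℕ} {f g : K⟦X⟧} (hf : FactorialIntegral n f)
    (hg : FactorialIntegral n g) : FactorialIntegral n (f * g) := by
  intro k hk
  rw [coeff_mul, mul_sum]
  refine IsIntegral.sum _ fun p hp ↦ ?_
  have hpn : p.1 + p.2 = k := by simpa using hp
  have hch : (k ! : K) = ((p.1 + p.2).choose p.2 : K) * p.1 ! * p.2 ! := by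
    rw [← hpn, ← Nat.add_choose_mul_factorial_mul_factorial]
    push_cast
    rfl
  have key : (k ! : K) * (coeff p.1 f * coeff p.2 g) =
      ((p.1 + p.2).choose p.2 : K) * ((p.1 ! * coeff p.1 f) * (p.2 ! * coeff p.2 g)) := by
    rw [hch]; ring
  rw [key]
  have hint : IsIntegral ℤ ((p.1 + p.2).choose p.2 : K) := by
    simpa using isIntegral_algebraMap (R := ℤ) (A := K) (x := ((p.1 + p.2).choose p.2 : ℤ))
  exact hint.mul ((hf _ (by omega)).mul (hg _ (by omega)))

lemma FactorialIntegral.one (n : ℕ) : FactorialIntegral n (1 : K⟦X⟧) := by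
  intro a _
  rw [coeff_one]
  split_ifs with h
  · subst h; simpa using isIntegral_one
  · simpa using isIntegral_zero

lemma FactorialIntegral.pow {n : ℕ} {f : K⟦X⟧} (hf : FactorialIntegral n f) (i : ℕ) :
    FactorialIntegral n (f ^ i) := by
  induction i with
  | zero => simpa using FactorialIntegral.one n
  | succ i ih => rw [pow_succ]; exact ih.mul hf

lemma factorialIntegral_C_add_X {n : ℕ} {x y : K} (hx : IsIntegral ℤ x) (hy : IsIntegral ℤ y) :
    FactorialIntegral n (C x + C y * X) := by
  intro a _
  rcases a with _ | _ | a
  · simpa using hx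
  · simpa [coeff_C] using hy
  · simpa [coeff_C, coeff_succ_mul_X] using isIntegral_zero

/-- Coefficientwise form of the differential equation `u'' = 6 u² - h`. -/
lemma coeff_of_derivative_derivative {u : K⟦X⟧} {h : K}
    (hu : d⁄dX K (d⁄dX K u) = 6 * (u * u) - C h) (n : ℕ) :
    ((n + 1 : ℕ) * (n + 2 : ℕ) : K) * coeff (n + 2) u =
      6 * coeff n (u * u) - if n = 0 then h else 0 := by
  have := congr_arg (coeff n) hu
  rw [coeff_derivative, coeff_derivative, map_sub, coeff_C] at this
  have h6 : coeff n (6 * (u * u)) = 6 * coeff n (u * u) := by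
    rw [show (6 : K⟦X⟧) = C (6 : K) from (map_ofNat C 6).symm, coeff_C_mul]
  rw [← h6, ← this]
  push_cast
  ring

lemma factorialIntegral_of_derivative_derivative {u : K⟦X⟧} {h : K}
    (hu : d⁄dX K (d⁄dX K u) = 6 * (u * u) - C h) (h0 : IsIntegral ℤ (coeff 0 u))
    (h1 : coeff 1 u = 0) (hh : IsIntegral ℤ h) (n : ℕ) : FactorialIntegral n u := by
  intro a _
  induction a using Nat.strong_induction_on with
  | _ a ih =>
  rcases a with _ | _ | a
  · simpa using h0
  · simpa [h1] using isIntegral_zero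
  · have hint : FactorialIntegral a u := fun b hb ↦ ih b (by omega) (by omega)
    have hc := coeff_of_derivative_derivative hu a
    have : ((a + 2) ! : K) * coeff (a + 2) u =
        6 * ((a ! : K) * coeff a (u * u)) - a ! * if a = 0 then h else 0 := by
      rw [Nat.factorial_succ, Nat.factorial_succ]
      push_cast at hc ⊢
      linear_combination (a ! : K) * hc
    rw [this]
    have h6 : IsIntegral ℤ (6 : K) := by
      simpa using isIntegral_algebraMap (R := ℤ) (A := K) (x := 6)
    refine (h6.mul (hint.mul hint a le_rfl)).sub ?_
    split_ifs with h0
    · subst h0; simpa using hh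
    · simpa using isIntegral_zero

variable [NumberField K]

lemma house_sub_le (x y : K) : house (x - y) ≤ house x + house y := by
  simp only [house, map_sub]; apply norm_sub_le

lemma house_one : house (1 : K) = 1 := by simpa using house_intCast (K := K) 1

lemma house_zero : house (0 : K) = 0 := by simpa using house_intCast (K := K) 0

/-- The houses of the coefficients of `f` up to index `n` grow at most geometrically. -/
def HouseBound (n : ℕ) (B ρ : ℝ) (f : K⟦X⟧) : Prop :=
  ∀ a ≤ n, house (coeff a f) ≤ B * ρ ^ a

lemma HouseBound.mul {n : ℕ} {B B' ρ : ℝ} {f g : K⟦X⟧} (hf : HouseBound n B ρ f)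
    (hg : HouseBound n B' ρ g) (hB : 0 ≤ B) (hB' : 0 ≤ B') (hρ : 0 ≤ ρ) :
    HouseBound n ((n + 1) * B * B') ρ (f * g) := by
  intro k hk
  rw [coeff_mul]
  calc house (∑ p ∈ antidiagonal k, coeff p.1 f * coeff p.2 g)
      ≤ ∑ p ∈ antidiagonal k, house (coeff p.1 f * coeff p.2 g) := house_sum_le_sum_house _ _
    _ ≤ ∑ p ∈ antidiagonal k, B * B' * ρ ^ k := by
        refine sum_le_sum fun p hp ↦ ?_
        have hpk : p.1 + p.2 = k := by simpa using hp
        calc _ ≤ house (coeff p.1 f) * house (coeff p.2 g) := house_mul_le _ _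
          _ ≤ (B * ρ ^ p.1) * (B' * ρ ^ p.2) := by
              gcongr
              · exact house_nonneg _
              · exact hf _ (by omega)
              · exact hg _ (by omega)
          _ = _ := by rw [← hpk, pow_add]; ring
    _ = (k + 1) * B * B' * ρ ^ k := by simp [mul_assoc]
    _ ≤ _ := by gcongr

lemma HouseBound.pow {n : ℕ} {B ρ : ℝ} {f : K⟦X⟧} (hf : HouseBound n B ρ f)
    (hB : 0 ≤ B) (hρ : 0 ≤ ρ) (i : ℕ) :
    HouseBound n (((n + 1) * B) ^ i) ρ (f ^ i) := by
  induction i with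
  | zero =>
    intro a _
    rw [pow_zero, coeff_one]
    split_ifs with h
    · simp [h, house_one]
    · rw [house_zero]; positivity
  | succ i ih =>
    rw [pow_succ f]
    have := ih.mul hf (by positivity) hB hρ
    rwa [show (n + 1 : ℝ) * ((n + 1) * B) ^ i * B = ((n + 1) * B) ^ (i + 1) by ring] at this

lemma HouseBound.mono {n : ℕ} {B B' ρ : ℝ} {f : K⟦X⟧} (hf : HouseBound n B ρ f) (h : B ≤ B')
    (hρ : 0 ≤ ρ) : HouseBound n B' ρ f :=
  fun a ha ↦ (hf a ha).trans (by gcongr)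

lemma houseBound_C_add_X {n : ℕ} {x y : K} {B ρ : ℝ} (hρ : 1 ≤ ρ) (hB : 0 ≤ B) (hx : house x ≤ B)
    (hy : house y ≤ B) : HouseBound n B ρ (C x + C y * X) := by
  intro a _
  have h1 : B ≤ B * ρ ^ a := le_mul_of_one_le_right hB (one_le_pow₀ hρ)
  rcases a with _ | _ | a
  · simpa using hx
  · simp only [zero_add] at h1 ⊢
    refine le_trans ?_ h1
    simpa [coeff_C] using hy
  · simpa [coeff_C, coeff_succ_mul_X, house_zero] using hB.trans h1

lemma exists_houseBound_of_derivative_derivative {u : K⟦X⟧} {h : K}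
    (hu : d⁄dX K (d⁄dX K u) = 6 * (u * u) - C h) (h1 : coeff 1 u = 0) :
    ∃ B ρ : ℝ, 1 ≤ B ∧ 1 ≤ ρ ∧ ∀ n, HouseBound n B ρ u := by
  set B : ℝ := 1 + house (coeff 0 u) with hBdef
  set ρ : ℝ := 6 * B + house h with hρdef
  have hB : 1 ≤ B := by have := house_nonneg (coeff 0 u); linarith
  have hh := house_nonneg h
  have hρ : 1 ≤ ρ := by linarith
  refine ⟨B, ρ, hB, hρ, fun n a _ ↦ ?_⟩
  induction a using Nat.strong_induction_on with
  | _ a ih =>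
  rcases a with _ | _ | a
  · simp [hBdef]
  · rw [h1, house_zero]; positivity
  · have hb : HouseBound a B ρ u := fun b hb ↦ ih b (by omega) (by omega)
    have hc := congr_arg house (coeff_of_derivative_derivative hu a)
    rw [← Nat.cast_mul, house_nat_mul] at hc
    have h6 : house (6 * coeff a (u * u)) ≤ 6 * ((a + 1) * B * B * ρ ^ a) := by
      have := house_nat_mul (coeff a (u * u)) 6
      push_cast at this
      rw [this]
      gcongr
      exact hb.mul hb (by positivity) (by positivity) (by positivity) a le_rfl
    have hi : house (if a = 0 then h else 0) ≤ house h * (B * ρ ^ a) := by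
      have : 1 ≤ B * ρ ^ a := one_le_mul_of_one_le_of_one_le hB (one_le_pow₀ hρ)
      split_ifs
      · exact le_mul_of_one_le_right hh this
      · rw [house_zero]; positivity
    have hle : ((a + 1 : ℕ) * (a + 2 : ℕ) : ℝ) * house (coeff (a + 2) u) ≤
        ((a + 1 : ℕ) * (a + 2 : ℕ) : ℝ) * (B * ρ ^ (a + 2)) := by
      calc _ = house (6 * coeff a (u * u) - if a = 0 then h else 0) := by rw [← hc]; push_cast; ring
        _ ≤ 6 * ((a + 1) * B * B * ρ ^ a) + house h * (B * ρ ^ a) :=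
            (house_sub_le _ _).trans (add_le_add h6 hi)
        _ ≤ (a + 1) * (B * ρ ^ a * ρ) := by
            rw [hρdef]
            have : 0 ≤ a * (house h * (B * ρ ^ a)) := by positivity
            rw [hρdef] at this
            nlinarith
        _ ≤ ((a + 1 : ℕ) * (a + 2 : ℕ) : ℝ) * (B * ρ ^ a * (ρ * ρ)) := by
            push_cast
            have h2 : B * ρ ^ a * ρ ≤ B * ρ ^ a * (ρ * ρ) :=
              mul_le_mul_of_nonneg_left (by nlinarith) (by positivity)
            refine mul_le_mul ?_ h2 (by positivity) (by positivity)
            have : (0 : ℝ) ≤ a := by positivity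
            nlinarith
        _ = _ := by ring
    exact le_of_mul_le_mul_left hle (by positivity)

end Arithmetic

end SchneiderPeriods

namespace SchneiderPeriods

open PowerSeries Finset NumberField
open scoped Nat

section Auxiliary

variable {K : Type*} [Field K]

/-- The power series `∑ ξᵢⱼ vⁱ uʲ`. -/
noncomputable def auxSeries {M N : ℕ} (ξ : Fin M × Fin N → K) (v u : K⟦X⟧) : K⟦X⟧ :=
  ∑ x, C (ξ x) * (v ^ (x.1 : ℕ) * u ^ (x.2 : ℕ))

lemma factorial_mul_coeff_auxSeries {M N : ℕ} (ξ : Fin M × Fin N → K) (v u : K⟦X⟧) (k : ℕ) :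
    (k ! : K) * coeff k (auxSeries ξ v u) =
      ∑ x, ξ x * (k ! * coeff k (v ^ (x.1 : ℕ) * u ^ (x.2 : ℕ))) := by
  rw [auxSeries, map_sum, mul_sum]
  refine sum_congr rfl fun x _ ↦ ?_
  rw [coeff_C_mul]
  ring

/-- Siegel's lemma for systems with twice as many unknowns as equations. -/
lemma exists_siegel_constant (K : Type*) [Field K] [NumberField K] :
    ∃ c : ℝ, ∀ {α β : Type} [Fintype α] [Fintype β] [DecidableEq α] [DecidableEq β] (p : ℕ) (B : ℝ)
      (a : Matrix α β (𝓞 K)), 0 < p → Fintype.card α = p → Fintype.card β = 2 * p →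
      (∀ k l, house (a k l : K) ≤ B) →
      ∃ ξ : β → 𝓞 K, ξ ≠ 0 ∧ a.mulVec ξ = 0 ∧ ∀ l, house (ξ l : K) ≤ max 1 (c * p * B) := by
  classical
  obtain ⟨c, hc⟩ : ∃ c : ℝ, ∀ {α β : Type} [Fintype α] [Fintype β] [DecidableEq α] [DecidableEq β]
      (p q : ℕ) (B : ℝ) (a : Matrix α β (𝓞 K)), a ≠ 0 → 0 < p → p < q → Fintype.card α = p →
      Fintype.card β = q → (∀ k l, house (a k l : K) ≤ B) → ∃ ξ : β → 𝓞 K, ξ ≠ 0 ∧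
      a.mulVec ξ = 0 ∧ ∀ l, house (ξ l : K) ≤ c * (c * q * B) ^ ((p : ℝ) / (q - p)) :=
    ⟨_, fun p q B a h0 hp hpq hα hβ ha ↦
      NumberField.house.exists_ne_zero_int_vec_house_le K a h0 hp hpq hβ ha hα⟩
  refine ⟨2 * c ^ 2, fun {α β} _ _ _ _ p B a hp hα hβ ha ↦ ?_⟩
  by_cases h0 : a = 0
  · refine ⟨fun _ ↦ 1, ?_, by simp [h0], fun l ↦ by simp [house_one]⟩
    have : Nonempty β := Fintype.card_pos_iff.mp (by omega)
    exact fun h ↦ one_ne_zero (congr_fun h (Classical.arbitrary β))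
  · obtain ⟨ξ, h1, h2, h3⟩ := hc p (2 * p) B a h0 hp (by omega) hα hβ ha
    refine ⟨ξ, h1, h2, fun l ↦ (h3 l).trans (le_max_of_le_right (le_of_eq ?_))⟩
    have : (p : ℝ) / (((2 * p : ℕ) : ℝ) - p) = 1 := by
      have : (p : ℝ) ≠ 0 := by exact_mod_cast hp.ne'
      push_cast
      field_simp
      ring
    rw [this, Real.rpow_one]
    push_cast
    ring

variable [NumberField K]

lemma house_factorial_mul_coeff_le {u v : K⟦X⟧} {D ρ : ℝ} {S t n k i j : ℕ} (hD : 1 ≤ D)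
    (hρ : 1 ≤ ρ) (hu : HouseBound t D ρ u) (hv : HouseBound t D ρ v) (hk : k ≤ t)
    (hnt : n ^ 4 ≤ t) (hi : i < 2 * S * n ^ 2) (hj : j < n ^ 2) (hSn : 4 * (S + 1) ≤ n)
    (hDn : D * ρ ≤ n) :
    house ((k ! : K) * coeff k (v ^ i * u ^ j)) ≤ (t : ℝ) ^ (3 * t) := by
  have hn : 4 ≤ n := by omega
  have hnt1 : n ≤ t := (Nat.le_self_pow four_ne_zero n).trans hnt
  have ht1 : (1 : ℝ) ≤ t := by exact_mod_cast (by omega : 1 ≤ t)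
  have htD : 1 ≤ (t + 1) * D := one_le_mul_of_one_le_of_one_le (by linarith) hD
  have hprod := (hv.pow (by linarith) (by linarith) i).mul (hu.pow (by linarith) (by linarith) j)
    (by positivity) (by positivity) (by linarith) k hk
  have he : 1 + i + j ≤ (2 * S + 2) * n ^ 2 := by nlinarith
  have he2 : 2 * ((2 * S + 2) * n ^ 2) ≤ t := by
    calc 2 * ((2 * S + 2) * n ^ 2) = 4 * (S + 1) * n ^ 2 := by ring
      _ ≤ n * n ^ 2 := by gcongr
      _ = n ^ 3 := by ring
      _ ≤ n ^ 4 := Nat.pow_le_pow_right (by omega) (by omega)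
      _ ≤ t := hnt
  rw [house_nat_mul]
  calc k ! * house (coeff k (v ^ i * u ^ j))
      ≤ k ! * ((t + 1) * ((t + 1) * D) ^ i * ((t + 1) * D) ^ j * ρ ^ k) := by gcongr
    _ ≤ (t : ℝ) ^ t * (((t + 1) * D) * ((t + 1) * D) ^ i * ((t + 1) * D) ^ j * ρ ^ t) := by
        have h1 : (k ! : ℝ) ≤ (t : ℝ) ^ t := by
          exact_mod_cast (Nat.factorial_le hk).trans (Nat.factorial_le_pow t)
        gcongr
        exact le_mul_of_one_le_right (by positivity) hD
    _ = (t : ℝ) ^ t * (((t + 1) * D) ^ (1 + i + j) * ρ ^ t) := by ring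
    _ ≤ (t : ℝ) ^ t * (((t + 1) * D) ^ ((2 * S + 2) * n ^ 2) * ρ ^ t) := by gcongr
    _ = (t : ℝ) ^ t * ((t + 1) ^ ((2 * S + 2) * n ^ 2) * D ^ ((2 * S + 2) * n ^ 2) * ρ ^ t) := by
        rw [mul_pow]
    _ ≤ (t : ℝ) ^ t * (((t : ℝ) ^ 2) ^ ((2 * S + 2) * n ^ 2) * D ^ t * ρ ^ t) := by
        have h4 : (4 : ℝ) ≤ t := by exact_mod_cast hn.trans hnt1
        have : (t : ℝ) + 1 ≤ t ^ 2 := by nlinarith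
        gcongr
        omega
    _ ≤ (t : ℝ) ^ t * ((t : ℝ) ^ t * (t : ℝ) ^ t) := by
        rw [← pow_mul, mul_assoc ((t : ℝ) ^ _), ← mul_pow]
        gcongr
        exact hDn.trans (by exact_mod_cast hnt1)
    _ = _ := by rw [← pow_add, ← pow_add]; congr 1; ring

theorem exists_auxSeries {u : K⟦X⟧} {v : ℕ → K⟦X⟧} {D ρ : ℝ} {S : ℕ} (hS : 1 ≤ S) (hD : 1 ≤ D)
    (hρ : 1 ≤ ρ) (hu : ∀ t, HouseBound t D ρ u) (hv : ∀ m < S, ∀ t, HouseBound t D ρ (v m))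
    (hui : ∀ t, FactorialIntegral t u) (hvi : ∀ m, ∀ t, FactorialIntegral t (v m)) :
    ∃ n₀ : ℕ, ∀ n, n₀ ≤ n → ∃ ξ : Fin (2 * S * n ^ 2) × Fin (n ^ 2) → K, ξ ≠ 0 ∧
      (∀ m < S, ∀ k < n ^ 4, coeff k (auxSeries ξ (v m) u) = 0) ∧
      ∀ t, n ^ 4 ≤ t → (∀ x, house (ξ x) ≤ (t : ℝ) ^ (5 * t)) ∧ ∀ m < S,
        IsIntegral ℤ ((t ! : K) * coeff t (auxSeries ξ (v m) u)) ∧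
        house ((t ! : K) * coeff t (auxSeries ξ (v m) u)) ≤ (t : ℝ) ^ (10 * t) := by
  obtain ⟨c, hc⟩ := exists_siegel_constant K
  refine ⟨⌈4 * (S + 1) + D * ρ + |c| * S⌉₊, fun n hn ↦ ?_⟩
  have hn' : 4 * (S + 1) + D * ρ + |c| * S ≤ n := (Nat.le_ceil _).trans (by exact_mod_cast hn)
  have hDρ : 1 ≤ D * ρ := one_le_mul_of_one_le_of_one_le hD hρ
  have hcS : 0 ≤ |c| * S := by positivity
  have hSn : 4 * (S + 1) ≤ n := by
    have : (4 * (S + 1) : ℝ) ≤ n := by linarith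
    exact_mod_cast this
  have hDn : D * ρ ≤ n := by
    have : (0 : ℝ) ≤ 4 * (S + 1) := by positivity
    linarith
  have hn1 : 1 ≤ n := by omega
  have hT1 : 1 ≤ n ^ 4 := Nat.one_le_pow _ _ hn1
  have hnT : n ≤ n ^ 4 := Nat.le_self_pow four_ne_zero n
  have hint (m k i j : ℕ) : IsIntegral ℤ ((k ! : K) * coeff k (v m ^ i * u ^ j)) :=
    ((hvi m k).pow i).mul ((hui k).pow j) k le_rfl
  let a : Matrix (Fin S × Fin (n ^ 4)) (Fin (2 * S * n ^ 2) × Fin (n ^ 2)) (𝓞 K) :=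
    fun y x ↦ ⟨_, hint y.1 y.2 x.1 x.2⟩
  obtain ⟨ξ, hξ0, hξ, hξb⟩ := hc (S * n ^ 4) (((n ^ 4 : ℕ) : ℝ) ^ (3 * n ^ 4)) a (by positivity)
    (by simp) (by simp; ring)
    (fun y x ↦ house_factorial_mul_coeff_le hD hρ (hu _) (hv y.1 y.1.is_lt _) y.2.is_lt.le le_rfl
      x.1.is_lt x.2.is_lt hSn hDn)
  have hξT (x) : house (ξ x : K) ≤ ((n ^ 4 : ℕ) : ℝ) ^ (5 * n ^ 4) := by
    refine (hξb x).trans (max_le (one_le_pow₀ (by exact_mod_cast hT1)) ?_)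
    have hT1' : (1 : ℝ) ≤ (n ^ 4 : ℕ) := by exact_mod_cast hT1
    have hcT : |c| * S ≤ (n ^ 4 : ℕ) := by
      have : (n : ℝ) ≤ (n ^ 4 : ℕ) := by exact_mod_cast hnT
      have : (0 : ℝ) ≤ 4 * (S + 1) := by positivity
      linarith
    calc c * (S * n ^ 4 : ℕ) * ((n ^ 4 : ℕ) : ℝ) ^ (3 * n ^ 4)
        ≤ (|c| * S) * (n ^ 4 : ℕ) * ((n ^ 4 : ℕ) : ℝ) ^ (3 * n ^ 4) := by
          rw [Nat.cast_mul, ← mul_assoc]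
          gcongr
          exact le_abs_self c
      _ ≤ (n ^ 4 : ℕ) * (n ^ 4 : ℕ) * ((n ^ 4 : ℕ) : ℝ) ^ (3 * n ^ 4) := by gcongr
      _ = ((n ^ 4 : ℕ) : ℝ) ^ (2 + 3 * n ^ 4) := by rw [pow_add]; ring
      _ ≤ _ := pow_le_pow_right₀ hT1' (by omega)
  refine ⟨fun x ↦ ξ x, ?_, ?_, fun t ht ↦ ?_⟩
  · intro h
    exact hξ0 (funext fun x ↦ RingOfIntegers.ext (congr_fun h x))
  · intro m hm k hk
    have h1 := congr_arg (algebraMap (𝓞 K) K) (congr_fun hξ (⟨m, hm⟩, ⟨k, hk⟩))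
    have h2 : (k ! : K) * coeff k (auxSeries (fun x ↦ (ξ x : K)) (v m) u) = 0 := by
      rw [factorial_mul_coeff_auxSeries, ← map_zero (algebraMap (𝓞 K) K)]
      refine Eq.trans ?_ h1
      rw [Matrix.mulVec, dotProduct, map_sum]
      exact sum_congr rfl fun x _ ↦ by
        rw [RingHom.map_mul (algebraMap (𝓞 K) K) (a _ x) (ξ x)]
        exact mul_comm _ _
    exact (mul_eq_zero.mp h2).resolve_left (by exact_mod_cast k.factorial_ne_zero)
  · have ht1 : 1 ≤ t := hT1.trans ht
    have ht1' : (1 : ℝ) ≤ t := by exact_mod_cast ht1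
    have hξt (x) : house (ξ x : K) ≤ (t : ℝ) ^ (5 * t) := by
      refine (hξT x).trans ?_
      calc ((n ^ 4 : ℕ) : ℝ) ^ (5 * n ^ 4) ≤ (t : ℝ) ^ (5 * n ^ 4) := by gcongr
        _ ≤ (t : ℝ) ^ (5 * t) := pow_le_pow_right₀ ht1' (by omega)
    refine ⟨hξt, fun m hm ↦ ?_⟩
    rw [factorial_mul_coeff_auxSeries]
    refine ⟨IsIntegral.sum _ fun x _ ↦ (ξ x).isIntegral_coe.mul (hint _ _ _ _), ?_⟩
    have hcard : 2 * S * n ^ 2 * n ^ 2 ≤ t ^ 2 := by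
      calc 2 * S * n ^ 2 * n ^ 2 = 2 * S * n ^ 4 := by ring
        _ ≤ t * t := by
            gcongr
            omega
        _ = t ^ 2 := by ring
    calc _ ≤ ∑ x : Fin (2 * S * n ^ 2) × Fin (n ^ 2), (t : ℝ) ^ (5 * t) * (t : ℝ) ^ (3 * t) := by
          refine (house_sum_le_sum_house _ _).trans (sum_le_sum fun x _ ↦
            (house_mul_le _ _).trans ?_)
          gcongr
          · exact house_nonneg _
          · exact hξt x
          · exact house_factorial_mul_coeff_le hD hρ (hu _) (hv m hm _) le_rfl ht
              x.1.is_lt x.2.is_lt hSn hDn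
      _ = ((2 * S * n ^ 2 * n ^ 2 : ℕ) : ℝ) * (t : ℝ) ^ (8 * t) := by
          rw [← pow_add]
          simp only [sum_const, card_univ, Fintype.card_prod, Fintype.card_fin, nsmul_eq_mul]
          congr 2
          ring
      _ ≤ (t : ℝ) ^ 2 * (t : ℝ) ^ (8 * t) := by
          gcongr
          exact_mod_cast hcard
      _ = (t : ℝ) ^ (2 + 8 * t) := by rw [pow_add]
      _ ≤ _ := pow_le_pow_right₀ ht1' (by omega)

end Auxiliary

end SchneiderPeriods

namespace SchneiderPeriods

open PowerSeries Nat Finset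

section Taylor

/-- The Taylor series of `f` at `z`, as a formal power series. -/
noncomputable def taylorSeries (f : ℂ → ℂ) (z : ℂ) : ℂ⟦X⟧ :=
  PowerSeries.mk fun n ↦ (n ! : ℂ)⁻¹ * iteratedDeriv n f z

variable {f g : ℂ → ℂ} {z : ℂ}

lemma coeff_taylorSeries (n : ℕ) :
    coeff n (taylorSeries f z) = (n ! : ℂ)⁻¹ * iteratedDeriv n f z := coeff_mk _ _

lemma coeff_zero_taylorSeries : coeff 0 (taylorSeries f z) = f z := by
  simp [coeff_taylorSeries]

lemma coeff_one_taylorSeries : coeff 1 (taylorSeries f z) = deriv f z := by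
  simp [coeff_taylorSeries]

lemma taylorSeries_congr (h : f =ᶠ[nhds z] g) : taylorSeries f z = taylorSeries g z := by
  ext n
  simp [coeff_taylorSeries, (h.iteratedDeriv_eq n)]

lemma taylorSeries_add (hf : AnalyticAt ℂ f z) (hg : AnalyticAt ℂ g z) :
    taylorSeries (fun w ↦ f w + g w) z = taylorSeries f z + taylorSeries g z := by
  ext n
  simp [coeff_taylorSeries, iteratedDeriv_fun_add hf.contDiffAt hg.contDiffAt, mul_add]

lemma taylorSeries_mul (hf : AnalyticAt ℂ f z) (hg : AnalyticAt ℂ g z) :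
    taylorSeries (fun w ↦ f w * g w) z = taylorSeries f z * taylorSeries g z := by
  ext n
  simp only [coeff_taylorSeries, coeff_mul, iteratedDeriv_fun_mul hf.contDiffAt hg.contDiffAt,
    Finset.mul_sum, Finset.Nat.sum_antidiagonal_eq_sum_range_succ_mk]
  refine Finset.sum_congr rfl fun i hi ↦ ?_
  rw [Nat.cast_choose _ (by grind)]
  field_simp [Nat.factorial_ne_zero]

lemma taylorSeries_const (a : ℂ) : taylorSeries (fun _ ↦ a) z = C a := by
  ext n
  rcases n with _ | n
  · simp [coeff_taylorSeries]
  · simp [coeff_taylorSeries, iteratedDeriv_const]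

lemma taylorSeries_pow (hf : AnalyticAt ℂ f z) (n : ℕ) :
    taylorSeries (fun w ↦ f w ^ n) z = taylorSeries f z ^ n := by
  induction n with
  | zero => simpa using taylorSeries_const (z := z) 1
  | succ n ih => simp only [pow_succ]; rw [taylorSeries_mul (hf.fun_pow n) hf, ih]

lemma taylorSeries_sum {ι : Type*} (s : Finset ι) {F : ι → ℂ → ℂ}
    (hF : ∀ i ∈ s, AnalyticAt ℂ (F i) z) :
    taylorSeries (fun w ↦ ∑ i ∈ s, F i w) z = ∑ i ∈ s, taylorSeries (F i) z := by
  classical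
  induction s using Finset.induction_on with
  | empty => simpa using taylorSeries_const (z := z) 0
  | insert a s ha ih =>
    simp only [Finset.sum_insert ha]
    rw [taylorSeries_add (hF _ (by simp))
      (Finset.analyticAt_fun_sum s fun i hi ↦ hF i (by simp [hi])),
      ih fun i hi ↦ hF i (by simp [hi])]

lemma taylorSeries_deriv : taylorSeries (deriv f) z = d⁄dX ℂ (taylorSeries f z) := by
  ext n
  rw [coeff_derivative, coeff_taylorSeries, coeff_taylorSeries, iteratedDeriv_succ',
    Nat.factorial_succ]
  have : (n ! : ℂ) ≠ 0 := by exact_mod_cast n.factorial_ne_zero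
  have : (n + 1 : ℂ) ≠ 0 := by exact_mod_cast n.succ_ne_zero
  push_cast
  field_simp

lemma taylorSeries_id : taylorSeries (fun w ↦ w) z = C z + X := by
  ext n
  rcases n with _ | _ | n
  · simp [coeff_taylorSeries]
  · simp [coeff_taylorSeries]
  · have : iteratedDeriv (n + 2) (fun w : ℂ ↦ w) z = 0 := by
      simp [iteratedDeriv_fun_id]
    simp [coeff_taylorSeries, coeff_X, this]

lemma taylorSeries_sub_self : taylorSeries (fun w ↦ w - z) z = X := by
  simp only [sub_eq_add_neg]
  rw [taylorSeries_add (f := fun w ↦ w) analyticAt_id analyticAt_const, taylorSeries_id,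
    taylorSeries_const]
  simp

lemma taylorSeries_const_mul (a : ℂ) : taylorSeries (fun w ↦ a * w) z = C (a * z) + C a * X := by
  rw [taylorSeries_mul (g := fun w ↦ w) analyticAt_const analyticAt_id, taylorSeries_id,
    taylorSeries_const, map_mul]
  ring

lemma taylorSeries_add_of_periodic {c : ℂ} (h : ∀ w, f (w + c) = f w) :
    taylorSeries f (z + c) = taylorSeries f z := by
  ext n
  have := congr_fun (iteratedDeriv_comp_add_const n f c) z
  simp only [h] at this
  rw [coeff_taylorSeries, coeff_taylorSeries, this]

lemma natCast_le_analyticOrderAt_iff_X_pow_dvd (hf : AnalyticAt ℂ f z) (n : ℕ) :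
    (n : ℕ∞) ≤ analyticOrderAt f z ↔ X ^ n ∣ taylorSeries f z := by
  rw [natCast_le_analyticOrderAt_iff_iteratedDeriv_eq_zero hf, X_pow_dvd_iff]
  refine forall₂_congr fun i hi ↦ ?_
  rw [coeff_taylorSeries]
  simp [Nat.factorial_ne_zero]

lemma eventually_eq_zero_of_taylorSeries_eq_zero (hf : AnalyticAt ℂ f z)
    (h : taylorSeries f z = 0) : ∀ᶠ w in nhds z, f w = 0 := by
  rw [← analyticOrderAt_eq_top, ENat.eq_top_iff_forall_ge]
  intro n
  rw [natCast_le_analyticOrderAt_iff_X_pow_dvd hf, h]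
  exact dvd_zero _

end Taylor

section Lift

variable {K : Type*} [Field K]

/-- The solution of `u'' = 6 u² - h` with `u(0) = e`, `u'(0) = 0` is defined over any field
of characteristic zero containing `e` and `h`. -/
lemma exists_map_eq_of_derivative_derivative (σ : K →+* ℂ) {e h : K} {u : ℂ⟦X⟧}
    (hu : d⁄dX ℂ (d⁄dX ℂ u) = 6 * (u * u) - C (σ h)) (h0 : coeff 0 u = σ e)
    (h1 : coeff 1 u = 0) :
    ∃ v : K⟦X⟧, v.map σ = u ∧ coeff 0 v = e ∧ coeff 1 v = 0 ∧
      d⁄dX K (d⁄dX K v) = 6 * (v * v) - C h := by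
  have hrange : ∀ n, ∃ x : K, σ x = coeff n u := by
    intro n
    induction n using Nat.strong_induction_on with
    | _ n ih =>
    rcases n with _ | _ | n
    · exact ⟨e, h0.symm⟩
    · exact ⟨0, by simp [h1]⟩
    · have hc := coeff_of_derivative_derivative hu n
      have hne : ((n + 1 : ℕ) * (n + 2 : ℕ) : ℂ) ≠ 0 := by
        exact_mod_cast (by positivity : (n + 1) * (n + 2) ≠ 0)
      have hmem : ∀ k < n + 2, coeff k u ∈ σ.fieldRange := fun k hk ↦ ih k hk
      change coeff (n + 2) u ∈ σ.fieldRange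
      rw [eq_div_of_mul_eq hne ((mul_comm _ _).trans hc), coeff_mul]
      refine div_mem (sub_mem (mul_mem (ofNat_mem _ 6) (sum_mem fun p hp ↦ ?_)) ?_)
        (mul_mem (natCast_mem _ _) (natCast_mem _ _))
      · have : p.1 + p.2 = n := by simpa using hp
        exact mul_mem (hmem _ (by omega)) (hmem _ (by omega))
      · split_ifs
        · exact ⟨h, rfl⟩
        · exact zero_mem _
  choose v hv using hrange
  have hinj : Function.Injective (PowerSeries.map σ) := by
    intro a b hab
    ext n
    apply σ.injective
    rw [← coeff_map, ← coeff_map, hab]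
  have hmap : (PowerSeries.mk v).map σ = u := by ext n; simp [hv]
  refine ⟨PowerSeries.mk v, hmap, ?_, ?_, hinj ?_⟩
  · apply σ.injective; simp [hv, h0, -coeff_zero_eq_constantCoeff]
  · apply σ.injective; simp [hv, h1]
  · have hd : ∀ w : K⟦X⟧, (d⁄dX K w).map σ = d⁄dX ℂ (w.map σ) := by
      intro w; ext n; simp [coeff_derivative]
    have h6 : (6 : K⟦X⟧).map σ = 6 := map_ofNat _ 6
    rw [hd, hd, hmap, hu]
    simp [hmap, h6]

end Lift

end SchneiderPeriods

namespace SchneiderPeriods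

open PowerSeries Nat Finset
open scoped PeriodPair

section WeierstrassFunction

variable (L : PeriodPair)

lemma isPreconnected_compl_lattice : IsPreconnected (L.lattice : Set ℂ)ᶜ := by
  have hc : (L.lattice : Set ℂ).Countable := by
    have : (L.lattice : Set ℂ) ⊆ Set.range fun p : ℤ × ℤ ↦ (p.1 * L.ω₁ + p.2 * L.ω₂ : ℂ) := by
      intro x hx
      obtain ⟨m, n, h⟩ := PeriodPair.mem_lattice.mp hx
      exact ⟨(m, n), h⟩
    exact (Set.countable_range _).mono this
  exact (hc.isConnected_compl_of_one_lt_rank (by simp [Complex.rank_real_complex])).isPreconnected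

variable {L}

lemma eqOn_zero_of_taylorSeries_eq_zero {f : ℂ → ℂ} (hf : AnalyticOnNhd ℂ f (L.lattice : Set ℂ)ᶜ)
    {z : ℂ} (hz : z ∉ L.lattice) (h : taylorSeries f z = 0) {w : ℂ} (hw : w ∉ L.lattice) :
    f w = 0 :=
  hf.eqOn_zero_of_preconnected_of_eventuallyEq_zero (isPreconnected_compl_lattice L)
    (show z ∈ (L.lattice : Set ℂ)ᶜ from hz)
    (eventually_eq_zero_of_taylorSeries_eq_zero (hf z hz) h) hw

variable (L)

lemma tendsto_weierstrassP_cobounded :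
    Filter.Tendsto ℘[L] (nhdsWithin 0 {0}ᶜ) (Bornology.cobounded ℂ) := by
  have h : MeromorphicAt ℘[L] 0 := by fun_prop
  rw [tendsto_cobounded_iff_meromorphicOrderAt_neg h]
  rw [L.order_weierstrassP 0 (zero_mem _)]
  decide

lemma eventually_notMem_lattice : ∀ᶠ z in nhdsWithin 0 {(0 : ℂ)}ᶜ, z ∉ L.lattice := by
  have h := L.compl_lattice_sdiff_singleton_mem_nhds 0
  filter_upwards [nhdsWithin_le_nhds h, self_mem_nhdsWithin] with z hz hz0 hzL
  exact hz ⟨hzL, hz0⟩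

variable {L}

lemma polynomial_eq_zero_of_eval_weierstrassP {p : Polynomial ℂ}
    (hp : ∀ z ∉ L.lattice, p.eval (℘[L] z) = 0) : p = 0 := by
  by_contra hne
  have hfin : (p.roots.toFinset : Set ℂ).Finite := Finset.finite_toSet _
  have h1 := (tendsto_weierstrassP_cobounded L).eventually
    (Bornology.isBounded_def.mp hfin.isBounded)
  obtain ⟨z, hz, hzL⟩ := (h1.and (eventually_notMem_lattice L)).exists
  refine hz ?_
  simp [hne, hp z hzL]

lemma eq_zero_of_sum_pow_mul_weierstrassP_pow_eq_zero {M N : ℕ} {a : Fin M × Fin N → ℂ}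
    (ha : ∀ z ∉ L.lattice, ∑ x, a x * z ^ (x.1 : ℕ) * ℘[L] z ^ (x.2 : ℕ) = 0) : a = 0 := by
  have h1 : ∀ z ∉ L.lattice, ∀ i, ∑ j, a (i, j) * ℘[L] z ^ (j : ℕ) = 0 := by
    intro z hz
    set p : Polynomial ℂ :=
      ∑ i : Fin M, Polynomial.monomial (i : ℕ) (∑ j, a (i, j) * ℘[L] z ^ (j : ℕ)) with hp
    have hp0 : p = 0 := by
      refine p.eq_zero_of_infinite_isRoot
        (Set.Infinite.mono ?_ (Set.infinite_range_of_injective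
          (f := fun m : ℕ ↦ z + m * L.ω₁) fun m n hmn ↦ ?_))
      · rintro _ ⟨m, rfl⟩
        have hm : (m : ℂ) * L.ω₁ ∈ L.lattice :=
          PeriodPair.mem_lattice.mpr ⟨m, 0, by simp⟩
        have hz' : z + m * L.ω₁ ∉ L.lattice := fun h ↦ hz (by simpa using sub_mem h hm)
        have hper : ℘[L] (z + m * L.ω₁) = ℘[L] z := L.weierstrassP_add_coe z ⟨_, hm⟩
        have := ha _ hz'
        rw [Fintype.sum_prod_type, hper] at this
        simp only [Set.mem_ofPred_eq, Polynomial.IsRoot, hp, Polynomial.eval_finsetSum,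
          Polynomial.eval_monomial, Finset.sum_mul]
        rw [← this]
        exact sum_congr rfl fun i _ ↦ sum_congr rfl fun j _ ↦ by ring
      · have h0 : L.ω₁ ≠ 0 := by simpa using L.indep.ne_zero 0
        simpa [h0] using hmn
    intro i
    have := congr_arg (Polynomial.coeff · i) hp0
    simpa [hp, Polynomial.finsetSum_coeff, Polynomial.coeff_monomial, Fin.val_inj] using this
  ext ⟨i, j⟩
  have h2 : (∑ j : Fin N, Polynomial.monomial (j : ℕ) (a (i, j))) = 0 := by
    refine polynomial_eq_zero_of_eval_weierstrassP (L := L) fun z hz ↦ ?_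
    simpa [Polynomial.eval_finsetSum] using h1 z hz i
  have := congr_arg (Polynomial.coeff · j) h2
  simpa [Polynomial.finsetSum_coeff, Polynomial.coeff_monomial, Fin.val_inj] using this

lemma derivWeierstrassP_eq_zero {w : ℂ} (hw : w + w ∈ L.lattice) : ℘'[L] w = 0 := by
  have h : ℘'[L] (-w + (w + w)) = ℘'[L] (-w) := L.derivWeierstrassP_add_coe (-w) ⟨_, hw⟩
  rw [L.derivWeierstrassP_neg] at h
  have : ℘'[L] w = -℘'[L] w := by rw [← h]; ring_nf
  exact self_eq_neg.mp this

lemma derivative_derivative_taylorSeries_weierstrassP {w : ℂ} (hw : w ∉ L.lattice) :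
    d⁄dX ℂ (d⁄dX ℂ (taylorSeries ℘[L] w)) =
      6 * (taylorSeries ℘[L] w * taylorSeries ℘[L] w) - C (L.g₂ / 2) := by
  have hP : AnalyticAt ℂ ℘[L] w := L.analyticOnNhd_weierstrassP w hw
  have hP' : AnalyticAt ℂ ℘'[L] w := L.analyticOnNhd_derivWeierstrassP w hw
  set u := taylorSeries ℘[L] w with hu
  have hu' : taylorSeries ℘'[L] w = d⁄dX ℂ u := by
    rw [← L.deriv_weierstrassP, taylorSeries_deriv]
  have hode : d⁄dX ℂ u ^ 2 = C 4 * u ^ 3 + (C (-L.g₂) * u + C (-L.g₃)) := by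
    rw [← hu', ← taylorSeries_pow hP', hu, ← taylorSeries_pow hP 3, ← taylorSeries_const (z := w),
      ← taylorSeries_const (z := w), ← taylorSeries_const (z := w),
      ← taylorSeries_mul analyticAt_const (hP.fun_pow 3),
      ← taylorSeries_mul analyticAt_const hP,
      ← taylorSeries_add (analyticAt_const.fun_mul hP) analyticAt_const,
      ← taylorSeries_add (analyticAt_const.fun_mul (hP.fun_pow 3))
        ((analyticAt_const.fun_mul hP).fun_add analyticAt_const)]
    refine taylorSeries_congr ?_
    filter_upwards [L.isClosed_lattice.isOpen_compl.mem_nhds hw] with z hz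
    rw [L.derivWeierstrassP_sq z hz]
    ring
  have hne : d⁄dX ℂ u ≠ 0 := by
    intro h0
    have hT : taylorSeries ℘'[L] w = 0 := hu'.trans h0
    have hz := fun z hz ↦ eqOn_zero_of_taylorSeries_eq_zero L.analyticOnNhd_derivWeierstrassP hw hT
      (w := z) hz
    have hp := polynomial_eq_zero_of_eval_weierstrassP (L := L)
      (p := 4 * Polynomial.X ^ 3 - Polynomial.C L.g₂ * Polynomial.X - Polynomial.C L.g₃) (by
        intro z hz'
        have := L.derivWeierstrassP_sq z hz'
        rw [hz z hz'] at this
        simpa using this.symm)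
    have := congr_arg (Polynomial.coeff · 3) hp
    have h4 : (4 : Polynomial ℂ) = Polynomial.C 4 := rfl
    rw [h4] at this
    simp at this
  have hd := congr_arg (d⁄dX ℂ) hode
  have h12 : (C (4 : ℂ) : ℂ⟦X⟧) = 4 := map_ofNat C 4
  have hg : (C (L.g₂ / 2) : ℂ⟦X⟧) * 2 = C L.g₂ := by
    rw [show (2 : ℂ⟦X⟧) = C (2 : ℂ) from (map_ofNat C 2).symm, ← map_mul]
    congr 1
    ring
  simp only [map_add, Derivation.leibniz, Derivation.leibniz_pow, smul_eq_mul, derivative_C,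
    map_neg] at hd
  have h2 : (2 : ℂ⟦X⟧) ≠ 0 := by
    rw [show (2 : ℂ⟦X⟧) = C (2 : ℂ) from (map_ofNat C 2).symm]
    exact (map_ne_zero_iff (C (R := ℂ)) PowerSeries.C_injective).mpr two_ne_zero
  refine mul_left_cancel₀ (mul_ne_zero h2 hne) ?_
  rw [h12, ← hg] at hd
  simp only [nsmul_eq_mul] at hd
  push_cast at hd
  linear_combination hd

end WeierstrassFunction

end SchneiderPeriods

namespace SchneiderPeriods

open PowerSeries Nat Finset
open scoped PeriodPair

section Growth

variable (L : PeriodPair)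

/-- The entire-at-the-origin function `z² ℘(z)`, with its singularity at `0` removed. -/
noncomputable def regularizedP (z : ℂ) : ℂ := z ^ 2 * L.weierstrassPExcept 0 z + 1

lemma regularizedP_zero : regularizedP L 0 = 1 := by simp [regularizedP]

lemma regularizedP_of_ne_zero {z : ℂ} (hz : z ≠ 0) : regularizedP L z = z ^ 2 * ℘[L] z := by
  have := L.ite_eq_one_sub_sq_mul_weierstrassP 0 (zero_mem _) z
  simpa [hz, regularizedP] using this.symm

lemma analyticAt_regularizedP {z : ℂ} (hz : z ∈ L.lattice → z = 0) :
    AnalyticAt ℂ (regularizedP L) z := by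
  have h : AnalyticAt ℂ (L.weierstrassPExcept 0) z :=
    L.analyticOnNhd_weierstrassPExcept 0 z fun h ↦ h.2 (hz h.1)
  unfold regularizedP
  fun_prop

/-- The lattice points with coordinates of absolute value at most `A`. -/
noncomputable def latticeBox (A : ℕ) : Finset ℂ :=
  (Icc (-A : ℤ) A ×ˢ Icc (-A : ℤ) A).image fun p ↦ (p.1 * L.ω₁ + p.2 * L.ω₂ : ℂ)

lemma card_latticeBox_le (A : ℕ) : #(latticeBox L A) ≤ (2 * A + 1) ^ 2 := by
  refine card_image_le.trans (le_of_eq ?_)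
  rw [card_product, Int.card_Icc, sq]
  congr <;> omega

variable {L}

lemma mem_lattice_of_mem_latticeBox {A : ℕ} {l : ℂ} (hl : l ∈ latticeBox L A) :
    l ∈ L.lattice := by
  obtain ⟨p, -, rfl⟩ := mem_image.mp hl
  exact PeriodPair.mem_lattice.mpr ⟨p.1, p.2, rfl⟩

lemma norm_le_of_mem_latticeBox {A : ℕ} {l : ℂ} (hl : l ∈ latticeBox L A) :
    ‖l‖ ≤ A * (‖L.ω₁‖ + ‖L.ω₂‖) := by
  obtain ⟨p, hp, rfl⟩ := mem_image.mp hl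
  simp only [mem_product, mem_Icc, ← abs_le] at hp
  have h (k : ℤ) (hk : |k| ≤ A) : ‖(k : ℂ)‖ ≤ A := by
    rw [Complex.norm_intCast]
    exact_mod_cast hk
  calc _ ≤ ‖(p.1 : ℂ)‖ * ‖L.ω₁‖ + ‖(p.2 : ℂ)‖ * ‖L.ω₂‖ := by
        simpa only [norm_mul] using norm_add_le (p.1 * L.ω₁ : ℂ) (p.2 * L.ω₂)
    _ ≤ A * ‖L.ω₁‖ + A * ‖L.ω₂‖ := by
        gcongr
        exacts [h _ hp.1, h _ hp.2]
    _ = _ := by ring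

variable (L)

lemma repr_eq (z : ℂ) : z = (L.basis.repr z 0 : ℂ) * L.ω₁ + (L.basis.repr z 1 : ℂ) * L.ω₂ := by
  have := L.basis.sum_repr z
  simpa [Fin.sum_univ_two] using this.symm

lemma repr_of_mem (m n : ℤ) (i : Fin 2) :
    L.basis.repr (m * L.ω₁ + n * L.ω₂) i = (![m, n] i : ℝ) := by
  have h : (m * L.ω₁ + n * L.ω₂ : ℂ) = (m : ℝ) • L.basis 0 + (n : ℝ) • L.basis 1 := by simp
  rw [h, map_add, map_smul, map_smul, L.basis.repr_self, L.basis.repr_self]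
  fin_cases i <;> simp

/-- Points whose coordinates have absolute value at most `1/2`. -/
def fundamentalBox : Set ℂ := {z | ∀ i, |L.basis.repr z i| ≤ 1 / 2}

lemma continuous_repr (i : Fin 2) : Continuous fun z ↦ L.basis.repr z i :=
  (L.basis.coord i).continuous_of_finiteDimensional

lemma isCompact_fundamentalBox : IsCompact (fundamentalBox L) := by
  refine (isCompact_closedBall (0 : ℂ) (‖L.ω₁‖ + ‖L.ω₂‖)).of_isClosed_subset ?_ fun z hz ↦ ?_
  · rw [fundamentalBox, Set.ofPred_forall]
    exact isClosed_iInter fun i ↦ isClosed_le (continuous_repr L i).abs continuous_const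
  · rw [mem_closedBall_zero_iff]
    have h (i) : ‖(L.basis.repr z i : ℂ)‖ ≤ 1 := by
      rw [Complex.norm_real, Real.norm_eq_abs]
      linarith [hz i]
    calc ‖z‖ ≤ ‖(L.basis.repr z 0 : ℂ)‖ * ‖L.ω₁‖ + ‖(L.basis.repr z 1 : ℂ)‖ * ‖L.ω₂‖ := by
          conv_lhs => rw [repr_eq L z]
          simpa only [norm_mul] using norm_add_le (L.basis.repr z 0 * L.ω₁ : ℂ)
            (L.basis.repr z 1 * L.ω₂)
      _ ≤ 1 * ‖L.ω₁‖ + 1 * ‖L.ω₂‖ := by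
          gcongr <;> exact h _
      _ = _ := by ring

variable {L} in
lemma eq_zero_of_mem_fundamentalBox {z : ℂ} (hz : z ∈ fundamentalBox L) (hL : z ∈ L.lattice) :
    z = 0 := by
  obtain ⟨m, n, rfl⟩ := PeriodPair.mem_lattice.mp hL
  have h (k : ℤ) (hk : |(k : ℝ)| ≤ 1 / 2) : k = 0 := by
    rw [← Int.abs_lt_one_iff]
    have : |(k : ℝ)| < 1 := by linarith
    exact_mod_cast this
  have h0 := hz 0
  have h1 := hz 1
  rw [repr_of_mem] at h0 h1
  simp [h m (by simpa using h0), h n (by simpa using h1)]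

lemma exists_norm_regularizedP_le : ∃ B : ℝ, ∀ z ∈ fundamentalBox L, ‖regularizedP L z‖ ≤ B :=
  (isCompact_fundamentalBox L).exists_bound_of_continuousOn fun _ hz ↦
    (analyticAt_regularizedP L (eq_zero_of_mem_fundamentalBox hz)).continuousAt.continuousWithinAt

lemma exists_sub_mem_fundamentalBox :
    ∃ κ : ℝ, 0 < κ ∧ κ ≤ 1 ∧ ∀ (A : ℕ) (z : ℂ), ‖z‖ ≤ κ * A →
      ∃ l ∈ latticeBox L A, z - l ∈ fundamentalBox L := by
  have hc (i : Fin 2) : ∃ c : ℝ, 0 ≤ c ∧ ∀ z, |L.basis.repr z i| ≤ c * ‖z‖ := by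
    set f := LinearMap.toContinuousLinearMap (L.basis.coord i)
    exact ⟨‖f‖, norm_nonneg _, f.le_opNorm⟩
  choose c hc0 hc using hc
  have h0 := hc0 0
  have h1 := hc0 1
  refine ⟨(1 + c 0 + c 1)⁻¹, by positivity, inv_le_one_of_one_le₀ (by linarith),
    fun A z hz ↦ ?_⟩
  have hA (i) : |L.basis.repr z i| ≤ A := by
    refine (hc i z).trans ?_
    rw [inv_mul_eq_div, le_div_iff₀ (by positivity)] at hz
    have hi : c i ≤ 1 + c 0 + c 1 := by fin_cases i <;> simp <;> linarith
    nlinarith [norm_nonneg z, mul_le_mul_of_nonneg_left hi (norm_nonneg z)]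
  have hround (x : ℝ) (hx : |x| ≤ A) : round x ∈ Icc (-A : ℤ) A := by
    have hr := abs_le.mp (abs_sub_round x)
    have hx := abs_le.mp hx
    have h1 : round x < (A : ℤ) + 1 := by
      have : (round x : ℝ) < A + 1 := by linarith
      exact_mod_cast this
    have h2 : -(A : ℤ) - 1 < round x := by
      have : (-(A : ℝ) - 1) < round x := by linarith
      exact_mod_cast this
    rw [mem_Icc]
    omega
  refine ⟨_, mem_image_of_mem _ (mk_mem_product (hround _ (hA 0)) (hround _ (hA 1))), fun i ↦ ?_⟩
  rw [map_sub, Finsupp.sub_apply, repr_of_mem]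
  fin_cases i
  · exact abs_sub_round (L.basis.repr z 0)
  · exact abs_sub_round (L.basis.repr z 1)

/-- The polynomial with double zeros at the points of the box. -/
noncomputable def boxPoly (A : ℕ) (z : ℂ) : ℂ := ∏ l ∈ latticeBox L A, (z - l) ^ 2

open Classical in
/-- The product of `boxPoly` and `℘`, with its singularities at the box points removed. -/
noncomputable def boxNum (A : ℕ) (z : ℂ) : ℂ :=
  if z ∈ L.lattice then ∏ l ∈ (latticeBox L A).erase z, (z - l) ^ 2 else boxPoly L A z * ℘[L] z

lemma analyticAt_boxPoly (A : ℕ) (z : ℂ) : AnalyticAt ℂ (boxPoly L A) z := by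
  unfold boxPoly
  fun_prop

variable {L}

lemma boxNum_of_notMem {A : ℕ} {z : ℂ} (hz : z ∉ L.lattice) :
    boxNum L A z = boxPoly L A z * ℘[L] z := if_neg hz

lemma boxNum_eq {A : ℕ} {l z : ℂ} (hl : l ∈ latticeBox L A) (hz : z ∈ L.lattice → z = l) :
    boxNum L A z = (∏ x ∈ (latticeBox L A).erase l, (z - x) ^ 2) * regularizedP L (z - l) := by
  by_cases h : z ∈ L.lattice
  · rw [boxNum, if_pos h, hz h, sub_self, regularizedP_zero, mul_one]
  · have hne : z - l ≠ 0 := fun h0 ↦ h (sub_eq_zero.mp h0 ▸ mem_lattice_of_mem_latticeBox hl)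
    have hper : ℘[L] (z - l) = ℘[L] z := by
      have := L.weierstrassP_add_coe (z - l) ⟨l, mem_lattice_of_mem_latticeBox hl⟩
      rw [← this]
      simp
    rw [boxNum_of_notMem h, boxPoly, regularizedP_of_ne_zero L hne, hper,
      ← Finset.mul_prod_erase _ _ hl]
    ring

lemma analyticAt_boxNum {A : ℕ} {z : ℂ} (hz : z ∈ L.lattice → z ∈ latticeBox L A) :
    AnalyticAt ℂ (boxNum L A) z := by
  by_cases h : z ∈ L.lattice
  · have h1 : AnalyticAt ℂ (fun w ↦ (∏ x ∈ (latticeBox L A).erase z, (w - x) ^ 2) *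
        regularizedP L (w - z)) z := by
      have h2 : AnalyticAt ℂ (fun w ↦ regularizedP L (w - z)) z := by
        refine AnalyticAt.comp_of_eq (y := 0) (analyticAt_regularizedP L fun _ ↦ rfl) ?_ (by simp)
        fun_prop
      fun_prop
    refine h1.congr ?_
    filter_upwards [L.compl_lattice_sdiff_singleton_mem_nhds z] with w hw
    refine (boxNum_eq (hz h) fun hwL ↦ ?_).symm
    by_contra hne
    exact hw ⟨hwL, hne⟩
  · refine ((analyticAt_boxPoly L A z).mul (L.analyticOnNhd_weierstrassP z h)).congr ?_
    filter_upwards [L.isClosed_lattice.isOpen_compl.mem_nhds h] with w hw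
    exact (boxNum_of_notMem hw).symm

lemma pow_le_norm_boxPoly {A : ℕ} {z : ℂ} {δ : ℝ} (h0 : 0 ≤ δ) (h1 : δ ≤ 1)
    (h : ∀ l ∈ L.lattice, δ ≤ ‖z - l‖) : δ ^ (2 * (2 * A + 1) ^ 2) ≤ ‖boxPoly L A z‖ := by
  calc _ ≤ δ ^ (2 * #(latticeBox L A)) :=
        pow_le_pow_of_le_one h0 h1 (by gcongr; exact card_latticeBox_le L A)
    _ = ∏ _l ∈ latticeBox L A, δ ^ 2 := by rw [prod_const, pow_mul]
    _ ≤ _ := by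
        rw [boxPoly, norm_prod]
        refine prod_le_prod (fun _ _ ↦ by positivity) fun l hl ↦ ?_
        rw [norm_pow]
        gcongr
        exact h l (mem_lattice_of_mem_latticeBox hl)

variable (L)

lemma exists_box_bounds : ∃ κ C : ℝ, 0 < κ ∧ κ ≤ 1 ∧ 1 ≤ C ∧ ∀ A : ℕ, 1 ≤ A →
    ∀ z : ℂ, ‖z‖ ≤ κ * A → AnalyticAt ℂ (boxNum L A) z ∧
      ‖boxPoly L A z‖ ≤ (C * A) ^ (2 * (2 * A + 1) ^ 2) ∧
      ‖boxNum L A z‖ ≤ (C * A) ^ (2 * (2 * A + 1) ^ 2) := by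
  obtain ⟨κ, hκ, hκ1, hbox⟩ := exists_sub_mem_fundamentalBox L
  obtain ⟨B, hB⟩ := exists_norm_regularizedP_le L
  set C : ℝ := 1 + ‖L.ω₁‖ + ‖L.ω₂‖ + |B| with hC
  have hC1 : 1 ≤ C := by
    have := norm_nonneg L.ω₁; have := norm_nonneg L.ω₂; have := abs_nonneg B; linarith
  refine ⟨κ, C, hκ, hκ1, hC1, fun A hA z hz ↦ ?_⟩
  have hA' : (1 : ℝ) ≤ A := by exact_mod_cast hA
  have hW : 1 ≤ C * A := one_le_mul_of_one_le_of_one_le hC1 hA'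
  obtain ⟨l, hl, hzl⟩ := hbox A z hz
  have hmem : z ∈ L.lattice → z = l := fun h ↦ sub_eq_zero.mp
    (eq_zero_of_mem_fundamentalBox hzl (sub_mem h (mem_lattice_of_mem_latticeBox hl)))
  have hdist (x) (hx : x ∈ latticeBox L A) : ‖(z - x) ^ 2‖ ≤ (C * A) ^ 2 := by
    rw [norm_pow]
    gcongr
    calc _ ≤ ‖z‖ + ‖x‖ := norm_sub_le _ _
      _ ≤ 1 * A + A * (‖L.ω₁‖ + ‖L.ω₂‖) := by
          gcongr
          · exact hz.trans (by gcongr)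
          · exact norm_le_of_mem_latticeBox hx
      _ ≤ _ := by
          rw [hC]
          nlinarith [mul_nonneg (abs_nonneg B) (by positivity : (0 : ℝ) ≤ A)]
  have hcard := card_latticeBox_le L A
  refine ⟨analyticAt_boxNum fun h ↦ hmem h ▸ hl, ?_, ?_⟩
  · calc _ = ∏ x ∈ latticeBox L A, ‖(z - x) ^ 2‖ := by rw [boxPoly, norm_prod]
      _ ≤ ∏ _x ∈ latticeBox L A, (C * A) ^ 2 := prod_le_prod (fun _ _ ↦ norm_nonneg _) hdist
      _ = (C * A) ^ (2 * #(latticeBox L A)) := by rw [prod_const, pow_mul]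
      _ ≤ _ := pow_le_pow_right₀ hW (by gcongr)
  · have hreg : ‖regularizedP L (z - l)‖ ≤ (C * A) ^ 2 := by
      calc _ ≤ |B| := (hB _ hzl).trans (le_abs_self B)
        _ ≤ C := by
            have := norm_nonneg L.ω₁; have := norm_nonneg L.ω₂; linarith
        _ ≤ C * A := le_mul_of_one_le_right (by positivity) hA'
        _ ≤ _ := le_self_pow₀ hW two_ne_zero
    calc _ = (∏ x ∈ (latticeBox L A).erase l, ‖(z - x) ^ 2‖) * ‖regularizedP L (z - l)‖ := by
          rw [boxNum_eq hl hmem, norm_mul, norm_prod]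
      _ ≤ (∏ _x ∈ (latticeBox L A).erase l, (C * A) ^ 2) * (C * A) ^ 2 := by
          gcongr with x hx
          exact hdist x (mem_of_mem_erase hx)
      _ = (C * A) ^ (2 * #(latticeBox L A)) := by
          rw [prod_erase_mul _ _ hl, prod_const, pow_mul]
      _ ≤ _ := pow_le_pow_right₀ hW (by gcongr)

end Growth

section ZeroDivision

/-- An analytic function with zeros of order at least `t` at the points of `s` is divisible by
`∏ x ∈ s, (z - x) ^ t`. -/
lemma exists_eq_prod_mul {U : Set ℂ} (t : ℕ) (s : Finset ℂ) : ∀ {G : ℂ → ℂ},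
    AnalyticOnNhd ℂ G U → (↑s ⊆ U) → (∀ x ∈ s, (t : ℕ∞) ≤ analyticOrderAt G x) →
    ∃ H : ℂ → ℂ, AnalyticOnNhd ℂ H U ∧ ∀ z, G z = (∏ x ∈ s, (z - x) ^ t) * H z := by
  classical
  induction s using Finset.induction_on with
  | empty => exact fun {G} hG _ _ ↦ ⟨G, hG, by simp⟩
  | insert a s ha ih =>
    intro G hG hs hord
    have hsU : ↑s ⊆ U := fun x hx ↦ hs (by simp [mem_coe.mp hx])
    obtain ⟨H, hH, hGH⟩ := ih hG hsU fun x hx ↦ hord x (by simp [hx])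
    have haU : a ∈ U := hs (by simp)
    have hprod : AnalyticAt ℂ (fun z ↦ ∏ x ∈ s, (z - x) ^ t) a := by fun_prop
    have hH0 : (t : ℕ∞) ≤ analyticOrderAt H a := by
      have h1 := hord a (by simp)
      rw [show G = (fun z ↦ ∏ x ∈ s, (z - x) ^ t) * H from funext hGH,
        analyticOrderAt_mul hprod (hH a haU), hprod.analyticOrderAt_eq_zero.mpr, zero_add] at h1
      · exact h1
      · refine prod_ne_zero_iff.mpr fun x hx ↦ pow_ne_zero _ (sub_ne_zero.mpr ?_)
        rintro rfl
        exact ha hx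
    obtain ⟨g, hg, hgH⟩ := (natCast_le_analyticOrderAt (hH a haU)).mp hH0
    simp only [smul_eq_mul] at hgH
    set K : ℂ → ℂ := fun z ↦ if z = a then g a else H z / (z - a) ^ t with hK
    have hKg : K =ᶠ[nhds a] g := by
      filter_upwards [hgH] with z hz
      by_cases hza : z = a
      · simp [hK, hza]
      · have : (z - a) ^ t ≠ 0 := pow_ne_zero _ (sub_ne_zero.mpr hza)
        simp [hK, hza, hz, this]
    have hHK : ∀ z, H z = (z - a) ^ t * K z := by
      intro z
      by_cases hza : z = a
      · subst hza
        rw [hgH.self_of_nhds]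
        simp [hK]
      · have : (z - a) ^ t ≠ 0 := pow_ne_zero _ (sub_ne_zero.mpr hza)
        simp only [hK, if_neg hza]
        field_simp
    refine ⟨K, fun z hz ↦ ?_, fun z ↦ ?_⟩
    · by_cases hza : z = a
      · subst hza
        exact hg.congr hKg.symm
      · have hne : (z - a) ^ t ≠ 0 := pow_ne_zero _ (sub_ne_zero.mpr hza)
        have h2 : AnalyticAt ℂ (fun w ↦ H w / (w - a) ^ t) z :=
          (hH z hz).div (by fun_prop) hne
        refine h2.congr ?_
        filter_upwards [isOpen_ne.mem_nhds hza] with w hw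
        simp [hK, show w ≠ a from hw]
    · rw [hGH, hHK, prod_insert ha]
      ring

end ZeroDivision

end SchneiderPeriods

namespace SchneiderPeriods

open PowerSeries Nat Finset
open scoped PeriodPair

section Schwarz

/-- A Schwarz-type estimate for the leading Taylor coefficient of a function having zeros of high
order at the points of `s`. -/
lemma norm_coeff_taylorSeries_le {G : ℂ → ℂ} {s : Finset ℂ} {t : ℕ} {Z R B : ℝ}
    (hG : AnalyticOnNhd ℂ G (Metric.closedBall 0 R)) (hZ : 1 ≤ Z) (hZR : 2 * Z ≤ R)
    (hs : ∀ x ∈ s, ‖x‖ ≤ Z) (hord : ∀ x ∈ s, X ^ t ∣ taylorSeries G x)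
    (hB : ∀ z, ‖z‖ = R → ‖G z‖ ≤ B) {y : ℂ} (hy : y ∈ s) :
    ‖coeff t (taylorSeries G y)‖ * (R / 2) ^ (#s * t) ≤ (2 * Z) ^ (#s * t) * B := by
  have hsR : ∀ x ∈ s, x ∈ Metric.closedBall (0 : ℂ) R := fun x hx ↦
    mem_closedBall_zero_iff.mpr (by linarith [hs x hx])
  obtain ⟨H, hH, hGH⟩ := exists_eq_prod_mul t s hG hsR fun x hx ↦
    (natCast_le_analyticOrderAt_iff_X_pow_dvd (hG x (hsR x hx)) t).mpr (hord x hx)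
  have hsphere : ∀ z ∈ frontier (Metric.ball (0 : ℂ) R), ‖H z‖ ≤ B / (R / 2) ^ (#s * t) := by
    intro z hz
    rw [frontier_ball _ (by linarith), mem_sphere_zero_iff_norm] at hz
    rw [le_div_iff₀ (by have : 0 < R := by linarith
                        positivity), mul_comm]
    calc (R / 2) ^ (#s * t) * ‖H z‖ = (∏ _x ∈ s, (R / 2) ^ t) * ‖H z‖ := by
          rw [prod_const, ← pow_mul, mul_comm #s]
      _ ≤ (∏ x ∈ s, ‖z - x‖ ^ t) * ‖H z‖ := by
          have hR : 0 ≤ R / 2 := by linarith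
          refine mul_le_mul_of_nonneg_right (prod_le_prod (fun _ _ ↦ pow_nonneg hR _)
            fun x hx ↦ pow_le_pow_left₀ hR ?_ _) (norm_nonneg _)
          have := norm_sub_norm_le z x
          linarith [hs x hx]
      _ = ‖G z‖ := by rw [hGH z, norm_mul, norm_prod]; simp
      _ ≤ B := hB z hz
  have hHy : ‖H y‖ ≤ B / (R / 2) ^ (#s * t) := by
    refine Complex.norm_le_of_forall_mem_frontier_norm_le Metric.isBounded_ball ?_ hsphere
      (subset_closure (mem_ball_zero_iff.mpr (by linarith [hs y hy])))
    refine DifferentiableOn.diffContOnCl ?_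
    rw [closure_ball _ (by linarith)]
    exact hH.differentiableOn
  have hcoeff : coeff t (taylorSeries G y) = (∏ x ∈ s.erase y, (y - x) ^ t) * H y := by
    have hprod : AnalyticAt ℂ (fun w ↦ ∏ x ∈ s.erase y, (w - x) ^ t) y := by fun_prop
    have hHa := hH y (hsR y hy)
    have hGe : G = fun w ↦ (w - y) ^ t * ((∏ x ∈ s.erase y, (w - x) ^ t) * H w) := by
      ext w
      rw [hGH, ← mul_prod_erase _ _ hy, mul_assoc]
    rw [hGe, taylorSeries_mul (by fun_prop) (hprod.fun_mul hHa),
      taylorSeries_pow (by fun_prop), taylorSeries_sub_self, coeff_X_pow_mul', if_pos le_rfl,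
      Nat.sub_self, coeff_zero_taylorSeries]
  have hRpos : 0 < (R / 2) ^ (#s * t) := by
    have : 0 < R := by linarith
    positivity
  have hprodle : ∏ x ∈ s.erase y, ‖y - x‖ ^ t ≤ (2 * Z) ^ (#s * t) := by
    calc _ ≤ ∏ _x ∈ s.erase y, (2 * Z) ^ t := by
          gcongr with x hx
          have := norm_sub_le y x
          linarith [hs y hy, hs x (mem_of_mem_erase hx)]
      _ = (2 * Z) ^ (#(s.erase y) * t) := by rw [prod_const, ← pow_mul, mul_comm t]
      _ ≤ _ := pow_le_pow_right₀ (by linarith) (by gcongr; exact erase_subset _ _)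
  rw [le_div_iff₀ hRpos] at hHy
  calc _ = (∏ x ∈ s.erase y, ‖y - x‖ ^ t) * (‖H y‖ * (R / 2) ^ (#s * t)) := by
        rw [hcoeff, norm_mul, norm_prod]
        simp only [norm_pow]
        ring
    _ ≤ _ := by gcongr

end Schwarz

section AuxiliaryFunction

variable (L : PeriodPair)

/-- The polynomial `∑ aᵢⱼ (δ z)ⁱ ℘(z)ʲ`. -/
noncomputable def auxFun {M N : ℕ} (δ : ℂ) (a : Fin M × Fin N → ℂ) (z : ℂ) : ℂ :=
  ∑ x, a x * (δ * z) ^ (x.1 : ℕ) * ℘[L] z ^ (x.2 : ℕ)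

/-- `auxFun`, multiplied by a power of `boxPoly` clearing its poles in a disc. -/
noncomputable def auxNum {M N : ℕ} (A : ℕ) (δ : ℂ) (a : Fin M × Fin N → ℂ) (z : ℂ) : ℂ :=
  ∑ x, a x * (δ * z) ^ (x.1 : ℕ) * (boxNum L A z ^ (x.2 : ℕ) * boxPoly L A z ^ (N - x.2))

variable {L} {M N : ℕ} {A : ℕ} {δ : ℂ} {a : Fin M × Fin N → ℂ} {z : ℂ}

lemma auxNum_of_notMem (hz : z ∉ L.lattice) :
    auxNum L A δ a z = auxFun L δ a z * boxPoly L A z ^ N := by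
  rw [auxNum, auxFun, sum_mul]
  refine sum_congr rfl fun x _ ↦ ?_
  have h : boxPoly L A z ^ N = boxPoly L A z ^ (x.2 : ℕ) * boxPoly L A z ^ (N - x.2) := by
    rw [← pow_add, Nat.add_sub_of_le x.2.is_lt.le]
  rw [boxNum_of_notMem hz, h]
  ring

lemma analyticAt_auxFun (hz : z ∉ L.lattice) : AnalyticAt ℂ (auxFun L δ a) z := by
  have := L.analyticOnNhd_weierstrassP z hz
  unfold auxFun
  fun_prop

lemma analyticAt_auxNum (hz : AnalyticAt ℂ (boxNum L A) z) : AnalyticAt ℂ (auxNum L A δ a) z := by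
  have := analyticAt_boxPoly L A z
  unfold auxNum
  fun_prop

lemma taylorSeries_auxNum (hz : z ∉ L.lattice) :
    taylorSeries (auxNum L A δ a) z =
      taylorSeries (auxFun L δ a) z * taylorSeries (boxPoly L A) z ^ N := by
  have hP := analyticAt_boxPoly L A z
  rw [← taylorSeries_pow hP, ← taylorSeries_mul (analyticAt_auxFun hz) (hP.fun_pow N)]
  refine taylorSeries_congr ?_
  filter_upwards [L.isClosed_lattice.isOpen_compl.mem_nhds hz] with w hw
  exact auxNum_of_notMem hw

lemma coeff_taylorSeries_auxNum (hz : z ∉ L.lattice) {t : ℕ}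
    (ht : X ^ t ∣ taylorSeries (auxFun L δ a) z) :
    coeff t (taylorSeries (auxNum L A δ a) z) =
      coeff t (taylorSeries (auxFun L δ a) z) * boxPoly L A z ^ N := by
  obtain ⟨f, hf⟩ := ht
  rw [taylorSeries_auxNum hz, hf, mul_assoc, coeff_X_pow_mul', coeff_X_pow_mul', if_pos le_rfl,
    if_pos le_rfl, Nat.sub_self]
  simp only [coeff_zero_eq_constantCoeff, map_mul, map_pow]
  congr 2
  rw [← coeff_zero_eq_constantCoeff_apply, coeff_zero_taylorSeries]

lemma norm_auxNum_le {W Y B : ℝ} (hW : 1 ≤ W) (ha : ∀ x, ‖a x‖ ≤ Y) (hz : ‖δ * z‖ ≤ B)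
    (hB : 1 ≤ B) (hnum : ‖boxNum L A z‖ ≤ W) (hpoly : ‖boxPoly L A z‖ ≤ W) :
    ‖auxNum L A δ a z‖ ≤ M * N * (Y * B ^ M * W ^ N) := by
  have hterm (x : Fin M × Fin N) : ‖a x * (δ * z) ^ (x.1 : ℕ) *
      (boxNum L A z ^ (x.2 : ℕ) * boxPoly L A z ^ (N - x.2))‖ ≤ Y * B ^ M * W ^ N := by
    have hY : 0 ≤ Y := (norm_nonneg _).trans (ha x)
    simp only [norm_mul (a x * _), norm_mul (a x), norm_mul (_ ^ _) (_ ^ _), norm_pow]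
    have h1 : ‖δ * z‖ ^ (x.1 : ℕ) ≤ B ^ M :=
      (pow_le_pow_left₀ (norm_nonneg _) hz _).trans (pow_le_pow_right₀ hB x.1.is_lt.le)
    have h2 : ‖boxNum L A z‖ ^ (x.2 : ℕ) * ‖boxPoly L A z‖ ^ (N - x.2) ≤ W ^ N := by
      calc _ ≤ W ^ (x.2 : ℕ) * W ^ (N - x.2) := by gcongr
        _ = W ^ N := by rw [← pow_add, Nat.add_sub_of_le x.2.is_lt.le]
    gcongr
    exact ha x
  calc _ ≤ ∑ x : Fin M × Fin N, Y * B ^ M * W ^ N :=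
        (norm_sum_le _ _).trans (sum_le_sum fun x _ ↦ hterm x)
    _ = _ := by simp

end AuxiliaryFunction

end SchneiderPeriods

namespace SchneiderPeriods

open PowerSeries Nat Finset
open scoped PeriodPair

section Numerics

lemma exists_pow_four_le_lt (t : ℕ) : ∃ A : ℕ, A ^ 4 ≤ t ∧ t < (A + 1) ^ 4 := by
  refine ⟨t.sqrt.sqrt, ?_, ?_⟩
  · calc t.sqrt.sqrt ^ 4 = (t.sqrt.sqrt ^ 2) ^ 2 := by ring
      _ ≤ t.sqrt ^ 2 := by gcongr; exact Nat.sqrt_le' _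
      _ ≤ t := Nat.sqrt_le' _
  · calc t < (t.sqrt + 1) ^ 2 := Nat.lt_succ_sqrt' t
      _ ≤ ((t.sqrt.sqrt + 1) ^ 2) ^ 2 := by gcongr; exact Nat.lt_succ_sqrt' _
      _ = _ := by ring

/-- The size of the numerator of the auxiliary function on a disc of radius comparable to `A`. -/
lemma auxNum_bound_le {t A n s : ℕ} {C δ : ℝ} (hAt : A ^ 4 ≤ t) (hnA : n ≤ A) (hC : 0 ≤ C)
    (hδ : 0 ≤ δ) (hCA : C ≤ A) (hδA : δ ≤ A) (hs : 32 * s ≤ A) (hA : 2 ≤ A) :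
    ((2 * (8 * s) * n ^ 2 : ℕ) : ℝ) * (n ^ 2 : ℕ) * ((t : ℝ) ^ (5 * t) *
      (δ * A) ^ (2 * (8 * s) * n ^ 2) * ((C * A) ^ (2 * (2 * A + 1) ^ 2)) ^ (n ^ 2)) ≤
      (t : ℝ) ^ (16 * t) := by
  have hAtt : A ≤ t := (Nat.le_self_pow four_ne_zero A).trans hAt
  have ht : 2 ≤ t := hA.trans hAtt
  have hA1 : (1 : ℝ) ≤ A := by exact_mod_cast (by omega : 1 ≤ A)
  have ht1 : (1 : ℝ) ≤ t := by exact_mod_cast (by omega : 1 ≤ t)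
  have hnA2 : n ^ 2 ≤ A ^ 2 := by gcongr
  have h1 : ((2 * (8 * s) * n ^ 2 : ℕ) : ℝ) * (n ^ 2 : ℕ) ≤ (t : ℝ) ^ t := by
    have : 2 * (8 * s) * n ^ 2 * n ^ 2 ≤ t ^ t := by
      calc 2 * (8 * s) * n ^ 2 * n ^ 2 = 16 * s * n ^ 4 := by ring
        _ ≤ t * t := by
            gcongr
            · omega
            · exact (Nat.pow_le_pow_left hnA 4).trans hAt
        _ = t ^ 2 := by ring
        _ ≤ t ^ t := Nat.pow_le_pow_right (by omega) ht
    exact_mod_cast this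
  have hmono {k l : ℕ} (h : k ≤ l) : (A : ℝ) ^ k ≤ (A : ℝ) ^ l := pow_le_pow_right₀ hA1 h
  have h2 : (δ * A) ^ (2 * (8 * s) * n ^ 2) ≤ (t : ℝ) ^ t := by
    calc (δ * A) ^ (2 * (8 * s) * n ^ 2) ≤ ((A : ℝ) * A) ^ (2 * (8 * s) * n ^ 2) := by gcongr
      _ = (A : ℝ) ^ (32 * s * n ^ 2) := by rw [← sq, ← pow_mul]; congr 1; ring
      _ ≤ (A : ℝ) ^ (A ^ 4) := by
          refine hmono ?_
          calc 32 * s * n ^ 2 ≤ A * A ^ 2 := by gcongr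
            _ = A ^ 3 := by ring
            _ ≤ A ^ 4 := Nat.pow_le_pow_right (by omega) (by omega)
      _ ≤ (A : ℝ) ^ t := hmono hAt
      _ ≤ (t : ℝ) ^ t := by gcongr
  have h3 : ((C * A) ^ (2 * (2 * A + 1) ^ 2)) ^ (n ^ 2) ≤ (t : ℝ) ^ (9 * t) := by
    calc ((C * A) ^ (2 * (2 * A + 1) ^ 2)) ^ (n ^ 2)
        ≤ (((A : ℝ) * A) ^ (2 * (2 * A + 1) ^ 2)) ^ (n ^ 2) := by gcongr
      _ = (A : ℝ) ^ (4 * (2 * A + 1) ^ 2 * n ^ 2) := by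
          rw [← sq, ← pow_mul, ← pow_mul]; congr 1; ring
      _ ≤ (A : ℝ) ^ (4 * (9 * t)) := by
          refine hmono ?_
          calc 4 * (2 * A + 1) ^ 2 * n ^ 2 ≤ 4 * (3 * A) ^ 2 * A ^ 2 := by gcongr; omega
            _ = 4 * (9 * A ^ 4) := by ring
            _ ≤ _ := by gcongr
      _ = ((A : ℝ) ^ 4) ^ (9 * t) := by rw [← pow_mul]
      _ ≤ (t : ℝ) ^ (9 * t) := by gcongr; exact_mod_cast hAt
  calc _ ≤ (t : ℝ) ^ t * ((t : ℝ) ^ (5 * t) * (t : ℝ) ^ t * (t : ℝ) ^ (9 * t)) := by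
        gcongr
    _ = (t : ℝ) ^ (16 * t) := by rw [← pow_add, ← pow_add, ← pow_add]; congr 1; ring

lemma one_le_pow_mul_pow {t A n : ℕ} {δ₀ P : ℝ} (hAt : A ^ 4 ≤ t) (hnA : n ≤ A) (hA : 1 ≤ A)
    (h0 : 0 < δ₀) (h1 : δ₀ ≤ 1) (hδt : (1 / δ₀) ^ 18 ≤ t)
    (hP : δ₀ ^ (2 * (2 * A + 1) ^ 2) ≤ P) : 1 ≤ P ^ (n ^ 2) * (t : ℝ) ^ t := by
  have ht : (1 : ℝ) ≤ t := by
    exact_mod_cast hA.trans ((Nat.le_self_pow four_ne_zero A).trans hAt)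
  have h18 : 1 ≤ δ₀ ^ 18 * t := by
    rwa [one_div, inv_pow, inv_le_iff_one_le_mul₀ (by positivity), mul_comm] at hδt
  calc 1 ≤ (δ₀ ^ 18 * t) ^ (A ^ 4) := one_le_pow₀ h18
    _ = δ₀ ^ (18 * A ^ 4) * (t : ℝ) ^ (A ^ 4) := by rw [mul_pow, ← pow_mul]
    _ ≤ δ₀ ^ (2 * (2 * A + 1) ^ 2 * n ^ 2) * (t : ℝ) ^ t := by
        refine mul_le_mul (pow_le_pow_of_le_one h0.le h1 ?_) (pow_le_pow_right₀ ht hAt)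
          (by positivity) (by positivity)
        calc 2 * (2 * A + 1) ^ 2 * n ^ 2 ≤ 2 * (3 * A) ^ 2 * A ^ 2 := by gcongr; omega
          _ = 18 * A ^ 4 := by ring
    _ ≤ _ := by
        rw [pow_mul]
        gcongr

lemma mul_pow_le_of_schwarz {t s : ℕ} {c P B Z R : ℝ} (hc : 0 ≤ c) (hZ : 1 ≤ Z)
    (hRZ : (t : ℝ) ≤ (R / (4 * Z)) ^ 8)
    (hP : 1 ≤ P * (t : ℝ) ^ t) (hB : B ≤ (t : ℝ) ^ (16 * t))
    (h : c * P * (R / 2) ^ (8 * s * t) ≤ (2 * Z) ^ (8 * s * t) * B) :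
    (t ! * c) * (t : ℝ) ^ (s * t) ≤ (t : ℝ) ^ (18 * t) := by
  have hR2 : (R / 2) ^ (8 * s * t) = (2 * Z) ^ (8 * s * t) * ((R / (4 * Z)) ^ 8) ^ (s * t) := by
    rw [← pow_mul, ← mul_assoc, ← mul_pow]
    congr 1
    field_simp
    ring
  have hfac : (t ! : ℝ) ≤ (t : ℝ) ^ t := by exact_mod_cast Nat.factorial_le_pow t
  have h2 : c * (t : ℝ) ^ (s * t) ≤ (t : ℝ) ^ (17 * t) := by
    have hle : (2 * Z) ^ (8 * s * t) * (c * (t : ℝ) ^ (s * t)) ≤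
        (2 * Z) ^ (8 * s * t) * (t : ℝ) ^ (17 * t) := by
      calc _ = c * ((2 * Z) ^ (8 * s * t) * (t : ℝ) ^ (s * t)) * 1 := by ring
        _ ≤ c * ((2 * Z) ^ (8 * s * t) * ((R / (4 * Z)) ^ 8) ^ (s * t)) * (P * (t : ℝ) ^ t) := by
            gcongr
        _ = (c * P * (R / 2) ^ (8 * s * t)) * (t : ℝ) ^ t := by rw [hR2]; ring
        _ ≤ ((2 * Z) ^ (8 * s * t) * (t : ℝ) ^ (16 * t)) * (t : ℝ) ^ t := by
            refine mul_le_mul_of_nonneg_right (h.trans ?_) (by positivity)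
            gcongr
        _ = _ := by rw [mul_assoc, ← pow_add]; congr 2; ring
    exact le_of_mul_le_mul_left hle (by positivity)
  calc _ = t ! * (c * (t : ℝ) ^ (s * t)) := by ring
    _ ≤ (t : ℝ) ^ t * (t : ℝ) ^ (17 * t) := by gcongr
    _ = _ := by rw [← pow_add]; congr 1; ring

end Numerics

section UpperBound

variable {L : PeriodPair}

lemma add_half_notMem_lattice {ω : ℂ} (hω : ω ∈ L.lattice) (hω2 : ω / 2 ∉ L.lattice) (m : ℕ) :
    ω / 2 + m * ω ∉ L.lattice := by
  intro h
  refine hω2 ?_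
  have hm : (m : ℂ) * ω ∈ L.lattice := by simpa using nsmul_mem hω m
  simpa using sub_mem h hm

lemma exists_norm_coeff_auxFun_le {ω : ℂ} (hω : ω ∈ L.lattice) (hω2 : ω / 2 ∉ L.lattice) (δ s : ℕ)
    (hδ : 1 ≤ δ) :
    ∃ t₀ : ℕ, ∀ t n : ℕ, t₀ ≤ t → n ^ 4 ≤ t →
      ∀ a : Fin (2 * (8 * s) * n ^ 2) × Fin (n ^ 2) → ℂ, (∀ x, ‖a x‖ ≤ (t : ℝ) ^ (5 * t)) →
      (∀ m < 8 * s, X ^ t ∣ taylorSeries (auxFun L δ a) (ω / 2 + m * ω)) → ∀ m < 8 * s,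
      ‖(t ! : ℂ) * coeff t (taylorSeries (auxFun L δ a) (ω / 2 + m * ω))‖ * (t : ℝ) ^ (s * t) ≤
        (t : ℝ) ^ (18 * t) := by
  classical
  obtain ⟨κ, C, hκ, hκ1, hC, hbox⟩ := exists_box_bounds L
  set Z : ℝ := 1 + 8 * s * ‖ω‖ with hZdef
  have hZ : 1 ≤ Z := by
    have : 0 ≤ 8 * s * ‖ω‖ := by positivity
    linarith
  have hω0 : ω ≠ 0 := by
    rintro rfl
    simp at hω2
  obtain ⟨δ₀, hδ₀, hδ₁, hdist⟩ : ∃ δ₀ : ℝ, 0 < δ₀ ∧ δ₀ ≤ 1 ∧ ∀ (m : ℕ), ∀ l ∈ L.lattice,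
      δ₀ ≤ ‖ω / 2 + m * ω - l‖ := by
    obtain ⟨ε, hε, hball⟩ := Metric.isOpen_iff.mp L.isClosed_lattice.isOpen_compl _ hω2
    refine ⟨min ε 1, by positivity, min_le_right _ _, fun m l hl ↦ (min_le_left _ _).trans ?_⟩
    by_contra! hlt
    have hm : (m : ℂ) * ω ∈ L.lattice := by simpa using nsmul_mem hω m
    refine hball (a := l - m * ω) ?_ (sub_mem hl hm)
    rw [Metric.mem_ball', dist_eq_norm]
    rwa [← sub_add, sub_add_eq_add_sub]
  set A₀ : ℝ := 4 * Z / κ + C + δ + 32 * s + (1 / δ₀) ^ 18 + 16 * (8 * Z / κ) ^ 8 + 2 with hA₀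
  have p1 : 0 ≤ 4 * Z / κ := by positivity
  have p2 : 0 ≤ (1 / δ₀) ^ 18 := by positivity
  have p3 : 0 ≤ 16 * (8 * Z / κ) ^ 8 := by positivity
  have p4 : (0 : ℝ) ≤ 32 * s := by positivity
  have p5 : (0 : ℝ) ≤ δ := by positivity
  refine ⟨⌈A₀⌉₊ ^ 4, fun t n ht hn a ha hord m hm ↦ ?_⟩
  obtain ⟨A, hAt, htA⟩ := exists_pow_four_le_lt t
  have hA₀A : A₀ ≤ A := by
    have : ⌈A₀⌉₊ < A + 1 := lt_of_pow_lt_pow_left' 4 (ht.trans_lt htA)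
    exact (Nat.le_ceil _).trans (by exact_mod_cast Nat.lt_succ_iff.mp this)
  have hnA : n ≤ A := Nat.lt_succ_iff.mp (lt_of_pow_lt_pow_left' 4 (hn.trans_lt htA))
  have hA2 : 2 ≤ A := by
    have : (2 : ℝ) ≤ A := by linarith
    exact_mod_cast this
  have hsA : 32 * s ≤ A := by
    have : (32 * s : ℝ) ≤ A := by linarith
    exact_mod_cast this
  have hA1 : (1 : ℝ) ≤ A := by exact_mod_cast (by omega : 1 ≤ A)
  have hAtR : (A : ℝ) ≤ t := by exact_mod_cast (Nat.le_self_pow four_ne_zero A).trans hAt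
  set R : ℝ := κ * A / 2 with hR
  have hRpos : 0 < R := by positivity
  have hRκ : R ≤ κ * A := by rw [hR]; linarith [mul_pos hκ (by linarith : (0 : ℝ) < A)]
  have hZR : 2 * Z ≤ R := by
    have : 4 * Z / κ ≤ A := by linarith
    rw [div_le_iff₀ hκ] at this
    rw [hR]
    linarith
  have hRZ : (t : ℝ) ≤ (R / (4 * Z)) ^ 8 := by
    have h16 : (t : ℝ) ≤ 16 * (A : ℝ) ^ 4 := by
      have : t ≤ 16 * A ^ 4 := by
        calc t ≤ (A + 1) ^ 4 := htA.le
          _ ≤ (2 * A) ^ 4 := by gcongr; omega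
          _ = _ := by ring
      exact_mod_cast this
    have hq : 16 * (8 * Z / κ) ^ 8 ≤ (A : ℝ) ^ 4 :=
      (by linarith : 16 * (8 * Z / κ) ^ 8 ≤ (A : ℝ)).trans (le_self_pow₀ hA1 four_ne_zero)
    have heq : R / (4 * Z) = A / (8 * Z / κ) := by
      rw [hR]
      field_simp
      ring
    rw [heq, div_pow, le_div_iff₀ (by positivity)]
    calc (t : ℝ) * (8 * Z / κ) ^ 8 ≤ 16 * (A : ℝ) ^ 4 * (8 * Z / κ) ^ 8 := by gcongr
      _ = (A : ℝ) ^ 4 * (16 * (8 * Z / κ) ^ 8) := by ring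
      _ ≤ (A : ℝ) ^ 4 * (A : ℝ) ^ 4 := by gcongr
      _ = _ := by ring
  set pts : Finset ℂ := (range (8 * s)).image fun m : ℕ ↦ ω / 2 + m * ω with hpts
  have hcard : #pts = 8 * s := by
    rw [hpts, Finset.card_image_of_injective _ fun i j hij ↦ by simpa [hω0] using hij, card_range]
  have hmem (k : ℕ) (hk : k < 8 * s) : ω / 2 + k * ω ∈ pts :=
    mem_image_of_mem _ (mem_range.mpr hk)
  have hnum : AnalyticOnNhd ℂ (auxNum L A δ a) (Metric.closedBall 0 R) := fun z hz ↦
    analyticAt_auxNum (hbox A (by omega) z ((mem_closedBall_zero_iff.mp hz).trans hRκ)).1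
  have hschwarz := norm_coeff_taylorSeries_le (s := pts) (t := t) (Z := Z) hnum hZ hZR (by
      intro x hx
      obtain ⟨k, hk, rfl⟩ := mem_image.mp hx
      have hk : (k : ℝ) + 1 ≤ 8 * s := by exact_mod_cast mem_range.mp hk
      calc ‖ω / 2 + k * ω‖ ≤ ‖ω‖ / 2 + k * ‖ω‖ := by
            simpa using norm_add_le (ω / 2) (k * ω)
        _ ≤ Z := by nlinarith [norm_nonneg ω]) (by
      intro x hx
      obtain ⟨k, hk, rfl⟩ := mem_image.mp hx
      rw [taylorSeries_auxNum (add_half_notMem_lattice hω hω2 k)]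
      exact (hord k (mem_range.mp hk)).mul_right _) (by
      intro z hz
      have hb := hbox A (by omega) z (hz.le.trans hRκ)
      have hδA : (1 : ℝ) ≤ δ * A :=
        one_le_mul_of_one_le_of_one_le (by exact_mod_cast hδ) hA1
      refine norm_auxNum_le (one_le_pow₀ (one_le_mul_of_one_le_of_one_le hC hA1)) ha ?_ hδA
        hb.2.2 hb.2.1
      rw [norm_mul, hz, Complex.norm_natCast]
      gcongr
      nlinarith) (hmem m hm)
  rw [coeff_taylorSeries_auxNum (add_half_notMem_lattice hω hω2 m) (hord m hm), hcard, norm_mul,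
    norm_pow] at hschwarz
  rw [norm_mul, Complex.norm_natCast]
  refine mul_pow_le_of_schwarz (norm_nonneg _) hZ hRZ
    (one_le_pow_mul_pow hAt hnA (by omega) hδ₀ hδ₁ ?_
      (pow_le_norm_boxPoly hδ₀.le hδ₁ (hdist m)))
    (auxNum_bound_le hAt hnA (by linarith) p5 ?_ ?_ hsA hA2) hschwarz
  all_goals linarith

end UpperBound

end SchneiderPeriods

namespace SchneiderPeriods

open PowerSeries NumberField
open scoped PeriodPair Nat

section NumberField

variable {K : Type*} [Field K]

lemma map_auxSeries (σ : K →+* ℂ) (L : PeriodPair) {M N : ℕ} (ξ : Fin M × Fin N → K) {u v : K⟦X⟧}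
    {δ z : ℂ} (hz : z ∉ L.lattice) (hu : u.map σ = taylorSeries ℘[L] z)
    (hv : v.map σ = taylorSeries (fun w ↦ δ * w) z) :
    (auxSeries ξ v u).map σ = taylorSeries (auxFun L δ (fun x ↦ σ (ξ x))) z := by
  have hP : AnalyticAt ℂ ℘[L] z := L.analyticOnNhd_weierstrassP z hz
  have hl : AnalyticAt ℂ (fun w ↦ δ * w) z := by fun_prop
  unfold auxFun auxSeries
  rw [taylorSeries_sum _ fun x _ ↦ by fun_prop, map_sum]
  refine Finset.sum_congr rfl fun x _ ↦ ?_
  rw [taylorSeries_mul (by fun_prop) (hP.fun_pow _), taylorSeries_mul (by fun_prop) (hl.fun_pow _),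
    taylorSeries_pow hP, taylorSeries_pow hl, taylorSeries_const, map_mul, map_mul, map_pow,
    map_pow, hu, hv, map_C, mul_assoc]

variable [NumberField K]

/-- Liouville's inequality for algebraic integers. -/
lemma one_le_norm_mul_pow_of_house_le (σ : K →+* ℂ) {γ : K} (hγ : IsIntegral ℤ γ) (h0 : γ ≠ 0)
    {H : ℝ} (hH : house γ ≤ H) : 1 ≤ ‖σ γ‖ * H ^ (Module.finrank ℚ K - 1) := by
  have h1 : (1 : ℝ) ≤ ‖Algebra.norm ℚ γ‖ := by
    obtain ⟨k, hk⟩ := IsIntegrallyClosed.isIntegral_iff.mp (Algebra.isIntegral_norm ℚ hγ)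
    have hk0 : k ≠ 0 := by
      rintro rfl
      exact (Algebra.norm_ne_zero_iff (R := ℚ)).mpr h0 (hk.symm.trans (map_zero _))
    rw [← hk, eq_intCast, ← Rat.norm_cast_real, Rat.cast_intCast, Real.norm_eq_abs]
    exact (by exact_mod_cast Int.one_le_abs hk0 : (1 : ℝ) ≤ |(k : ℝ)|)
  refine h1.trans ((norm_norm_le_norm_mul_house_pow γ σ).trans ?_)
  gcongr
  exact house_nonneg _

/-- A half period and the value of `℘` there are not both algebraic if `g₂` is algebraic. -/
theorem false_of_map_eq_half_period (σ : K →+* ℂ) (L : PeriodPair) {ω : ℂ} (hω : ω ∈ L.lattice)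
    (hω2 : ω / 2 ∉ L.lattice) {δ : ℕ} (hδ : 1 ≤ δ) {θ e h : K} (hθ : IsIntegral ℤ θ)
    (he : IsIntegral ℤ e) (hh : IsIntegral ℤ h) (hσθ : σ θ = δ * (ω / 2))
    (hσe : σ e = ℘[L] (ω / 2)) (hσh : σ h = L.g₂ / 2) : False := by
  obtain ⟨u, hu, hu0, hu1, hu2⟩ := exists_map_eq_of_derivative_derivative σ
    (u := taylorSeries ℘[L] (ω / 2)) (e := e) (h := h)
    (by rw [hσh, derivative_derivative_taylorSeries_weierstrassP hω2])
    (by rw [coeff_zero_taylorSeries, hσe])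
    (by
      rw [coeff_one_taylorSeries, L.deriv_weierstrassP]
      exact derivWeierstrassP_eq_zero (by simpa using hω))
  obtain ⟨B, ρ, hB, hρ, huB⟩ := exists_houseBound_of_derivative_derivative hu2 hu1
  set d := Module.finrank ℚ K with hd
  set s := 19 + 10 * d with hs
  set v : ℕ → K⟦X⟧ := fun m ↦ C ((2 * m + 1 : ℕ) * θ) + C (δ : K) * X with hv
  set D : ℝ := B + house (δ : K) + (2 * (8 * s) + 1 : ℕ) * house θ with hDdef
  have hθ0 := house_nonneg θ
  have hδ0 := house_nonneg (δ : K)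
  have hBD : B ≤ D := by
    have : 0 ≤ (2 * (8 * s) + 1 : ℕ) * house θ := by positivity
    linarith
  have hvD : ∀ m < 8 * s, ∀ t, HouseBound t D ρ (v m) := by
    intro m hm t
    refine houseBound_C_add_X hρ (by linarith) ?_ ?_
    · rw [house_nat_mul]
      have : ((2 * m + 1 : ℕ) : ℝ) * house θ ≤ (2 * (8 * s) + 1 : ℕ) * house θ := by gcongr
      linarith
    · have : 0 ≤ (2 * (8 * s) + 1 : ℕ) * house θ := by positivity
      linarith
  obtain ⟨n₀, hn₀⟩ := exists_auxSeries (u := u) (v := v) (S := 8 * s) (by omega) (hB.trans hBD) hρ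
    (fun t ↦ (huB t).mono hBD (by linarith)) hvD
    (factorialIntegral_of_derivative_derivative hu2 (by rwa [hu0]) hu1 hh)
    (fun m t ↦ factorialIntegral_C_add_X ((isIntegral_natCast _).mul hθ) (isIntegral_natCast _))
  obtain ⟨t₀, ht₀⟩ := exists_norm_coeff_auxFun_le hω hω2 δ s hδ
  set n := n₀ + t₀ + 2
  obtain ⟨ξ, hξ0, hξ, hξt⟩ := hn₀ n (by omega)
  have hz (m : ℕ) : ω / 2 + m * ω ∉ L.lattice := add_half_notMem_lattice hω hω2 m
  have hmap (m : ℕ) : (auxSeries ξ (v m) u).map σ =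
      taylorSeries (auxFun L δ (fun x ↦ σ (ξ x))) (ω / 2 + m * ω) := by
    refine map_auxSeries σ L ξ (hz m) ?_ ?_
    · rw [hu, taylorSeries_add_of_periodic fun w ↦ ?_]
      exact L.weierstrassP_add_coe w ⟨m * ω, by simpa using nsmul_mem hω m⟩
    · have : (δ : ℂ) * (ω / 2 + m * ω) = (2 * m + 1 : ℕ) * (δ * (ω / 2)) := by
        push_cast
        ring
      rw [taylorSeries_const_mul, this]
      simp only [hv, map_add, map_mul, map_C, map_X, map_natCast, hσθ]
  have hex : ∃ t, ∃ m < 8 * s, coeff t (auxSeries ξ (v m) u) ≠ 0 := by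
    by_contra! hcon
    have h0 : taylorSeries (auxFun L δ (fun x ↦ σ (ξ x))) (ω / 2 + (0 : ℕ) * ω) = 0 := by
      rw [← hmap]
      ext t
      simp [hcon t 0 (by omega)]
    have h1 := eq_zero_of_sum_pow_mul_weierstrassP_pow_eq_zero (L := L)
      (a := fun x ↦ σ (ξ x) * (δ : ℂ) ^ (x.1 : ℕ)) fun w hw ↦ by
        rw [← eqOn_zero_of_taylorSeries_eq_zero (fun w hw ↦ analyticAt_auxFun hw) (hz 0) h0 hw,
          auxFun]
        exact Finset.sum_congr rfl fun x _ ↦ by ring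
    refine hξ0 (funext fun x ↦ σ.injective ?_)
    have hδ' : (δ : ℂ) ^ (x.1 : ℕ) ≠ 0 := pow_ne_zero _ (by exact_mod_cast (by omega : δ ≠ 0))
    simpa using (mul_eq_zero.mp (congr_fun h1 x)).resolve_right hδ'
  classical
  obtain ⟨t, ⟨m, hm, htm⟩, hmin⟩ : ∃ t, (∃ m < 8 * s, coeff t (auxSeries ξ (v m) u) ≠ 0) ∧
      ∀ k < t, ∀ m < 8 * s, coeff k (auxSeries ξ (v m) u) = 0 := by
    refine ⟨Nat.find hex, Nat.find_spec hex, fun k hk m hm ↦ ?_⟩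
    by_contra hne
    exact Nat.find_min hex hk ⟨m, hm, hne⟩
  have hnt : n ^ 4 ≤ t := by
    by_contra! hlt
    exact htm (hξ m hm t hlt)
  have hnt1 : n ≤ t := (Nat.le_self_pow four_ne_zero n).trans hnt
  obtain ⟨hξb, hγ⟩ := hξt t hnt
  obtain ⟨hint, hhouse⟩ := hγ m hm
  have hsmall := ht₀ t n (by omega) hnt (fun x ↦ σ (ξ x))
    (fun x ↦ (norm_embedding_le_house _ _).trans (hξb x))
    (fun k hk ↦ by
      rw [← hmap, X_pow_dvd_iff]
      intro j hj
      rw [coeff_map, hmin j hj k hk, map_zero]) m hm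
  rw [← hmap, coeff_map] at hsmall
  have hbig := one_le_norm_mul_pow_of_house_le σ hint
    (mul_ne_zero (by exact_mod_cast t.factorial_ne_zero) htm) hhouse
  rw [map_mul, map_natCast, ← hd] at hbig
  have ht1 : (1 : ℝ) < t := by exact_mod_cast (by omega : 1 < t)
  have : (t : ℝ) ^ (s * t) ≤ (t : ℝ) ^ (18 * t + 10 * t * (d - 1)) := by
    calc (t : ℝ) ^ (s * t) = 1 * (t : ℝ) ^ (s * t) := (one_mul _).symm
      _ ≤ ‖(t ! : ℂ) * σ (coeff t (auxSeries ξ (v m) u))‖ * ((t : ℝ) ^ (10 * t)) ^ (d - 1) *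
          (t : ℝ) ^ (s * t) := by gcongr
      _ = ‖(t ! : ℂ) * σ (coeff t (auxSeries ξ (v m) u))‖ * (t : ℝ) ^ (s * t) *
          ((t : ℝ) ^ (10 * t)) ^ (d - 1) := by ring
      _ ≤ (t : ℝ) ^ (18 * t) * ((t : ℝ) ^ (10 * t)) ^ (d - 1) := by gcongr
      _ = _ := by rw [← pow_mul, ← pow_add]
  have h2 := (pow_le_pow_iff_right₀ ht1).mp this
  have h3 : 18 * t + 10 * t * (d - 1) ≤ (18 + 10 * d) * t := by
    calc 18 * t + 10 * t * (d - 1) ≤ 18 * t + 10 * t * d := by gcongr; omega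
      _ = _ := by ring
  have h4 : (18 + 10 * d) * t < s * t := Nat.mul_lt_mul_of_pos_right (by omega) (by omega)
  omega

end NumberField

end SchneiderPeriods

namespace SchneiderPeriods

open scoped PeriodPair Topology
open Filter

section Reduction

lemma isAlgebraic_two : IsAlgebraic ℚ (2 : ℂ) := by
  exact_mod_cast isAlgebraic_natCast (R := ℚ) (A := ℂ) 2

lemma exists_nat_isIntegral_mul {z : ℂ} (hz : IsAlgebraic ℚ z) :
    ∃ d : ℕ, 1 ≤ d ∧ IsIntegral ℤ ((d : ℂ) * z) := by
  obtain ⟨y, hy, h⟩ := ((IsFractionRing.isAlgebraic_iff ℤ ℚ ℂ).mpr hz).exists_integral_multiple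
  refine ⟨y.natAbs, Nat.one_le_iff_ne_zero.mpr (Int.natAbs_ne_zero.mpr hy), ?_⟩
  rw [zsmul_eq_mul] at h
  rcases Int.natAbs_eq y with hy | hy <;> rw [hy] at h
  · simpa using h
  · simpa using h.neg

variable {L : PeriodPair}

lemma isIntegral_of_pow_three_eq_algebraMap {R A : Type*} [CommRing R] [CommRing A] [Algebra R A]
    {x : A} {a b : R} (h : x ^ 3 = algebraMap R A a * x + algebraMap R A b) : IsIntegral R x := by
  nontriviality R
  have hdeg : (Polynomial.C a * Polynomial.X + Polynomial.C b).degree < ((3 : ℕ) : WithBot ℕ) :=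
    Polynomial.degree_linear_le.trans_lt (by norm_num)
  refine ⟨Polynomial.X ^ 3 - (Polynomial.C a * Polynomial.X + Polynomial.C b),
    (Polynomial.monic_X_pow 3).sub_of_left (by rwa [Polynomial.degree_X_pow]), ?_⟩
  simp [Polynomial.eval₂_sub, h]

lemma isIntegral_of_pow_three_eq {R A : Type*} [CommRing R] [CommRing A] [Algebra R A] {x a b : A}
    (ha : IsIntegral R a) (hb : IsIntegral R b) (h : x ^ 3 = a * x + b) : IsIntegral R x :=
  isIntegral_trans x (isIntegral_of_pow_three_eq_algebraMap
    (R := integralClosure R A) (a := ⟨a, ha⟩) (b := ⟨b, hb⟩) h)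

lemma isIntegral_weierstrassP_half_period (h2 : IsIntegral ℤ (L.g₂ / 4))
    (h3 : IsIntegral ℤ (L.g₃ / 4)) {w : ℂ} (hw : w ∉ L.lattice) (hw2 : w + w ∈ L.lattice) :
    IsIntegral ℤ (℘[L] w) := by
  refine isIntegral_of_pow_three_eq h2 h3 ?_
  have h := L.derivWeierstrassP_sq w hw
  rw [derivWeierstrassP_eq_zero hw2] at h
  linear_combination -h / 4

lemma transcendental_of_isIntegral_of_half_notMem (h2 : IsIntegral ℤ (L.g₂ / 4))
    (h3 : IsIntegral ℤ (L.g₃ / 4)) {ω : ℂ} (hω : ω ∈ L.lattice) (hω2 : ω / 2 ∉ L.lattice) :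
    Transcendental ℚ ω := by
  intro halg
  obtain ⟨δ, hδ, hθ⟩ := exists_nat_isIntegral_mul (z := ω / 2) (by
    rw [div_eq_mul_inv]
    exact halg.mul isAlgebraic_two.inv)
  have he := isIntegral_weierstrassP_half_period h2 h3 hω2 (by simpa using hω)
  have hh : IsIntegral ℤ (L.g₂ / 2) := by
    have : L.g₂ / 2 = (2 : ℤ) * (L.g₂ / 4) := by push_cast; ring
    rw [this]
    exact isIntegral_algebraMap.mul h2
  let S : Set ℂ := {δ * (ω / 2), ℘[L] (ω / 2), L.g₂ / 2}
  have hS : ∀ x ∈ S, IsIntegral ℚ x := by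
    rintro x (rfl | rfl | rfl)
    exacts [hθ.tower_top, he.tower_top, hh.tower_top]
  have : Finite S := Set.toFinite S
  let K := IntermediateField.adjoin ℚ S
  have : FiniteDimensional ℚ K := IntermediateField.finiteDimensional_adjoin hS
  have : NumberField K := ⟨⟩
  have hint (x : K) (hx : IsIntegral ℤ (x : ℂ)) : IsIntegral ℤ x :=
    (isIntegral_algebraMap_iff (algebraMap K ℂ).injective).mp hx
  have hmem {x : ℂ} (hx : x ∈ S) : x ∈ K := IntermediateField.subset_adjoin ℚ S hx
  exact false_of_map_eq_half_period (algebraMap K ℂ) L hω hω2 hδ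
    (θ := ⟨_, hmem (.inl rfl)⟩) (e := ⟨_, hmem (.inr (.inl rfl))⟩)
    (h := ⟨_, hmem (.inr (.inr rfl))⟩) (hint _ hθ) (hint _ he) (hint _ hh) rfl rfl rfl

lemma exists_div_two_pow_mem_lattice {ω : ℂ} (hω : ω ∈ L.lattice) (hω0 : ω ≠ 0) :
    ∃ k : ℕ, ω / 2 ^ k ∈ L.lattice ∧ ω / 2 ^ k / 2 ∉ L.lattice := by
  by_contra! hcon
  have hmem : ∀ k : ℕ, ω / 2 ^ k ∈ L.lattice := by
    intro k
    induction k with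
    | zero => simpa using hω
    | succ k ih => simpa [pow_succ, div_div] using hcon k ih
  have hlim : Tendsto (fun k : ℕ ↦ ω / 2 ^ k) atTop (𝓝 0) := by
    have := (tendsto_pow_atTop_nhds_zero_of_norm_lt_one (x := (2 : ℂ)⁻¹) (by norm_num)).const_mul ω
    simpa [div_eq_mul_inv] using this
  obtain ⟨k, hk⟩ := (hlim.eventually (L.compl_lattice_sdiff_singleton_mem_nhds 0)).exists
  exact hk ⟨hmem k, by simpa using hω0⟩

lemma G_eq_tsum_indicator (L : PeriodPair) (n : ℕ) :
    L.G n = ∑' z : ℂ, (L.lattice : Set ℂ).indicator (fun z ↦ (z ^ n)⁻¹) z :=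
  tsum_subtype (L.lattice : Set ℂ) fun z ↦ (z ^ n)⁻¹

lemma exists_rescaled (L : PeriodPair) {d : ℂ} (hd : d ≠ 0) :
    ∃ L' : PeriodPair, (∀ z, z ∈ L'.lattice ↔ d * z ∈ L.lattice) ∧ ∀ n, L'.G n = d ^ n * L.G n := by
  have hind : LinearIndependent ℝ ![d⁻¹ * L.ω₁, d⁻¹ * L.ω₂] := by
    have h : ![d⁻¹ * L.ω₁, d⁻¹ * L.ω₂] = LinearMap.mulLeft ℝ d⁻¹ ∘ ![L.ω₁, L.ω₂] := by
      ext i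
      fin_cases i <;> simp
    rw [h]
    exact L.indep.map' _ (LinearMap.ker_eq_bot_of_injective
      (mul_right_injective₀ (inv_ne_zero hd)))
  let L' : PeriodPair := ⟨d⁻¹ * L.ω₁, d⁻¹ * L.ω₂, hind⟩
  have hmem (z : ℂ) : z ∈ L'.lattice ↔ d * z ∈ L.lattice := by
    simp only [PeriodPair.mem_lattice]
    refine exists_congr fun m ↦ exists_congr fun n ↦ ?_
    rw [← mul_right_inj' hd]
    have : d * (m * (d⁻¹ * L.ω₁) + n * (d⁻¹ * L.ω₂)) = m * L.ω₁ + n * L.ω₂ := by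
      field_simp
    exact iff_of_eq (congr_arg (· = d * z) this)
  refine ⟨L', hmem, fun n ↦ ?_⟩
  rw [G_eq_tsum_indicator, G_eq_tsum_indicator, ← (Equiv.mulLeft₀ d hd).tsum_eq
    ((L.lattice : Set ℂ).indicator _), ← tsum_mul_left]
  refine tsum_congr fun z ↦ ?_
  rw [Equiv.mulLeft₀_apply]
  by_cases hz : z ∈ L'.lattice
  · rw [Set.indicator_of_mem (SetLike.mem_coe.mpr hz),
      Set.indicator_of_mem (SetLike.mem_coe.mpr ((hmem z).mp hz))]
    rw [mul_pow, mul_inv, mul_inv_cancel_left₀ (pow_ne_zero n hd)]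
  · rw [Set.indicator_of_notMem (mt SetLike.mem_coe.mp hz),
      Set.indicator_of_notMem (mt SetLike.mem_coe.mp (mt (hmem z).mpr hz)), mul_zero]

theorem transcendental_of_mem_lattice (h2 : IsAlgebraic ℚ L.g₂) (h3 : IsAlgebraic ℚ L.g₃) {ω : ℂ}
    (hω : ω ∈ L.lattice) (hω0 : ω ≠ 0) : Transcendental ℚ ω := by
  have h4 : IsAlgebraic ℚ (4 : ℂ)⁻¹ := by
    have : (4 : ℂ)⁻¹ = 2⁻¹ ^ 2 := by norm_num
    rw [this]
    exact isAlgebraic_two.inv.pow 2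
  obtain ⟨a, ha, hia⟩ := exists_nat_isIntegral_mul (h2.mul h4)
  obtain ⟨b, hb, hib⟩ := exists_nat_isIntegral_mul (h3.mul h4)
  have hd : ((a * b : ℕ) : ℂ) ≠ 0 := by exact_mod_cast (Nat.mul_pos ha hb).ne'
  obtain ⟨L', hL', hG⟩ := exists_rescaled L hd
  obtain ⟨k, hk, hk2⟩ := exists_div_two_pow_mem_lattice hω hω0
  have h2' : IsIntegral ℤ (L'.g₂ / 4) := by
    have : L'.g₂ / 4 = ((a ^ 3 * b ^ 4 : ℕ) : ℂ) * (a * (L.g₂ * 4⁻¹)) := by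
      rw [PeriodPair.g₂, PeriodPair.g₂, hG]
      push_cast
      ring
    rw [this]
    exact (isIntegral_natCast _).mul hia
  have h3' : IsIntegral ℤ (L'.g₃ / 4) := by
    have : L'.g₃ / 4 = ((a ^ 6 * b ^ 5 : ℕ) : ℂ) * (b * (L.g₃ * 4⁻¹)) := by
      rw [PeriodPair.g₃, PeriodPair.g₃, hG]
      push_cast
      ring
    rw [this]
    exact (isIntegral_natCast _).mul hib
  have hcancel (z : ℂ) : ((a * b : ℕ) : ℂ) * (z / (a * b : ℕ)) = z := mul_div_cancel₀ z hd
  refine fun halg ↦ transcendental_of_isIntegral_of_half_notMem h2' h3'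
    (ω := ω / 2 ^ k / (a * b : ℕ)) ?_ ?_ ?_
  · rwa [hL', hcancel]
  · rwa [hL', div_right_comm, hcancel]
  · simp only [div_eq_mul_inv]
    exact (halg.mul (isAlgebraic_two.pow k).inv).mul (isAlgebraic_natCast _).inv

lemma tsum_nonzero_eq_G (L : PeriodPair) {n : ℕ} (hn : n ≠ 0) {s : Set ℂ}
    (hs : ∀ z, z ∈ s ↔ z ∈ L.lattice ∧ z ≠ 0) : ∑' w : s, ((w : ℂ) ^ n)⁻¹ = L.G n := by
  rw [G_eq_tsum_indicator, tsum_subtype s fun z ↦ (z ^ n)⁻¹]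
  refine tsum_congr fun z ↦ ?_
  rcases eq_or_ne z 0 with rfl | hz
  · simp [Set.indicator, hn]
  · have : z ∈ s ↔ z ∈ (L.lattice : Set ℂ) := by simp [hs, hz]
    by_cases hzs : z ∈ s
    · rw [Set.indicator_of_mem hzs, Set.indicator_of_mem (this.mp hzs)]
    · rw [Set.indicator_of_notMem hzs, Set.indicator_of_notMem (mt this.mpr hzs)]

end Reduction

end SchneiderPeriods

/-- (Schneider) If the Eisenstein invariants `g₂ = 60 ∑_{ω ∈ L∖{0}} ω⁻⁴` and
`g₃ = 140 ∑_{ω ∈ L∖{0}} ω⁻⁶` of the lattice `L = ℤω₁ + ℤω₂` are algebraic numbers,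
then every nonzero element of `L` is transcendental over `ℚ`. -/
theorem schneider_periods_transcendental (ω₁ ω₂ : ℂ)
    (hindep : LinearIndependent ℝ ![ω₁, ω₂])
    (L : AddSubgroup ℂ) (hL : L = AddSubgroup.closure {ω₁, ω₂})
    (hg₂ : IsAlgebraic ℚ ((60 : ℂ) * ∑' w : {z : ℂ // z ∈ L ∧ z ≠ 0}, ((w : ℂ) ^ 4)⁻¹))
    (hg₃ : IsAlgebraic ℚ ((140 : ℂ) * ∑' w : {z : ℂ // z ∈ L ∧ z ≠ 0}, ((w : ℂ) ^ 6)⁻¹)) :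
    ∀ ω : ℂ, ω ∈ L → ω ≠ 0 → Transcendental ℚ ω := by
  let P : PeriodPair := ⟨ω₁, ω₂, hindep⟩
  have hmem (z : ℂ) : z ∈ L ↔ z ∈ P.lattice := by
    rw [hL, AddSubgroup.mem_closure_pair, PeriodPair.lattice, Submodule.mem_span_pair]
  have hs (z : ℂ) : z ∈ {z : ℂ | z ∈ L ∧ z ≠ 0} ↔ z ∈ P.lattice ∧ z ≠ 0 := by
    rw [Set.mem_ofPred_eq, hmem]
  have h2 : IsAlgebraic ℚ P.g₂ := by
    rw [PeriodPair.g₂, ← SchneiderPeriods.tsum_nonzero_eq_G P four_ne_zero hs]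
    exact hg₂
  have h3 : IsAlgebraic ℚ P.g₃ := by
    rw [PeriodPair.g₃, ← SchneiderPeriods.tsum_nonzero_eq_G P (by norm_num : 6 ≠ 0) hs]
    exact hg₃
  exact fun ω hω hω0 ↦
    SchneiderPeriods.transcendental_of_mem_lattice h2 h3 ((hmem ω).mp hω) hω0
end

section
/- Let ω₁, ω₂ ∈ ℂ be linearly independent over ℝ and let L = ℤω₁ + ℤω₂ be the lattice they generate. Suppose z ∈ ℂ satisfies z·L ⊆ L but z is not a rational integer (z ∉ ℤ). Then z is not real, z is an algebraic number of degree 2 over ℚ (indeed an algebraic integer satisfying a monic quadratic equation with integer coefficients), and the quotient τ = ω₂/ω₁ is algebraic of degree 2 over ℚ. -/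
open Polynomial in
/-- A non-real complex root of a rational quadratic has degree `2` over `ℚ`. -/
theorem natDegree_minpoly_eq_two_of_not_real {x : ℂ} (hx : ¬ ∃ r : ℝ, x = (r : ℂ)) {p q r : ℚ}
    (hp : p ≠ 0) (h : (p : ℂ) * x ^ 2 + (q : ℂ) * x + (r : ℂ) = 0) :
    (minpoly ℚ x).natDegree = 2 := by
  have hroot : aeval x (C p * X ^ 2 + C q * X + C r) = 0 := by
    simpa using h
  have hdeg := natDegree_quadratic (b := q) (c := r) hp
  have hne : C p * X ^ 2 + C q * X + C r ≠ 0 := by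
    rintro h0
    simp [h0] at hdeg
  have hint : IsIntegral ℚ x := IsAlgebraic.isIntegral ⟨_, hne, hroot⟩
  refine le_antisymm (hdeg ▸ natDegree_le_of_dvd (minpoly.dvd ℚ x hroot) hne) ?_
  rw [minpoly.two_le_natDegree_iff hint]
  rintro ⟨s, rfl⟩
  exact hx ⟨s, by simp⟩

/-- The quotient of two real-linearly independent complex numbers is not real. -/
theorem not_real_div_of_linearIndependent {ω₁ ω₂ : ℂ}
    (hindep : LinearIndependent ℝ ![ω₁, ω₂]) : ¬ ∃ r : ℝ, ω₂ / ω₁ = (r : ℂ) := by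
  rintro ⟨r, hr⟩
  have h₁ : ω₁ ≠ 0 := hindep.ne_zero 0
  rw [div_eq_iff h₁] at hr
  have := (LinearIndependent.pair_iff.1 hindep r (-1) (by simp [hr])).2
  norm_num at this


/-- If `z` is a multiplier of the lattice `L = ℤω₁ + ℤω₂` (i.e. `z·L ⊆ L`) and `z` is not
a rational integer, then `z` is not real, `z` is an algebraic integer of degree `2` over
`ℚ` (it satisfies a monic quadratic equation with integer coefficients), and
`τ = ω₂/ω₁` is algebraic of degree `2` over `ℚ`. -/
theorem complex_multiplication_quadratic (ω₁ ω₂ : ℂ)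
    (hindep : LinearIndependent ℝ ![ω₁, ω₂])
    (L : AddSubgroup ℂ) (hL : L = AddSubgroup.closure {ω₁, ω₂})
    (z : ℂ) (hmul : ∀ ω ∈ L, z * ω ∈ L) (hz : ¬ ∃ n : ℤ, z = (n : ℂ)) :
    (¬ ∃ r : ℝ, z = (r : ℂ)) ∧
    (∃ b c : ℤ, z ^ 2 + (b : ℂ) * z + (c : ℂ) = 0) ∧
    (minpoly ℚ z).natDegree = 2 ∧
    (minpoly ℚ (ω₂ / ω₁)).natDegree = 2 := by
  have h₁ : ω₁ ≠ 0 := hindep.ne_zero 0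
  have hτ := not_real_div_of_linearIndependent hindep
  subst hL
  obtain ⟨a, b, hab⟩ := AddSubgroup.mem_closure_pair.1
    (hmul ω₁ (AddSubgroup.subset_closure (by simp)))
  obtain ⟨c, d, hcd⟩ := AddSubgroup.mem_closure_pair.1
    (hmul ω₂ (AddSubgroup.subset_closure (by simp)))
  simp only [zsmul_eq_mul] at hab hcd
  set τ := ω₂ / ω₁ with hτ_def
  have hω : ω₂ = τ * ω₁ := by rw [hτ_def, div_mul_cancel₀ _ h₁]
  have hz_eq : z = a + b * τ := by
    apply mul_right_cancel₀ h₁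
    rw [← hab, hω]; ring
  have hzτ : z * τ = c + d * τ := by
    apply mul_right_cancel₀ h₁
    linear_combination -hcd + (z - d) * (-hω)
  have hb : b ≠ 0 := by
    rintro rfl
    exact hz ⟨a, by simpa using hz_eq⟩
  have hbC : (b : ℂ) ≠ 0 := by exact_mod_cast hb
  have hz_real : ¬ ∃ r : ℝ, z = (r : ℂ) := by
    rintro ⟨r, hr⟩
    refine hτ ⟨(r - a) / b, ?_⟩
    push_cast
    rw [← hr, hz_eq]
    field_simp
    ring
  have hz_quad : z ^ 2 + ((-(a + d) : ℤ) : ℂ) * z + ((a * d - b * c : ℤ) : ℂ) = 0 := by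
    push_cast
    linear_combination (z - d) * hz_eq + b * hzτ
  refine ⟨hz_real, ⟨_, _, hz_quad⟩, ?_, ?_⟩
  · exact natDegree_minpoly_eq_two_of_not_real hz_real (p := 1) (q := (-(a + d) : ℤ))
      (r := (a * d - b * c : ℤ)) one_ne_zero (by push_cast at hz_quad ⊢; linear_combination hz_quad)
  · exact natDegree_minpoly_eq_two_of_not_real hτ (p := b) (q := a - d) (r := -c)
      (by exact_mod_cast hb) (by push_cast; linear_combination hzτ - τ * hz_eq)
end

section
/- For any two admissible compositions s and s′, of weights w and w′ respectively, the product ζ(s)·ζ(s′) of the corresponding multiple zeta values lies in 𝔷_{w+w′}, the ℚ-linear span in ℝ of multiple zeta values of weight w + w′. Consequently 𝔷_w · 𝔷_{w′} ⊆ 𝔷_{w+w′} and the sum ∑_w 𝔷_w is a ℚ-subalgebra of ℝ. -/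
/-- The multiple zeta value `ζ(s) = ∑_{n₁ > ⋯ > n_k ≥ 1} n₁^{-s₁} ⋯ n_k^{-s_k}`. -/
noncomputable def mzv (k : ℕ) (s : Fin k → ℕ) : ℝ :=
  ∑' n : {n : Fin k → ℕ+ // StrictAnti n}, ∏ i : Fin k, (((n.1 i : ℕ) : ℝ) ^ s i)⁻¹

/-- A composition `s = (s₁, …, s_k)` of positive integers with `s₁ ≥ 2` is admissible. -/
def IsAdmissible (k : ℕ) (s : Fin k → ℕ) : Prop :=
  ∃ hk : 0 < k, (∀ i, 1 ≤ s i) ∧ 2 ≤ s ⟨0, hk⟩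

/-- `𝔷_w`: the `ℚ`-linear span in `ℝ` of the multiple zeta values of weight `w`
(with the conventions `𝔷₀ = ℚ`, `𝔷₁ = 0`; for `w = 1` there is no admissible
composition of weight `1`, so the span below is indeed `0`). -/
noncomputable def zetaSpan (w : ℕ) : Submodule ℚ ℝ :=
  if w = 0 then Submodule.span ℚ {(1 : ℝ)}
  else Submodule.span ℚ
    {x : ℝ | ∃ (k : ℕ) (s : Fin k → ℕ), IsAdmissible k s ∧ (∑ i, s i) = w ∧ x = mzv k s}

/-- The pairs of strictly increasing maps `Fin k → Fin l`, `Fin k' → Fin l` that are jointly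
surjective; they index the terms of depth `l` of the quasi-shuffle product. -/
abbrev QuasiShuffle (k k' l : ℕ) : Type :=
  {f : (Fin k → Fin l) × (Fin k' → Fin l) //
    StrictMono f.1 ∧ StrictMono f.2 ∧ ∀ j, (∃ i, f.1 i = j) ∨ ∃ i, f.2 i = j}

namespace QuasiShuffle

variable {k k' l : ℕ}

/-- The composition attached to a quasi-shuffle: exponents landing on the same index add up. -/
def exponent (f : QuasiShuffle k k' l) (s : Fin k → ℕ) (s' : Fin k' → ℕ) (j : Fin l) : ℕ :=
  (∑ i with f.1.1 i = j, s i) + ∑ i with f.1.2 i = j, s' i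

lemma sum_exponent (f : QuasiShuffle k k' l) (s : Fin k → ℕ) (s' : Fin k' → ℕ) :
    ∑ j, f.exponent s s' j = ∑ i, s i + ∑ i, s' i := by
  simp only [exponent, Finset.sum_add_distrib, Finset.sum_fiberwise]

lemma le_exponent_left (f : QuasiShuffle k k' l) (s : Fin k → ℕ) (s' : Fin k' → ℕ) (i : Fin k) :
    s i ≤ f.exponent s s' (f.1.1 i) :=
  le_add_right (Finset.single_le_sum_of_canonicallyOrdered (f := s) (by simp))

lemma le_exponent_right (f : QuasiShuffle k k' l) (s : Fin k → ℕ) (s' : Fin k' → ℕ)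
    (i : Fin k') : s' i ≤ f.exponent s s' (f.1.2 i) :=
  le_add_left (Finset.single_le_sum_of_canonicallyOrdered (f := s') (by simp))

lemma isAdmissible_exponent (f : QuasiShuffle k k' l) {s : Fin k → ℕ} {s' : Fin k' → ℕ}
    (hs : IsAdmissible k s) (hs' : IsAdmissible k' s') : IsAdmissible l (f.exponent s s') := by
  obtain ⟨hk, hpos, htwo⟩ := hs
  obtain ⟨hk', hpos', htwo'⟩ := hs'
  have hl : 0 < l := (Nat.zero_le _).trans_lt (f.1.1 ⟨0, hk⟩).isLt
  refine ⟨hl, fun j ↦ ?_, ?_⟩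
  · rcases f.2.2.2 j with ⟨i, rfl⟩ | ⟨i, rfl⟩
    · exact (hpos i).trans (f.le_exponent_left s s' i)
    · exact (hpos' i).trans (f.le_exponent_right s s' i)
  · rcases f.2.2.2 ⟨0, hl⟩ with ⟨i, hi⟩ | ⟨i, hi⟩
    · have h : f.1.1 ⟨0, hk⟩ = ⟨0, hl⟩ :=
        le_antisymm (hi ▸ f.2.1.monotone (Nat.zero_le i.val)) (Nat.zero_le _)
      exact h ▸ htwo.trans (f.le_exponent_left s s' _)
    · have h : f.1.2 ⟨0, hk'⟩ = ⟨0, hl⟩ :=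
        le_antisymm (hi ▸ f.2.2.1.monotone (Nat.zero_le i.val)) (Nat.zero_le _)
      exact h ▸ htwo'.trans (f.le_exponent_right s s' _)

lemma prod_pow_exponent {M : Type*} [CommMonoid M] (f : QuasiShuffle k k' l) (s : Fin k → ℕ)
    (s' : Fin k' → ℕ) (x : Fin l → M) :
    ∏ j, x j ^ f.exponent s s' j = (∏ i, x (f.1.1 i) ^ s i) * ∏ i, x (f.1.2 i) ^ s' i := by
  simp only [exponent, pow_add, Finset.prod_mul_distrib, ← Finset.prod_pow_eq_pow_sum]
  congr 1
  · rw [← Finset.prod_fiberwise Finset.univ f.1.1]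
    exact Finset.prod_congr rfl fun j _ ↦ Finset.prod_congr rfl fun i hi ↦ by
      rw [(Finset.mem_filter.1 hi).2]
  · rw [← Finset.prod_fiberwise Finset.univ f.1.2]
    exact Finset.prod_congr rfl fun j _ ↦ Finset.prod_congr rfl fun i hi ↦ by
      rw [(Finset.mem_filter.1 hi).2]

lemma length_le (f : QuasiShuffle k k' l) : l ≤ k + k' := by
  have h : Function.Surjective (Sum.elim f.1.1 f.1.2) := fun j ↦ by
    rcases f.2.2.2 j with ⟨i, hi⟩ | ⟨i, hi⟩
    · exact ⟨.inl i, hi⟩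
    · exact ⟨.inr i, hi⟩
  simpa using Fintype.card_le_of_surjective _ h

lemma range_comp_union (f : QuasiShuffle k k' l) {α : Type*} (m : Fin l → α) :
    Set.range (m ∘ f.1.1) ∪ Set.range (m ∘ f.1.2) = Set.range m := by
  ext x
  constructor
  · rintro (⟨i, rfl⟩ | ⟨i, rfl⟩) <;> exact ⟨_, rfl⟩
  · rintro ⟨j, rfl⟩
    rcases f.2.2.2 j with ⟨i, rfl⟩ | ⟨i, rfl⟩
    · exact .inl ⟨i, rfl⟩
    · exact .inr ⟨i, rfl⟩

end QuasiShuffle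

/-- Merge a quasi-shuffle and a strictly decreasing sequence into a pair of sequences. -/
def quasiShuffleMerge (k k' : ℕ) (α : Type*) [PartialOrder α]
    (p : Σ q : (Σ l : Fin (k + k' + 1), QuasiShuffle k k' l), {m : Fin q.1 → α // StrictAnti m}) :
    {n : Fin k → α // StrictAnti n} × {n : Fin k' → α // StrictAnti n} :=
  (⟨p.2.1 ∘ p.1.2.1.1, p.2.2.comp_strictMono p.1.2.2.1⟩,
    ⟨p.2.1 ∘ p.1.2.1.2, p.2.2.comp_strictMono p.1.2.2.2.1⟩)

lemma quasiShuffleMerge_injective (k k' : ℕ) (α : Type*) [PartialOrder α] :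
    Function.Injective (quasiShuffleMerge k k' α) := by
  rintro ⟨⟨l, f⟩, m, hm⟩ ⟨⟨l', f'⟩, m', hm'⟩ h
  simp only [quasiShuffleMerge, Prod.mk.injEq, Subtype.mk.injEq] at h
  obtain ⟨h₁, h₂⟩ := h
  have hr : Set.range m = Set.range m' := by
    rw [← f.range_comp_union m, ← f'.range_comp_union m', h₁, h₂]
  obtain rfl : l = l' := by
    have := congrArg Set.ncard hr
    rw [← Set.image_univ, ← Set.image_univ, Set.ncard_image_of_injective _ hm.injective,
      Set.ncard_image_of_injective _ hm'.injective] at this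
    simpa [Set.ncard_univ, Fin.ext_iff] using this
  obtain rfl : m = m' := (hm.range_inj hm').1 hr
  obtain rfl : f = f' := Subtype.ext <| Prod.ext (hm.injective.comp_left h₁)
    (hm.injective.comp_left h₂)
  rfl

lemma quasiShuffleMerge_surjective (k k' : ℕ) (α : Type*) [LinearOrder α] :
    Function.Surjective (quasiShuffleMerge k k' α) := by
  rintro ⟨⟨n, hn⟩, ⟨n', hn'⟩⟩
  let S : Finset α := Finset.univ.image n ∪ Finset.univ.image n'
  let m : Fin S.card → α := S.orderEmbOfFin rfl ∘ Fin.rev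
  have hm : StrictAnti m := (S.orderEmbOfFin rfl).strictMono.comp_strictAnti Fin.rev_strictAnti
  have hrange : Set.range m = S := by
    rw [Fin.rev_surjective.range_comp, Finset.range_orderEmbOfFin]
  have hf (i) : ∃ j, m j = n i := hrange.ge (by simp [S])
  have hf' (i) : ∃ j, m j = n' i := hrange.ge (by simp [S])
  choose f hf using hf
  choose f' hf' using hf'
  have hsurj (j) : (∃ i, f i = j) ∨ ∃ i, f' i = j := by
    have : m j ∈ S := Finset.mem_coe.1 (hrange.le ⟨j, rfl⟩)
    simp only [S, Finset.mem_union, Finset.mem_image, Finset.mem_univ, true_and] at this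
    exact this.imp (fun ⟨i, hi⟩ ↦ ⟨i, hm.injective ((hf i).trans hi)⟩)
      (fun ⟨i, hi⟩ ↦ ⟨i, hm.injective ((hf' i).trans hi)⟩)
  let q : QuasiShuffle k k' S.card := ⟨(f, f'),
    fun a b hab ↦ hm.lt_iff_gt.1 (by simpa only [hf] using hn hab),
    fun a b hab ↦ hm.lt_iff_gt.1 (by simpa only [hf'] using hn' hab), hsurj⟩
  exact ⟨⟨⟨⟨S.card, Nat.lt_succ_of_le q.length_le⟩, q⟩, m, hm⟩,
    Prod.ext (Subtype.ext (funext hf)) (Subtype.ext (funext hf'))⟩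

/-- The quasi-shuffle (stuffle) product formula. -/
lemma mzv_mul_mzv {k k' : ℕ} {s : Fin k → ℕ} {s' : Fin k' → ℕ}
    (hs : Summable fun n : {n : Fin k → ℕ+ // StrictAnti n} ↦
      ∏ i, (((n.1 i : ℕ) : ℝ) ^ s i)⁻¹)
    (hs' : Summable fun n : {n : Fin k' → ℕ+ // StrictAnti n} ↦
      ∏ i, (((n.1 i : ℕ) : ℝ) ^ s' i)⁻¹) :
    mzv k s * mzv k' s' = ∑ q : (Σ l : Fin (k + k' + 1), QuasiShuffle k k' l),
      mzv q.1 (q.2.exponent s s') := by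
  let e := Equiv.ofBijective _
    ⟨quasiShuffleMerge_injective k k' ℕ+, quasiShuffleMerge_surjective k k' ℕ+⟩
  have hsum := hs.mul_of_nonneg hs' (fun n ↦ by positivity) (fun n ↦ by positivity)
  rw [mzv, mzv, hs.tsum_mul_tsum hs' hsum, ← e.tsum_eq]
  refine (e.summable_iff.2 hsum).tsum_sigma.trans ?_
  rw [tsum_fintype]
  refine Finset.sum_congr rfl fun q _ ↦ tsum_congr fun m ↦ ?_
  simp only [← inv_pow]
  exact (q.2.prod_pow_exponent s s' fun j ↦ ((m.1 j : ℕ) : ℝ)⁻¹).symm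

lemma IsAdmissible.weight_ne_zero {k : ℕ} {s : Fin k → ℕ} (hs : IsAdmissible k s) :
    ∑ i, s i ≠ 0 := by
  obtain ⟨hk, -, h⟩ := hs
  have := Finset.single_le_sum_of_canonicallyOrdered (f := s) (Finset.mem_univ ⟨0, hk⟩)
  omega

lemma IsAdmissible.mzv_mem_zetaSpan {k : ℕ} {s : Fin k → ℕ} (hs : IsAdmissible k s) :
    mzv k s ∈ zetaSpan (∑ i, s i) := by
  rw [zetaSpan, if_neg hs.weight_ne_zero]
  exact Submodule.subset_span ⟨k, s, hs, rfl, rfl⟩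

lemma IsAdmissible.mzv_mul_mzv_mem {k k' : ℕ} {s : Fin k → ℕ} {s' : Fin k' → ℕ}
    (hs : IsAdmissible k s) (hs' : IsAdmissible k' s') :
    mzv k s * mzv k' s' ∈ zetaSpan ((∑ i, s i) + (∑ i, s' i)) := by
  by_cases h : Summable fun n : {n : Fin k → ℕ+ // StrictAnti n} ↦
      ∏ i, (((n.1 i : ℕ) : ℝ) ^ s i)⁻¹
  swap
  · rw [mzv, tsum_eq_zero_of_not_summable h, zero_mul]
    exact zero_mem _
  by_cases h' : Summable fun n : {n : Fin k' → ℕ+ // StrictAnti n} ↦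
      ∏ i, (((n.1 i : ℕ) : ℝ) ^ s' i)⁻¹
  swap
  · rw [mzv.eq_def k', tsum_eq_zero_of_not_summable h', mul_zero]
    exact zero_mem _
  rw [mzv_mul_mzv h h']
  exact sum_mem fun q _ ↦
    q.2.sum_exponent s s' ▸ (q.2.isAdmissible_exponent hs hs').mzv_mem_zetaSpan

lemma zetaSpan_zero : zetaSpan 0 = 1 := by
  rw [zetaSpan, if_pos rfl, Submodule.one_eq_span]

lemma zetaSpan_mul_le (w w' : ℕ) : zetaSpan w * zetaSpan w' ≤ zetaSpan (w + w') := by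
  rcases eq_or_ne w 0 with rfl | hw
  · rw [zetaSpan_zero, one_mul, zero_add]
  rcases eq_or_ne w' 0 with rfl | hw'
  · rw [zetaSpan_zero, mul_one, add_zero]
  rw [zetaSpan, if_neg hw, zetaSpan, if_neg hw', Submodule.span_mul_span, Submodule.span_le]
  rintro _ ⟨_, ⟨k, s, hs, rfl, rfl⟩, _, ⟨k', s', hs', rfl, rfl⟩, rfl⟩
  exact hs.mzv_mul_mzv_mem hs'

lemma iSup_zetaSpan_mul_le : (⨆ w, zetaSpan w) * (⨆ w, zetaSpan w) ≤ ⨆ w, zetaSpan w := by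
  simp only [Submodule.iSup_mul, Submodule.mul_iSup]
  exact iSup_le fun w ↦ iSup_le fun w' ↦ (zetaSpan_mul_le _ _).trans (le_iSup zetaSpan _)

/-- For admissible compositions `s`, `s'` of weights `w`, `w'`, the product
`ζ(s)·ζ(s')` lies in `𝔷_{w+w'}`; consequently `𝔷_w · 𝔷_{w'} ⊆ 𝔷_{w+w'}` and
`∑_w 𝔷_w` is a `ℚ`-subalgebra of `ℝ`. -/
theorem mzv_mul_mem_zetaSpan :
    (∀ (k : ℕ) (s : Fin k → ℕ) (k' : ℕ) (s' : Fin k' → ℕ),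
      IsAdmissible k s → IsAdmissible k' s' →
      mzv k s * mzv k' s' ∈ zetaSpan ((∑ i, s i) + (∑ i, s' i))) ∧
    (∀ (w w' : ℕ) (x y : ℝ), x ∈ zetaSpan w → y ∈ zetaSpan w' →
      x * y ∈ zetaSpan (w + w')) ∧
    (∃ A : Subalgebra ℚ ℝ, Subalgebra.toSubmodule A = ⨆ w : ℕ, zetaSpan w) := by
  refine ⟨fun k s k' s' hs hs' ↦ hs.mzv_mul_mzv_mem hs',
    fun w w' x y hx hy ↦ zetaSpan_mul_le w w' (Submodule.mul_mem_mul hx hy),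
    (⨆ w, zetaSpan w).toSubalgebra ?_
      fun x y hx hy ↦ iSup_zetaSpan_mul_le (Submodule.mul_mem_mul hx hy),
    Submodule.toSubalgebra_toSubmodule _ _ _⟩
  exact le_iSup zetaSpan 0 (zetaSpan_zero ▸ Submodule.one_le.1 le_rfl)
end
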